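/- Suppose b : ℝ → ℝ is positive with b(T) → 0 as T → ∞, and suppose that for all sufficiently large T, every nontrivial zero ρ = β + iγ of the Riemann zeta function with T < γ ≤ 2T satisfies |β − 1/2| < b(T)/(2 log T). Then, as T → ∞, the number of nontrivial zeros ρ = β + iγ of ζ with T < γ ≤ 2T and β = 1/2 (counted with multiplicity) is at least (2/3 + o(1)) times the total number of nontrivial zeros ρ = β + iγ of ζ with T < γ ≤ 2T (counted with multiplicity). -/

import Mathlib

open Filter Topology MeasureTheory Set

/-- The multiplicity of `ρ` as a zero of the Riemann zeta function:
the least `n` such that the `n`-th iterated derivative of `ζ` is nonzero at `ρ`. -/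
noncomputable def zetaMult (ρ : ℂ) : ℕ :=
  sInf {n : ℕ | iteratedDeriv n riemannZeta ρ ≠ 0}

/-- `ρ` is a nontrivial zero of the Riemann zeta function. -/
def IsNontrivialZero (ρ : ℂ) : Prop :=
  riemannZeta ρ = 0 ∧ 0 < ρ.re ∧ ρ.re < 1

/-- The set of nontrivial zeros `ρ = β + iγ` with `T < γ ≤ 2T`. -/
def zeroBand (T : ℝ) : Set ℂ :=
  {ρ | IsNontrivialZero ρ ∧ T < ρ.im ∧ ρ.im ≤ 2 * T}

/-- Number of nontrivial zeros with `T < γ ≤ 2T`, counted with multiplicity. -/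
noncomputable def Ntot (T : ℝ) : ℝ :=
  ∑ᶠ ρ ∈ zeroBand T, (zetaMult ρ : ℝ)

/-- Number of simple nontrivial zeros with `T < γ ≤ 2T`. -/
noncomputable def Nsimple (T : ℝ) : ℝ :=
  ∑ᶠ ρ ∈ {ρ ∈ zeroBand T | zetaMult ρ = 1}, (1 : ℝ)

/-- Number of nontrivial zeros with `T < γ ≤ 2T` on the critical line, with multiplicity. -/
noncomputable def Nline (T : ℝ) : ℝ :=
  ∑ᶠ ρ ∈ {ρ ∈ zeroBand T | ρ.re = 1/2}, (zetaMult ρ : ℝ)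

/-- Number of simple critical-line nontrivial zeros with `T < γ ≤ 2T`. -/
noncomputable def NlineSimple (T : ℝ) : ℝ :=
  ∑ᶠ ρ ∈ {ρ ∈ zeroBand T | ρ.re = 1/2 ∧ zetaMult ρ = 1}, (1 : ℝ)

noncomputable def xi (s : ℂ) : ℂ := s * (s - 1) * completedRiemannZeta₀ s + 1

lemma xi_diff : Differentiable ℂ xi := by
  unfold xi
  have := differentiable_completedZeta₀
  fun_prop

lemma xi_one_sub (s : ℂ) : xi (1 - s) = xi s := by
  unfold xi
  rw [completedRiemannZeta₀_one_sub]; ring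

lemma xi_eq {s : ℂ} (h0 : s ≠ 0) (h1 : s ≠ 1) : xi s = s * (s - 1) * completedRiemannZeta s := by
  unfold xi
  rw [completedRiemannZeta_eq]
  have : 1 - s ≠ 0 := sub_ne_zero.mpr (Ne.symm h1)
  field_simp
  ring

lemma xi_eq' {s : ℂ} (h0 : 0 < s.re) (h1 : s ≠ 1) :
    xi s = s * (s - 1) * s.Gammaℝ * riemannZeta s := by
  have hs : s ≠ 0 := by rintro rfl; simp at h0
  rw [xi_eq hs h1, riemannZeta_def_of_ne_zero hs]
  have := Complex.Gammaℝ_ne_zero_of_re_pos h0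
  field_simp

lemma xi_zero : xi 0 = 1 := by simp [xi]
lemma xi_one : xi 1 = 1 := by simp [xi]

lemma xi_eq_zero_iff (s : ℂ) : xi s = 0 ↔ IsNontrivialZero s := by
  have key : ∀ s : ℂ, 0 < s.re → xi s = 0 → riemannZeta s = 0 ∧ s.re < 1 := by
    intro s h0 h
    have h1 : s ≠ 1 := by rintro rfl; simp [xi_one] at h
    rw [xi_eq' h0 h1] at h
    have hs : s ≠ 0 := by rintro rfl; simp at h0
    have hz : riemannZeta s = 0 := by
      rcases mul_eq_zero.mp h with h | h
      · exfalso
        exact (mul_ne_zero (mul_ne_zero hs (sub_ne_zero.mpr h1))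
          (Complex.Gammaℝ_ne_zero_of_re_pos h0)) h
      · exact h
    refine ⟨hz, ?_⟩
    by_contra hc
    exact riemannZeta_ne_zero_of_one_le_re (not_lt.mp hc) hz
  constructor
  · intro h
    have h0 : 0 < s.re := by
      by_contra hc
      have := key (1 - s) (by simp; linarith) (by rw [xi_one_sub]; exact h)
      have h2 := this.2
      simp at h2
      linarith
    exact ⟨(key s h0 h).1, h0, (key s h0 h).2⟩
  · rintro ⟨hz, h0, h1⟩
    rw [xi_eq' h0 (by rintro rfl; simp at h1), hz, mul_zero]

lemma norm_Gamma_le {s : ℂ} (hs : 0 < s.re) : ‖Complex.Gamma s‖ ≤ Real.Gamma s.re := by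
  rw [Complex.Gamma_eq_integral hs, Real.Gamma_eq_integral hs, Complex.GammaIntegral]
  refine (norm_integral_le_integral_norm _).trans (le_of_eq ?_)
  refine setIntegral_congr_fun measurableSet_Ioi fun x hx => ?_
  have hx : 0 < x := hx
  simp only [norm_mul, Complex.norm_cpow_eq_rpow_re_of_pos hx, Complex.norm_real, Complex.sub_re,
    Complex.one_re, Real.norm_eq_abs, Real.abs_exp]

lemma Gamma_le_exp : ∃ C : ℝ, 0 < C ∧ ∀ x : ℝ, 1 ≤ x → Real.Gamma x ≤ Real.exp (C * x ^ (3/2 : ℝ)) := by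
  refine ⟨2 * 3 ^ (3/2 : ℝ), by positivity, fun x hx => ?_⟩
  set n := ⌈x⌉₊ with hn
  have hxn : x ≤ n := Nat.le_ceil x
  have hnx : (n : ℝ) < x + 1 := Nat.ceil_lt_add_one (by linarith)
  have h1 : Real.Gamma x ≤ Real.Gamma (n + 2) := by
    have e : Real.Gamma x ≤ Real.Gamma (x + 1) ∨ x < 2 := by
      rcases lt_or_ge x 2 with h | h
      · right; exact h
      · left
        exact Real.Gamma_strictMonoOn_Ici.monotoneOn (by simpa using h) (by simp; linarith) (by linarith)
    rcases e with e | e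
    · exact e.trans (Real.Gamma_strictMonoOn_Ici.monotoneOn (by simp; linarith) (by simp) (by linarith))
    · have : Real.Gamma x ≤ 1 := by
        obtain ⟨_, hc⟩ := Real.convexOn_Gamma
        have := hc (x := 1) (y := 2) (by simp) (by simp) (a := 2 - x) (b := x - 1)
          (by linarith) (by linarith) (by ring)
        simp only [smul_eq_mul, Real.Gamma_one, Real.Gamma_two] at this
        have e2 : (2 - x) * 1 + (x - 1) * 2 = x := by ring
        rw [e2] at this
        linarith
      refine this.trans ?_
      rw [← Real.Gamma_two]
      exact Real.Gamma_strictMonoOn_Ici.monotoneOn (by simp) (by simp) (by simp)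
  have h2 : Real.Gamma (n + 2) ≤ ((n : ℝ) + 1) ^ (n + 1) := by
    have := Real.Gamma_nat_eq_factorial (n + 1)
    push_cast at this
    rw [show (n : ℝ) + 2 = n + 1 + 1 by ring, this]
    exact_mod_cast Nat.factorial_le_pow (n + 1)
  have h3 : ((n : ℝ) + 1) ^ (n + 1) = Real.exp (Real.log (n + 1) * (n + 1)) := by
    rw [← Real.rpow_def_of_pos (by positivity)]
    rw [← Real.rpow_natCast]; push_cast; rfl
  refine h1.trans (h2.trans ?_)
  rw [h3]
  refine Real.exp_le_exp.mpr ?_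
  have h4 := Real.log_le_rpow_div (x := (n : ℝ) + 1) (ε := 1/2) (by positivity) (by norm_num)
  have h5 : ((n : ℝ) + 1) ≤ 3 * x := by linarith
  have h6 : ((n : ℝ) + 1) ^ (1/2 : ℝ) * (n + 1) = ((n : ℝ) + 1) ^ (3/2 : ℝ) := by
    nth_rewrite 2 [← Real.rpow_one ((n : ℝ) + 1)]
    rw [← Real.rpow_add (by positivity)]; norm_num
  have h7 : ((n : ℝ) + 1) ^ (3/2 : ℝ) ≤ 3 ^ (3/2 : ℝ) * x ^ (3/2 : ℝ) := by
    rw [← Real.mul_rpow (by norm_num) (by linarith)]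
    gcongr
  have h8 := mul_le_mul_of_nonneg_right h4 (show 0 ≤ (n : ℝ) + 1 by positivity)
  have h9 : ((n : ℝ) + 1) ^ (1/2 : ℝ) / (1/2) * (n + 1) = 2 * (((n : ℝ) + 1) ^ (1/2 : ℝ) * (n + 1)) := by ring
  rw [h9, h6] at h8
  linarith

lemma norm_zeta_le : ∃ C : ℝ, 0 < C ∧ ∀ s : ℂ, 2 ≤ s.re → ‖riemannZeta s‖ ≤ C := by
  have hsum : Summable fun n : ℕ => 1 / ((n : ℝ) + 1) ^ (2 : ℝ) := by
    have := (Real.summable_one_div_nat_rpow (p := 2)).mpr (by norm_num)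
    have := (summable_nat_add_iff 1).mpr this
    simpa using this
  refine ⟨∑' n : ℕ, 1 / ((n : ℝ) + 1) ^ (2 : ℝ), ?_, fun s hs => ?_⟩
  · refine hsum.tsum_pos (fun n => by positivity) 0 (by positivity)
  rw [zeta_eq_tsum_one_div_nat_add_one_cpow (by linarith)]
  refine tsum_of_norm_bounded hsum.hasSum fun n => ?_
  rw [norm_div, norm_one]
  have : ‖((n : ℂ) + 1) ^ s‖ = ((n : ℝ) + 1) ^ s.re := by
    have := Complex.norm_cpow_eq_rpow_re_of_pos (x := (n : ℝ) + 1) (by positivity) s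
    push_cast at this
    exact this
  rw [this]
  gcongr
  linarith

lemma Lambda0_strip : ∃ C : ℝ, 0 < C ∧ ∀ s : ℂ, 1/2 ≤ s.re → s.re ≤ 2 → ‖completedRiemannZeta₀ s‖ ≤ C := by
  set P := (HurwitzZeta.hurwitzEvenFEPair 0)
  have hc : ∀ s : ℂ, MellinConvergent P.f_modif s := fun s =>
    (P.isStrongFEPair_toStrongFEPair.hasMellin s).1
  have hi : ∀ a : ℝ, IntegrableOn (fun t : ℝ => t ^ (a - 1) * ‖P.f_modif t‖) (Ioi 0) := by
    intro a
    have h0 := IntegrableOn.congr_fun (hc a).norm (g := fun t : ℝ => t ^ (a - 1) * ‖P.f_modif t‖) (fun t ht => ?_) measurableSet_Ioi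
    · exact h0
    simp only [norm_smul]
    rw [Complex.norm_cpow_eq_rpow_re_of_pos ht]
    simp
  set I := ∫ t in Ioi (0 : ℝ), (t ^ ((1/4 : ℝ) - 1) * ‖P.f_modif t‖ + t ^ ((1 : ℝ) - 1) * ‖P.f_modif t‖) with hI
  have hI0 : 0 ≤ I := setIntegral_nonneg measurableSet_Ioi fun t ht => by
    have : 0 < t := ht
    positivity
  refine ⟨I + 1, by positivity, fun s h1 h2 => ?_⟩
  have : completedRiemannZeta₀ s = mellin P.f_modif (s / 2) / 2 := rfl
  rw [this, norm_div]
  have hb : ‖mellin P.f_modif (s / 2)‖ ≤ I := by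
    unfold mellin
    refine norm_integral_le_of_norm_le ((hi _).add (hi _)) ?_
    refine (ae_restrict_iff' measurableSet_Ioi).mpr (Eventually.of_forall fun t ht => ?_)
    have ht : 0 < t := ht
    rw [norm_smul, Complex.norm_cpow_eq_rpow_re_of_pos ht, ← add_mul]
    refine mul_le_mul_of_nonneg_right ?_ (norm_nonneg _)
    have hre : (s / 2 - 1).re = s.re / 2 - 1 := by simp
    rw [hre]
    rcases le_total t 1 with h | h
    · have := Real.rpow_le_rpow_of_exponent_ge ht h (show (1/4 : ℝ) - 1 ≤ s.re / 2 - 1 by linarith)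
      exact le_add_of_le_of_nonneg this (Real.rpow_nonneg ht.le _)
    · have := Real.rpow_le_rpow_of_exponent_le h (show s.re / 2 - 1 ≤ (1 : ℝ) - 1 by linarith)
      exact le_add_of_nonneg_of_le (Real.rpow_nonneg ht.le _) this
  simp only [Complex.norm_ofNat]
  linarith

lemma xi_growth : ∃ C : ℝ, 0 < C ∧ ∀ R : ℝ, 2 ≤ R → ∀ s : ℂ, ‖s‖ ≤ R →
    ‖xi s‖ ≤ Real.exp (C * R ^ (3/2 : ℝ)) := by
  obtain ⟨C1, hC1, h1⟩ := Gamma_le_exp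
  obtain ⟨C2, hC2, h2⟩ := norm_zeta_le
  obtain ⟨C3, hC3, h3⟩ := Lambda0_strip
  have key : ∀ R : ℝ, 3 ≤ R → ∀ s : ℂ, ‖s‖ ≤ R → 1/2 ≤ s.re →
      ‖xi s‖ ≤ Real.exp ((C1 + C2 + C3 + 3) * R ^ (3/2 : ℝ)) := by
    intro R hR s hs hre
    have hRR : R ≤ R ^ (3/2 : ℝ) := by
      conv_lhs => rw [← Real.rpow_one R]
      exact Real.rpow_le_rpow_of_exponent_le (by linarith) (by norm_num)
    set Q := R ^ (3/2 : ℝ) with hQ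
    have hs1 : ‖s - 1‖ ≤ R + 1 := (norm_sub_le _ _).trans (by simpa using hs)
    have hq : ‖s‖ * ‖s - 1‖ ≤ Real.exp (2 * Q) := by
      have e1 := Real.add_one_le_exp R
      have : Real.exp (2 * Q) = Real.exp Q * Real.exp Q := by rw [← Real.exp_add]; ring_nf
      rw [this]
      have e2 := Real.exp_le_exp.mpr hRR
      exact mul_le_mul (by linarith) (by linarith) (norm_nonneg _) (by positivity)
    have fin : ∀ D : ℝ, 0 ≤ D → D ≤ C1 + C2 + C3 → ∀ z : ℂ, ‖z‖ ≤ Real.exp (D * Q) →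
        ‖s * (s - 1) * z‖ + 1 ≤ Real.exp ((C1 + C2 + C3 + 3) * Q) := by
      intro D hD hD2 z hz
      have h0 : ‖s * (s - 1) * z‖ ≤ Real.exp ((2 + D) * Q) := by
        rw [norm_mul, norm_mul, add_mul, Real.exp_add]
        gcongr
      have h5 : Real.exp ((C1 + C2 + C3 + 3) * Q) ≥ Real.exp ((2 + D) * Q) * Real.exp Q := by
        rw [← Real.exp_add]
        refine Real.exp_le_exp.mpr ?_
        nlinarith
      have h6 := Real.add_one_le_exp Q
      have h7 : 1 ≤ Real.exp ((2 + D) * Q) := Real.one_le_exp (by nlinarith)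
      nlinarith
    rcases le_total s.re 2 with h | h
    · unfold xi
      refine (norm_add_le _ _).trans ?_
      rw [norm_one]
      refine fin C3 hC3.le (by linarith) _ ((h3 s hre h).trans ?_)
      have := Real.add_one_le_exp (C3 * Q)
      nlinarith
    · have hs0 : s ≠ 0 := by rintro rfl; rw [Complex.zero_re] at h; linarith
      have hs1 : s ≠ 1 := by rintro rfl; rw [Complex.one_re] at h; linarith
      have e : ‖s * (s - 1) * completedRiemannZeta s‖ + 1 ≤ Real.exp ((C1 + C2 + C3 + 3) * Q) := by
        refine fin (C1 + C2) (by positivity) (by linarith) _ ?_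
        have hz : completedRiemannZeta s = s.Gammaℝ * riemannZeta s := by
          rw [riemannZeta_def_of_ne_zero hs0]
          have := Complex.Gammaℝ_ne_zero_of_re_pos (show 0 < s.re by linarith)
          field_simp
        rw [hz, norm_mul, add_mul, Real.exp_add]
        refine mul_le_mul ?_ ?_ (norm_nonneg _) (by positivity)
        · rw [Complex.Gammaℝ_def, norm_mul, Complex.norm_cpow_eq_rpow_re_of_pos Real.pi_pos]
          have g1 : Real.pi ^ (-s / 2).re ≤ 1 := by
            refine Real.rpow_le_one_of_one_le_of_nonpos (by linarith [Real.pi_gt_three]) ?_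
            simp; linarith
          have g2 := norm_Gamma_le (s := s / 2) (by simp; linarith)
          have g3 := h1 (s / 2).re (by simp; linarith)
          have g4 : (s / 2).re ≤ R := by
            have := Complex.re_le_norm s
            simp; linarith
          have g5 : Real.exp (C1 * (s / 2).re ^ (3/2 : ℝ)) ≤ Real.exp (C1 * Q) := by
            refine Real.exp_le_exp.mpr ?_
            have : 0 ≤ (s / 2).re := by simp; linarith
            rw [hQ]; gcongr
          calc _ ≤ 1 * Real.exp (C1 * Q) := mul_le_mul g1 (by linarith) (norm_nonneg _) (by norm_num)
            _ = _ := one_mul _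
        · have := Real.add_one_le_exp (C2 * Q)
          have := h2 s h
          nlinarith
      rw [xi_eq hs0 hs1]
      linarith
  refine ⟨(C1 + C2 + C3 + 3) * 2 ^ (3/2 : ℝ), by positivity, fun R hR s hs => ?_⟩
  have hR2 : (R + 1) ^ (3/2 : ℝ) ≤ 2 ^ (3/2 : ℝ) * R ^ (3/2 : ℝ) := by
    rw [← Real.mul_rpow (by norm_num) (by linarith)]
    exact Real.rpow_le_rpow (by linarith) (by linarith) (by norm_num)
  have hle : Real.exp ((C1 + C2 + C3 + 3) * (R + 1) ^ (3/2 : ℝ)) ≤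
      Real.exp ((C1 + C2 + C3 + 3) * 2 ^ (3/2 : ℝ) * R ^ (3/2 : ℝ)) := by
    rw [mul_assoc]
    exact Real.exp_le_exp.mpr (mul_le_mul_of_nonneg_left hR2 (by positivity))
  rcases le_total (1/2) s.re with h | h
  · exact (key (R + 1) (by linarith) s (by linarith) h).trans hle
  · rw [← xi_one_sub]
    refine (key (R + 1) (by linarith) (1 - s) ?_ (by simp; linarith)).trans hle
    have := norm_sub_le 1 s
    rw [norm_one] at this
    linarith

lemma iteratedDeriv_zeta_conj (n : ℕ) (s : ℂ) :
    iteratedDeriv n riemannZeta (starRingEnd ℂ s) = starRingEnd ℂ (iteratedDeriv n riemannZeta s) := by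
  induction n generalizing s with
  | zero => simp [riemannZeta_conj]
  | succ n ih =>
    rw [iteratedDeriv_succ]
    have h : iteratedDeriv n riemannZeta = starRingEnd ℂ ∘ iteratedDeriv n riemannZeta ∘ starRingEnd ℂ := by
      funext z
      simp [ih]
    conv_lhs => rw [h]
    rw [deriv_conj_conj]
    simp

lemma zetaMult_conj (ρ : ℂ) : zetaMult (starRingEnd ℂ ρ) = zetaMult ρ := by
  unfold zetaMult
  congr 1
  ext n
  simp [iteratedDeriv_zeta_conj]

lemma analyticAt_zeta {s : ℂ} (h1 : s ≠ 1) : AnalyticAt ℂ riemannZeta s := by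
  refine DifferentiableOn.analyticAt (s := {1}ᶜ) ?_ (isOpen_compl_singleton.mem_nhds h1)
  exact fun z hz => (differentiableAt_riemannZeta hz).differentiableWithinAt

lemma xi_order_ne_top (s : ℂ) : analyticOrderAt xi s ≠ ⊤ := by
  intro h
  rw [analyticOrderAt_eq_top] at h
  have hA : AnalyticOnNhd ℂ xi univ := fun z _ => xi_diff.analyticAt z
  have := hA.eqOn_zero_of_preconnected_of_eventuallyEq_zero isPreconnected_univ (mem_univ s) h
  have := this (mem_univ 0)
  rw [xi_zero] at this
  simp at this

lemma xi_order {ρ : ℂ} (h : IsNontrivialZero ρ) : analyticOrderAt xi ρ = zetaMult ρ := by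
  obtain ⟨hz, h0, h1⟩ := h
  have hne1 : ρ ≠ 1 := by rintro rfl; simp at h1
  have hne0 : ρ ≠ 0 := by rintro rfl; simp at h0
  have hev : xi =ᶠ[𝓝 ρ] (fun s => s * (s - 1) * s.Gammaℝ) * riemannZeta := by
    have o : IsOpen {s : ℂ | 0 < s.re ∧ s ≠ 1} :=
      (isOpen_lt continuous_const Complex.continuous_re).inter isOpen_compl_singleton
    filter_upwards [o.mem_nhds ⟨h0, hne1⟩] with s hs
    exact xi_eq' hs.1 hs.2
  have hG : AnalyticAt ℂ (fun s => s * (s - 1) * s.Gammaℝ) ρ := by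
    refine DifferentiableOn.analyticAt (s := {s : ℂ | 0 < s.re}) ?_
      ((isOpen_lt continuous_const Complex.continuous_re).mem_nhds h0)
    intro s hs
    have : DifferentiableAt ℂ Complex.Gammaℝ s := by
      have e : Complex.Gammaℝ = fun s => (Real.pi : ℂ) ^ (-s / 2) * Complex.Gamma (s / 2) := by
        funext s; exact Complex.Gammaℝ_def s
      rw [e]
      have hp : (Real.pi : ℂ) ≠ 0 := by exact_mod_cast Real.pi_pos.ne'
      have hg : DifferentiableAt ℂ Complex.Gamma (s / 2) := by
        refine Complex.differentiableAt_Gamma _ fun m hm => ?_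
        have := congrArg Complex.re hm
        simp at this
        have hs : 0 < s.re := hs
        have : (0 : ℝ) ≤ m := by positivity
        linarith
      refine DifferentiableAt.mul ?_ ?_
      · refine DifferentiableAt.const_cpow (by fun_prop) (Or.inl hp)
      · exact hg.comp (f := fun s : ℂ => s / 2) s (by fun_prop)
    exact (by fun_prop : DifferentiableAt ℂ _ s).differentiableWithinAt
  have hG0 : analyticOrderAt (fun s => s * (s - 1) * s.Gammaℝ) ρ = 0 := by
    rw [hG.analyticOrderAt_eq_zero]
    exact mul_ne_zero (mul_ne_zero hne0 (sub_ne_zero.mpr hne1)) (Complex.Gammaℝ_ne_zero_of_re_pos h0)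
  have hZ := analyticAt_zeta hne1
  have ho : analyticOrderAt xi ρ = analyticOrderAt riemannZeta ρ := by
    rw [analyticOrderAt_congr hev, analyticOrderAt_mul hG hZ, hG0, zero_add]
  rw [ho]
  have hnt : analyticOrderAt riemannZeta ρ ≠ ⊤ := ho ▸ xi_order_ne_top ρ
  obtain ⟨n, hn⟩ := ENat.ne_top_iff_exists.mp hnt
  rw [← hn]
  congr 1
  have := (analyticOrderAt_eq_nat_iff_iteratedDeriv_eq_zero hZ).mp hn.symm
  unfold zetaMult
  refine le_antisymm ?_ ?_
  · refine le_csInf ⟨n, this.2⟩ fun m hm => ?_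
    by_contra hc
    exact hm (this.1 m (by omega))
  · exact Nat.sInf_le this.2

lemma nz_one_sub {ρ : ℂ} (h : IsNontrivialZero ρ) : IsNontrivialZero (1 - ρ) := by
  rw [← xi_eq_zero_iff, xi_one_sub, xi_eq_zero_iff]; exact h

lemma nz_conj {ρ : ℂ} (h : IsNontrivialZero ρ) : IsNontrivialZero (starRingEnd ℂ ρ) := by
  obtain ⟨hz, h0, h1⟩ := h
  exact ⟨by rw [riemannZeta_conj, hz, map_zero], by simpa using h0, by simpa using h1⟩

lemma zetaMult_one_sub {ρ : ℂ} (h : IsNontrivialZero ρ) : zetaMult (1 - ρ) = zetaMult ρ := by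
  have h1 := xi_order h
  have h2 := xi_order (nz_one_sub h)
  have h3 : xi = xi ∘ (fun s => 1 - s) := by funext s; simp [xi_one_sub]
  have h4 : analyticOrderAt (xi ∘ (fun s => 1 - s)) ρ = analyticOrderAt xi (1 - ρ) := by
    refine analyticOrderAt_comp_of_deriv_ne_zero (g := fun s : ℂ => 1 - s) ?_ ?_
    · exact analyticAt_const.sub analyticAt_id
    · simp
  rw [← h3, h1, h2] at h4
  exact_mod_cast h4.symm

lemma zetaMult_pos {ρ : ℂ} (h : IsNontrivialZero ρ) : 0 < zetaMult ρ := by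
  have h1 := xi_order h
  have h2 : analyticOrderAt xi ρ ≠ 0 := by
    rw [(xi_diff.analyticAt ρ).analyticOrderAt_ne_zero]
    exact (xi_eq_zero_iff ρ).mpr h
  rw [h1] at h2
  exact Nat.pos_of_ne_zero (by exact_mod_cast h2)

lemma nz_finite (K : Set ℂ) (hK : Bornology.IsBounded K) : {ρ ∈ K | IsNontrivialZero ρ}.Finite := by
  have hc : IsCompact (closure K) := hK.isCompact_closure
  exact hc.inter_riemannZetaZeros_finite.subset fun ρ h => ⟨subset_closure h.1, h.2.1⟩

lemma small_log (g : ℂ → ℂ) (hd : Differentiable ℂ g) (hev : ∀ w, g (-w) = g w) {R B : ℝ}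
    (hR : 0 < R) (hB : 0 < B) (hg : ∀ w ∈ Metric.ball (0 : ℂ) R, g w ≠ 0)
    (hb : ∀ w ∈ Metric.ball (0 : ℂ) R, ‖g w‖ ≤ ‖g 0‖ * Real.exp B) (w : ℂ) (hw : ‖w‖ < R / 2) :
    |Real.log ‖g w‖ - Real.log ‖g 0‖| ≤ 2 * B * (‖w‖ / (R / 2)) ^ 2 := by
  have hd' : Differentiable ℂ (deriv g) := fun z =>
    ((hd.analyticAt z).deriv).differentiableAt
  have hq : DifferentiableOn ℂ (fun z => deriv g z / g z) (Metric.ball 0 R) := fun z hz =>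
    ((hd' z).div (hd z) (hg z hz)).differentiableWithinAt
  obtain ⟨l, hl0, hl⟩ := (hq.isExactOn_ball).with_val_at 0 0
  have h0mem : (0 : ℂ) ∈ Metric.ball (0 : ℂ) R := by simpa using hR
  have hgl : ∀ z ∈ Metric.ball (0 : ℂ) R, g z = g 0 * Complex.exp (l z) := by
    have hder : ∀ z ∈ Metric.ball (0 : ℂ) R, HasDerivAt (fun z => g z * Complex.exp (- l z)) 0 z := by
      intro z hz
      have h1 := (hd z).hasDerivAt.mul ((hl z hz).neg.cexp)
      convert! h1 using 1
      have := hg z hz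
      field_simp
      ring
    have hc : ∀ z ∈ Metric.ball (0 : ℂ) R, g z * Complex.exp (- l z) = g 0 * Complex.exp (- l 0) := by
      intro z hz
      refine (convex_ball (0 : ℂ) R).is_const_of_fderivWithin_eq_zero (𝕜 := ℂ)
        (f := fun z => g z * Complex.exp (- l z)) ?_ ?_ hz h0mem
      · exact fun z hz => (hder z hz).differentiableAt.differentiableWithinAt
      · intro z hz
        rw [fderivWithin_of_isOpen Metric.isOpen_ball hz, (hder z hz).hasFDerivAt.fderiv]
        ext; simp
    intro z hz
    have := hc z hz
    rw [hl0, neg_zero, Complex.exp_zero, mul_one] at this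
    rw [← this, mul_assoc, ← Complex.exp_add]
    simp
  have hg0 : 0 < ‖g 0‖ := norm_pos_iff.mpr (hg 0 h0mem)
  have hre : ∀ z ∈ Metric.ball (0 : ℂ) R, Real.log ‖g z‖ - Real.log ‖g 0‖ = (l z).re := by
    intro z hz
    rw [hgl z hz, norm_mul, Complex.norm_exp, Real.log_mul hg0.ne' (Real.exp_pos _).ne', Real.log_exp]
    ring
  have hld : DifferentiableOn ℂ l (Metric.ball 0 R) := fun z hz => (hl z hz).differentiableAt.differentiableWithinAt
  have hsub : Metric.ball (0 : ℂ) (R / 2) ⊆ Metric.ball 0 R := Metric.ball_subset_ball (by linarith)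
  have hbc : ∀ z ∈ Metric.ball (0 : ℂ) (R / 2), ‖l z‖ ≤ 2 * B := by
    intro z hz
    have h1 := Complex.borelCaratheodory_zero (M := B) hB hld (fun z hz => ?_) hR (hsub hz) hl0
    · refine h1.trans ?_
      have hz' : ‖z‖ < R / 2 := by simpa using hz
      rw [div_le_iff₀ (by linarith)]
      nlinarith
    · simp only [mem_ofPred_eq]
      rw [← hre z hz]
      have := hb z hz
      have h2 := Real.log_le_log (norm_pos_iff.mpr (hg z hz)) this
      rw [Real.log_mul hg0.ne' (Real.exp_pos _).ne', Real.log_exp] at h2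
      linarith
  have hdg0 : deriv g 0 = 0 := by
    have h1 : HasDerivAt (fun w => g (-w)) (deriv g 0 * (-1)) 0 := by
      have := HasDerivAt.comp (h₂ := g) (h := fun w : ℂ => -w) (h₂' := deriv g 0) (0 : ℂ)
        (by simpa using (hd 0).hasDerivAt) (hasDerivAt_neg 0)
      exact this
    have h2 : (fun w => g (-w)) = g := funext hev
    rw [h2] at h1
    have := h1.unique (hd 0).hasDerivAt
    have h3 : (2 : ℂ) * deriv g 0 = 0 := by linear_combination -this
    simpa using h3
  have hlo : (fun z => l z - l 0) =o[𝓝 0] (fun w : ℂ => ‖w - 0‖ ^ 1) := by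
    have := (hl 0 h0mem).isLittleO
    rw [hdg0] at this
    simp only [zero_div, smul_zero, sub_zero] at this
    simpa using this.norm_right
  have := Complex.dist_le_mul_div_pow_of_mapsTo_ball_of_isLittleO (R₂ := 2 * B) (hld.mono hsub)
    (fun z hz => by simpa [hl0] using hbc z hz) hlo (z := w) (by simpa using hw)
  rw [hl0] at this
  simp only [dist_zero_right] at this
  have hw' : w ∈ Metric.ball (0 : ℂ) R := hsub (by simpa using hw)
  rw [hre w hw']
  exact (Complex.abs_re_le_norm _).trans this

lemma factor_one (f : ℂ → ℂ) (hf : Differentiable ℂ f) (a : ℂ) (ha : analyticOrderAt f a ≠ ⊤) :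
    ∃ g : ℂ → ℂ, Differentiable ℂ g ∧ (∀ w, f w = (w - a) ^ analyticOrderNatAt f a * g w) ∧ g a ≠ 0 := by
  classical
  obtain ⟨h, hh, hha, hev⟩ := ((hf.analyticAt a).analyticOrderNatAt_eq_iff ha).mp rfl
  set n := analyticOrderNatAt f a
  refine ⟨fun w => if w = a then h a else f w / (w - a) ^ n, ?_, ?_, by simpa using hha⟩
  · intro z
    by_cases hz : z = a
    · subst hz
      refine hh.differentiableAt.congr_of_eventuallyEq ?_
      filter_upwards [hev] with w hw
      by_cases hwz : w = z
      · simp [hwz]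
      · simp only [hwz, if_false, hw, smul_eq_mul]
        have : (w - z) ^ n ≠ 0 := pow_ne_zero _ (sub_ne_zero.mpr hwz)
        field_simp
    · have hd : DifferentiableAt ℂ (fun w => f w / (w - a) ^ n) z :=
        (hf z).div (by fun_prop) (pow_ne_zero _ (sub_ne_zero.mpr hz))
      refine hd.congr_of_eventuallyEq ?_
      filter_upwards [isOpen_compl_singleton.mem_nhds hz] with w hw
      have hw : w ≠ a := hw
      simp [hw]
  · intro w
    by_cases hw : w = a
    · subst hw
      simpa using hev.self_of_nhds
    · simp only [hw, if_false]
      have : (w - a) ^ n ≠ 0 := pow_ne_zero _ (sub_ne_zero.mpr hw)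
      field_simp

lemma factor_many (f : ℂ → ℂ) (hf : Differentiable ℂ f) (ha : ∀ a, analyticOrderAt f a ≠ ⊤)
    (F : Finset ℂ) :
    ∃ g : ℂ → ℂ, Differentiable ℂ g ∧
      (∀ w, f w = (∏ a ∈ F, (w - a) ^ analyticOrderNatAt f a) * g w) ∧ ∀ a ∈ F, g a ≠ 0 := by
  classical
  induction F using Finset.induction_on with
  | empty => exact ⟨f, hf, by simp, by simp⟩
  | insert a F haF ih =>
    obtain ⟨g, hg, hfg, hne⟩ := ih
    set P : ℂ → ℂ := fun w => ∏ a ∈ F, (w - a) ^ analyticOrderNatAt f a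
    have hP : Differentiable ℂ P := by fun_prop
    have hPa : P a ≠ 0 := Finset.prod_ne_zero_iff.mpr fun b hb =>
      pow_ne_zero _ (sub_ne_zero.mpr fun h => haF (h ▸ hb))
    have hfg' : f = P * g := funext hfg
    have hord : analyticOrderAt f a = analyticOrderAt g a := by
      conv_lhs => rw [hfg']
      rw [analyticOrderAt_mul (hP.analyticAt a) (hg.analyticAt a),
        (hP.analyticAt a).analyticOrderAt_eq_zero.mpr hPa, zero_add]
    obtain ⟨k, hk, hgk, hka⟩ := factor_one g hg a (hord ▸ ha a)
    have hn : analyticOrderNatAt g a = analyticOrderNatAt f a := by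
      unfold analyticOrderNatAt; rw [hord]
    refine ⟨k, hk, fun w => ?_, fun b hb => ?_⟩
    · rw [Finset.prod_insert haF, hfg w, hgk w, hn]; ring
    · rcases Finset.mem_insert.mp hb with rfl | hb
      · exact hka
      · intro h
        have := hne b hb
        rw [hgk b, h, mul_zero] at this
        exact this rfl

theorem hadamard_limit (f : ℂ → ℂ) (hf : Differentiable ℂ f) (hev : ∀ w, f (-w) = f w)
    (ha : ∀ a, analyticOrderAt f a ≠ ⊤) (C R0 : ℝ) (hC : 0 < C)
    (hgr : ∀ R : ℝ, R0 ≤ R → ∀ w, ‖w‖ ≤ R → ‖f w‖ ≤ Real.exp (C * R ^ (3/2 : ℝ)))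
    (hfin : ∀ R : ℝ, {w | f w = 0 ∧ ‖w‖ ≤ R}.Finite) (w1 w2 : ℂ) (h1 : f w1 ≠ 0) (h2 : f w2 ≠ 0) :
    Tendsto (fun R : ℝ => ∑ a ∈ (hfin R).toFinset,
      (analyticOrderNatAt f a : ℝ) * (Real.log ‖w1 - a‖ - Real.log ‖w2 - a‖)) atTop
      (𝓝 (Real.log ‖f w1‖ - Real.log ‖f w2‖)) := by
  classical
  set m : ℂ → ℕ := fun a => analyticOrderNatAt f a with hm
  have hmev : ∀ a, m (-a) = m a := by
    intro a
    have h3 : f ∘ (fun s => - s) = f := by funext s; simp [hev]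
    have h4 : analyticOrderAt (f ∘ (fun s => -s)) a = analyticOrderAt f (-a) := by
      refine analyticOrderAt_comp_of_deriv_ne_zero (g := fun s : ℂ => -s) ?_ ?_
      · exact analyticAt_id.neg
      · simp
    rw [h3] at h4
    simp only [hm, analyticOrderNatAt, h4]
  have hm0 : ∀ a, f a ≠ 0 → m a = 0 := by
    intro a h
    by_contra hc
    exact h (apply_eq_zero_of_analyticOrderNatAt_ne_zero hc)
  obtain ⟨k, hk, hfk, hk0⟩ := factor_one f hf 0 (ha 0)
  have main : ∀ R : ℝ, R0 ≤ R → 1 ≤ R → 2 * ‖w1‖ < R → 2 * ‖w2‖ < R →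
      |(Real.log ‖f w1‖ - Real.log ‖f w2‖) - ∑ a ∈ (hfin R).toFinset,
      (m a : ℝ) * (Real.log ‖w1 - a‖ - Real.log ‖w2 - a‖)| ≤
      (2 * (C * (2 * R) ^ (3/2 : ℝ) + |Real.log ‖k 0‖| + 1) / (R / 2) ^ 2) * (‖w1‖ ^ 2 + ‖w2‖ ^ 2) := by
    intro R hR0 hR1 hw1 hw2
    set F := (hfin R).toFinset with hF
    set G := insert 0 F with hG
    have hGsym : ∀ a ∈ G, -a ∈ G := by
      intro a ha
      simp only [hG, hF, Finset.mem_insert, Set.Finite.mem_toFinset, mem_ofPred_eq, neg_eq_zero] at ha ⊢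
      rwa [hev, norm_neg]
    have hGn : ∀ a ∈ G, ‖a‖ ≤ R := by
      intro a ha
      simp only [hG, hF, Finset.mem_insert, Set.Finite.mem_toFinset, mem_ofPred_eq] at ha
      rcases ha with rfl | ha
      · simp; linarith
      · exact ha.2
    obtain ⟨g, hg, hfg, hgG⟩ := factor_many f hf ha G
    set P : ℂ → ℂ := fun w => ∏ a ∈ G, (w - a) ^ m a with hP
    have hfg : ∀ w, f w = P w * g w := hfg
    have hPd : Differentiable ℂ P := by fun_prop
    have hPne : ∀ w, w ∉ G → P w ≠ 0 := fun w hw => Finset.prod_ne_zero_iff.mpr fun b hb =>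
      pow_ne_zero _ (sub_ne_zero.mpr fun h => hw (h ▸ hb))
    have hdense : Dense ((G : Set ℂ)ᶜ) := by
      exact (Finset.countable_toSet G).dense_compl ℝ
    set c : ℂ := ∏ a ∈ G, (-1 : ℂ) ^ m a with hc
    have hPev : ∀ w, P (-w) = c * P w := by
      intro w
      have : P w = ∏ a ∈ G, (w + a) ^ m a := by
        refine Finset.prod_nbij' (fun a => -a) (fun a => -a) hGsym hGsym (by simp) (by simp) ?_
        intro a _
        rw [hmev, sub_eq_add_neg]
      rw [this, hc, ← Finset.prod_mul_distrib]
      refine Finset.prod_congr rfl fun a _ => ?_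
      rw [← mul_pow]; ring
    have hgev0 : ∀ w, g w = c * g (-w) := by
      have : g = fun w => c * g (-w) := by
        refine Continuous.ext_on hdense hg.continuous (by have := hg.continuous; fun_prop) ?_
        intro w hw
        have e1 := hfg w
        have e2 := hfg (-w)
        rw [hev, hPev, e1] at e2
        have : P w * (g w - c * g (-w)) = 0 := by linear_combination e2
        rcases mul_eq_zero.mp this with h | h
        · exact absurd h (hPne w hw)
        · exact sub_eq_zero.mp h
      exact fun w => congrFun this w
    have h0G : (0 : ℂ) ∈ G := Finset.mem_insert_self _ _
    have hg0 : g 0 ≠ 0 := hgG 0 h0G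
    have hc1 : c = 1 := by
      have := hgev0 0
      rw [neg_zero] at this
      have : (c - 1) * g 0 = 0 := by linear_combination -this
      rcases mul_eq_zero.mp this with h | h
      · exact sub_eq_zero.mp h
      · exact absurd h hg0
    have hgev : ∀ w, g (-w) = g w := fun w => by
      have := hgev0 w
      rw [hc1, one_mul] at this
      exact this.symm
    have hgne : ∀ w, ‖w‖ ≤ R → g w ≠ 0 := by
      intro w hw h
      have : w ∉ G := fun h' => hgG w h' h
      apply this
      simp only [hG, hF, Finset.mem_insert, Set.Finite.mem_toFinset, mem_ofPred_eq]
      right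
      exact ⟨by rw [hfg, h, mul_zero], hw⟩
    set Q : ℂ → ℂ := fun w => ∏ a ∈ G.erase 0, (w - a) ^ m a with hQ
    have hPQ : ∀ w, P w = w ^ m 0 * Q w := by
      intro w
      rw [hP, hQ]
      simp only
      rw [← Finset.mul_prod_erase G _ h0G, sub_zero]
    have hkQ : ∀ w, k w = Q w * g w := by
      have : k = fun w => Q w * g w := by
        have hgc := hg.continuous
        have hQc : Continuous Q := by fun_prop
        refine Continuous.ext_on (dense_compl_singleton (0 : ℂ)) hk.continuous (by fun_prop) ?_
        intro w hw
        have hw : w ≠ 0 := hw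
        have e1 := hfk w
        rw [hfg, hPQ, sub_zero] at e1
        have e2 : w ^ m 0 ≠ 0 := pow_ne_zero _ hw
        have : w ^ m 0 * (k w - Q w * g w) = 0 := by linear_combination -e1
        rcases mul_eq_zero.mp this with h | h
        · exact absurd h e2
        · exact sub_eq_zero.mp h
      exact fun w => congrFun this w
    have hQ0 : Q 0 ≠ 0 := by
      intro h
      have := hkQ 0
      rw [h, zero_mul] at this
      exact hk0 this
    set B := C * (2 * R) ^ (3/2 : ℝ) + |Real.log ‖k 0‖| + 1 with hB
    have hB0 : 0 < B := by positivity
    have hbd : ∀ w, ‖w‖ = 2 * R → ‖g w‖ ≤ ‖g 0‖ * Real.exp B := by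
      intro w hw
      have hQQ : ‖Q 0‖ ≤ ‖Q w‖ := by
        simp only [hQ, norm_prod]
        refine Finset.prod_le_prod (fun a _ => norm_nonneg _) fun a ha => ?_
        rw [norm_pow, norm_pow]
        refine pow_le_pow_left₀ (norm_nonneg _) ?_ _
        have := hGn a (Finset.mem_of_mem_erase ha)
        have h3 := norm_sub_norm_le w a
        rw [zero_sub, norm_neg]
        linarith
      have hkf : ‖k w‖ ≤ ‖f w‖ := by
        rw [hfk w, norm_mul, sub_zero, norm_pow]
        exact le_mul_of_one_le_left (norm_nonneg _) (one_le_pow₀ (by linarith))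
      have h3 := hgr (2 * R) (by linarith) w hw.le
      have h4 : ‖k w‖ = ‖Q w‖ * ‖g w‖ := by rw [hkQ, norm_mul]
      have h5 : ‖k 0‖ = ‖Q 0‖ * ‖g 0‖ := by rw [hkQ, norm_mul]
      have hk0' : 0 < ‖k 0‖ := norm_pos_iff.mpr hk0
      have h6 : Real.exp (C * (2 * R) ^ (3/2 : ℝ)) ≤ ‖k 0‖ * Real.exp B := by
        rw [← Real.exp_log hk0', ← Real.exp_add]
        refine Real.exp_le_exp.mpr ?_
        rw [hB]
        have := neg_abs_le (Real.log ‖k 0‖)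
        linarith
      have hQ0' : 0 < ‖Q 0‖ := norm_pos_iff.mpr hQ0
      have h7 : ‖Q 0‖ * ‖g w‖ ≤ ‖Q 0‖ * (‖g 0‖ * Real.exp B) := by
        calc _ ≤ ‖Q w‖ * ‖g w‖ := by gcongr
          _ ≤ ‖k 0‖ * Real.exp B := by rw [← h4]; linarith
          _ = _ := by rw [h5]; ring
      exact le_of_mul_le_mul_left h7 hQ0'
    have hbd' : ∀ w ∈ Metric.ball (0 : ℂ) R, ‖g w‖ ≤ ‖g 0‖ * Real.exp B := by
      intro w hw
      refine Complex.norm_le_of_forall_mem_frontier_norm_le (U := Metric.ball 0 (2 * R))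
        Metric.isBounded_ball hg.diffContOnCl ?_ ?_
      · intro z hz
        rw [frontier_ball _ (by linarith)] at hz
        exact hbd z (by simpa using hz)
      · refine subset_closure (Metric.ball_subset_ball (by linarith) hw)
    have hsl := small_log g hg hgev (by linarith) hB0
      (fun w hw => hgne w (by simpa using (Metric.mem_ball.mp hw).le)) hbd'
    have e1 := hsl w1 (by linarith)
    have e2 := hsl w2 (by linarith)
    have hlog : ∀ w, f w ≠ 0 → Real.log ‖f w‖ = ∑ a ∈ F, (m a : ℝ) * Real.log ‖w - a‖ + Real.log ‖g w‖ := by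
      intro w hw
      have e3 := hfg w
      have hP0 : P w ≠ 0 := fun h => hw (by rw [e3, h, zero_mul])
      have hgw : g w ≠ 0 := fun h => hw (by rw [e3, h, mul_zero])
      rw [e3, norm_mul, Real.log_mul (by simpa using hP0) (by simpa using hgw)]
      congr 1
      simp only [hP, norm_prod]
      rw [Real.log_prod]
      · simp only [norm_pow, Real.log_pow]
        rw [hG]
        by_cases h0F : (0 : ℂ) ∈ F
        · rw [Finset.insert_eq_of_mem h0F]
        · rw [Finset.sum_insert h0F]
          have : f 0 ≠ 0 := by
            intro h
            apply h0F
            rw [hF, Set.Finite.mem_toFinset]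
            exact ⟨h, by simp; linarith⟩
          rw [hm0 0 this]
          simp
      · intro a ha
        have := Finset.prod_ne_zero_iff.mp hP0 a ha
        simpa using this
    rw [hlog w1 h1, hlog w2 h2]
    simp only [mul_sub, Finset.sum_sub_distrib]
    have e4 : ∀ x y z u : ℝ, x + z - (y + u) - (x - y) = z - u := fun x y z u => by ring
    rw [e4]
    have e5 : 2 * B / (R / 2) ^ 2 * (‖w1‖ ^ 2 + ‖w2‖ ^ 2) =
        2 * B * (‖w1‖ / (R / 2)) ^ 2 + 2 * B * (‖w2‖ / (R / 2)) ^ 2 := by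
      rw [div_pow, div_pow]; ring
    rw [e5]
    rw [abs_le] at *
    constructor <;> linarith [e1.1, e1.2, e2.1, e2.2]
  rw [tendsto_iff_norm_sub_tendsto_zero]
  have hlim : Tendsto (fun R : ℝ => (2 * (C * (2 * R) ^ (3/2 : ℝ) + |Real.log ‖k 0‖| + 1) / (R / 2) ^ 2)
      * (‖w1‖ ^ 2 + ‖w2‖ ^ 2)) atTop (𝓝 0) := by
    have t1 : Tendsto (fun R : ℝ => R ^ (-(1/2 : ℝ))) atTop (𝓝 0) := tendsto_rpow_neg_atTop (by norm_num)
    have t2 : Tendsto (fun R : ℝ => R ^ (-(2 : ℝ))) atTop (𝓝 0) := tendsto_rpow_neg_atTop (by norm_num)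
    have t3 : Tendsto (fun R : ℝ => (8 * C * 2 ^ (3/2 : ℝ) * R ^ (-(1/2 : ℝ)) +
        8 * (|Real.log ‖k 0‖| + 1) * R ^ (-(2 : ℝ))) * (‖w1‖ ^ 2 + ‖w2‖ ^ 2)) atTop (𝓝 0) := by
      have := ((t1.const_mul (8 * C * 2 ^ (3/2 : ℝ))).add
        (t2.const_mul (8 * (|Real.log ‖k 0‖| + 1)))).mul_const (‖w1‖ ^ 2 + ‖w2‖ ^ 2)
      simpa using this
    refine t3.congr' ?_
    filter_upwards [eventually_gt_atTop 0] with R hR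
    congr 1
    rw [Real.mul_rpow (by norm_num) hR.le]
    have e1 : R ^ (-(1/2 : ℝ)) = R ^ (3/2 : ℝ) / R ^ 2 := by
      rw [← Real.rpow_natCast R 2, ← Real.rpow_sub hR]; norm_num
    have e2 : R ^ (-(2 : ℝ)) = 1 / R ^ 2 := by
      rw [Real.rpow_neg hR.le]; norm_cast; simp
    rw [e1, e2]
    field_simp
    ring
  refine squeeze_zero' (Eventually.of_forall fun _ => norm_nonneg _) ?_ hlim
  filter_upwards [eventually_ge_atTop R0, eventually_ge_atTop 1, eventually_gt_atTop (2 * ‖w1‖),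
    eventually_gt_atTop (2 * ‖w2‖)] with R a1 a2 a3 a4
  rw [Real.norm_eq_abs, abs_sub_comm]
  exact main R a1 a2 a3 a4

abbrev NZ := {ρ : ℂ // IsNontrivialZero ρ}

noncomputable def mu (ρ : NZ) : ℝ := (zetaMult ρ.1 : ℝ)

lemma mu_pos (ρ : NZ) : 0 < mu ρ := by
  have := zetaMult_pos ρ.2
  unfold mu
  exact_mod_cast this

lemma nz_finite' (K : Set ℂ) (hK : Bornology.IsBounded K) : {ρ : NZ | ρ.1 ∈ K}.Finite := by
  have := (nz_finite K hK).preimage (f := (Subtype.val : NZ → ℂ)) (Subtype.val_injective.injOn)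
  refine this.subset fun ρ h => ⟨h, ρ.2⟩

theorem hadamard_xi (s1 s2 : ℂ) (h1 : xi s1 ≠ 0) (h2 : xi s2 ≠ 0)
    (hle : ∀ ρ : NZ, Real.log ‖s2 - ρ.1‖ ≤ Real.log ‖s1 - ρ.1‖) :
    HasSum (fun ρ : NZ => mu ρ * (Real.log ‖s1 - ρ.1‖ - Real.log ‖s2 - ρ.1‖))
      (Real.log ‖xi s1‖ - Real.log ‖xi s2‖) := by
  classical
  obtain ⟨C, hC, hgr⟩ := xi_growth
  set f : ℂ → ℂ := fun w => xi (1/2 + w) with hf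
  have hfd : Differentiable ℂ f := by
    have := xi_diff
    exact this.comp (f := fun w : ℂ => 1/2 + w) (by fun_prop)
  have hord : ∀ a, analyticOrderAt f a = analyticOrderAt xi (1/2 + a) := by
    intro a
    refine analyticOrderAt_comp_of_deriv_ne_zero (f := xi) (g := fun s : ℂ => 1/2 + s) ?_ ?_
    · exact analyticAt_const.add analyticAt_id
    · simp
  have hball : ∀ R : ℝ, {ρ : NZ | ‖ρ.1 - 1/2‖ ≤ R}.Finite := by
    intro R
    have := nz_finite' (Metric.closedBall (1/2) R) Metric.isBounded_closedBall
    refine this.subset fun ρ h => ?_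
    simpa [dist_eq_norm] using h
  have hfin : ∀ R : ℝ, {w | f w = 0 ∧ ‖w‖ ≤ R}.Finite := by
    intro R
    refine ((hball R).image (fun ρ => ρ.1 - 1/2)).subset ?_
    rintro w ⟨hw, hwR⟩
    refine ⟨⟨1/2 + w, (xi_eq_zero_iff _).mp hw⟩, ?_, ?_⟩
    · simpa using hwR
    · simp
  have hlim := hadamard_limit f hfd (fun w => by
      simp only [hf]; rw [← xi_one_sub]; congr 1; ring) (fun a => by rw [hord]; exact xi_order_ne_top _)
    (C * 2 ^ (3/2 : ℝ)) 2 (by positivity) (fun R hR w hw => by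
      have := hgr (2 * R) (by linarith) (1/2 + w) (by
        have := norm_add_le (1/2 : ℂ) w
        simp at this ⊢
        linarith)
      rwa [Real.mul_rpow (by norm_num) (by linarith), ← mul_assoc] at this) hfin
    (s1 - 1/2) (s2 - 1/2) (by simpa [hf] using h1) (by simpa [hf] using h2)
  set F : ℝ → Finset NZ := fun R => (hball R).toFinset with hF
  set t : NZ → ℝ := fun ρ => mu ρ * (Real.log ‖s1 - ρ.1‖ - Real.log ‖s2 - ρ.1‖) with ht
  have hsum : ∀ R, ∑ a ∈ (hfin R).toFinset, (analyticOrderNatAt f a : ℝ) *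
      (Real.log ‖s1 - 1/2 - a‖ - Real.log ‖s2 - 1/2 - a‖) = ∑ ρ ∈ F R, t ρ := by
    intro R
    symm
    refine Finset.sum_bij (fun ρ _ => ρ.1 - 1/2) ?_ ?_ ?_ ?_
    · intro ρ h
      simp only [hF, Set.Finite.mem_toFinset, mem_ofPred_eq] at h ⊢
      refine ⟨?_, h⟩
      have := (xi_eq_zero_iff ρ.1).mpr ρ.2
      simp [hf, this]
    · intro ρ _ ρ' _ h
      apply Subtype.ext
      linear_combination h
    · intro w hw
      simp only [Set.Finite.mem_toFinset, mem_ofPred_eq] at hw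
      refine ⟨⟨1/2 + w, (xi_eq_zero_iff _).mp hw.1⟩, ?_, ?_⟩
      · simpa [hF] using hw.2
      · simp
    · intro ρ _
      simp only [ht]
      have e1 : analyticOrderNatAt f (ρ.1 - 1/2) = zetaMult ρ.1 := by
        unfold analyticOrderNatAt
        rw [hord, show (1/2 : ℂ) + (ρ.1 - 1/2) = ρ.1 by ring, xi_order ρ.2]
        simp
      rw [e1]
      simp [mu]
  simp only [hsum] at hlim
  have e : f (s1 - 1/2) = xi s1 ∧ f (s2 - 1/2) = xi s2 := by simp [hf]
  rw [e.1, e.2] at hlim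
  have ht0 : ∀ ρ, 0 ≤ t ρ := fun ρ => mul_nonneg (mu_pos ρ).le (sub_nonneg.mpr (hle ρ))
  have hmonoF : Monotone F := by
    intro R R' h ρ hρ
    simp only [hF, Set.Finite.mem_toFinset, mem_ofPred_eq] at hρ ⊢
    linarith
  have hmono : Monotone fun R => ∑ ρ ∈ F R, t ρ := fun R R' h =>
    Finset.sum_le_sum_of_subset_of_nonneg (hmonoF h) fun ρ _ _ => ht0 ρ
  have hFt : Tendsto F atTop atTop := by
    refine tendsto_atTop_finset_of_monotone hmonoF fun ρ => ⟨‖ρ.1 - 1/2‖, ?_⟩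
    simp [hF]
  have hs : Summable t := by
    refine summable_of_sum_le ht0 (c := Real.log ‖xi s1‖ - Real.log ‖xi s2‖) fun u => ?_
    obtain ⟨R, hR⟩ := (hFt.eventually (eventually_ge_atTop u)).exists
    exact (Finset.sum_le_sum_of_subset_of_nonneg hR fun ρ _ _ => ht0 ρ).trans (hmono.ge_of_tendsto hlim R)
  have h3 := hs.hasSum
  have h4 : Tendsto (fun R => ∑ ρ ∈ F R, t ρ) atTop (𝓝 (∑' ρ, t ρ)) := h3.comp hFt
  rw [tendsto_nhds_unique hlim h4]
  exact h3

lemma zeta_sub_one {s : ℂ} (hs : 2 ≤ s.re) : ‖riemannZeta s - 1‖ ≤ 2/3 := by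
  have hz2 := hasSum_zeta_two
  have h2 := (hasSum_nat_add_iff' 2).mpr hz2
  simp only [Finset.sum_range_succ, Finset.sum_range_zero] at h2
  have hpi : Real.pi ^ 2 / 6 - (0 + 1 / ((0 : ℕ) : ℝ) ^ 2 + 1 / ((1 : ℕ) : ℝ) ^ 2) ≤ 2/3 := by
    have := Real.pi_lt_d2
    have := Real.pi_pos
    norm_num
    nlinarith
  refine le_trans ?_ hpi
  have hsum : Summable fun n : ℕ => 1 / ((n : ℂ) + 1) ^ s := by
    have := Complex.summable_one_div_nat_cpow.mpr (show 1 < s.re by linarith)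
    have := (summable_nat_add_iff 1).mpr this
    simpa using this
  rw [zeta_eq_tsum_one_div_nat_add_one_cpow (by linarith), hsum.tsum_eq_zero_add]
  have e : (1 : ℂ) / (((0 : ℕ) : ℂ) + 1) ^ s = 1 := by simp
  rw [e, add_sub_cancel_left]
  refine tsum_of_norm_bounded h2 fun n => ?_
  have : ‖(((n + 1 : ℕ) : ℂ) + 1) ^ s‖ = (((n + 2 : ℕ) : ℝ)) ^ s.re := by
    have := Complex.norm_cpow_eq_rpow_re_of_pos (x := ((n + 2 : ℕ) : ℝ)) (by positivity) s
    rw [← this]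
    push_cast
    ring_nf
  rw [norm_div, norm_one, this]
  have h3 : (((n + 2 : ℕ) : ℝ)) ^ 2 ≤ (((n + 2 : ℕ) : ℝ)) ^ s.re := by
    rw [← Real.rpow_natCast]
    refine Real.rpow_le_rpow_of_exponent_le ?_ (by simpa using hs)
    push_cast
    have : (0 : ℝ) ≤ n := by positivity
    linarith
  exact one_div_le_one_div_of_le (by positivity) h3

lemma zeta_bounds {s : ℂ} (hs : 2 ≤ s.re) : 1/3 ≤ ‖riemannZeta s‖ ∧ ‖riemannZeta s‖ ≤ 5/3 := by
  have h := zeta_sub_one hs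
  have h1 := norm_sub_norm_le (1 : ℂ) (1 - riemannZeta s)
  have h2 := norm_add_le (riemannZeta s - 1) 1
  rw [norm_sub_rev 1] at h1
  simp at h1 h2
  constructor <;> linarith

noncomputable def Aser (s : ℂ) : ℝ :=
  Real.log ‖s + 2‖ + Real.log ‖s + 1‖ - Real.log ‖s - 1‖ - Real.log (2 * Real.pi) +
    (Real.log ‖riemannZeta (s + 2)‖ - Real.log ‖riemannZeta s‖)

lemma log_le_shift {s : ℂ} (hs : 2 ≤ s.re) (ρ : NZ) :
    Real.log ‖s - ρ.1‖ ≤ Real.log ‖s + 2 - ρ.1‖ := by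
  have h1 := ρ.2.2.2
  have hpos : 0 < ‖s - ρ.1‖ := by
    refine lt_of_lt_of_le ?_ (Complex.re_le_norm _)
    simp; linarith
  refine Real.log_le_log hpos ?_
  rw [← sq_le_sq₀ (norm_nonneg _) (norm_nonneg _), Complex.sq_norm, Complex.sq_norm,
    Complex.normSq_apply, Complex.normSq_apply]
  simp
  nlinarith

lemma zero_formula {s : ℂ} (hs : 2 ≤ s.re) :
    HasSum (fun ρ : NZ => mu ρ * (Real.log ‖s + 2 - ρ.1‖ - Real.log ‖s - ρ.1‖)) (Aser s) := by
  have hne : ∀ s : ℂ, 2 ≤ s.re → xi s ≠ 0 := by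
    intro s hs h
    have := ((xi_eq_zero_iff s).mp h).2.2
    linarith
  have hs2 : 2 ≤ (s + 2).re := by simp; linarith
  have := hadamard_xi (s + 2) s (hne _ hs2) (hne _ hs) (log_le_shift hs)
  convert! this using 1
  have n1 : ∀ s : ℂ, 2 ≤ s.re → s ≠ 1 := by rintro s h rfl; norm_num at h
  have n0 : ∀ s : ℂ, 0 < s.re → s ≠ 0 := by rintro s h rfl; simp at h
  rw [xi_eq' (by linarith) (n1 _ hs2), xi_eq' (by linarith) (n1 _ hs)]
  have hs0 : s ≠ 0 := n0 s (by linarith)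
  rw [Complex.Gammaℝ_add_two hs0]
  have g0 : s.Gammaℝ ≠ 0 := Complex.Gammaℝ_ne_zero_of_re_pos (by linarith)
  have z1 : riemannZeta s ≠ 0 := riemannZeta_ne_zero_of_one_le_re (by linarith)
  have z2 : riemannZeta (s + 2) ≠ 0 := riemannZeta_ne_zero_of_one_le_re (by linarith)
  have a1 : s + 2 ≠ 0 := n0 _ (by linarith)
  have a2 : s + 1 ≠ 0 := n0 _ (by simp; linarith)
  have a3 : s - 1 ≠ 0 := sub_ne_zero.mpr (n1 _ hs)
  have e : s + 2 - 1 = s + 1 := by ring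
  rw [e]
  simp only [norm_mul, norm_div, Complex.norm_real, Complex.norm_ofNat, Real.norm_eq_abs,
    abs_of_pos Real.pi_pos]
  have p1 := norm_ne_zero_iff.mpr hs0
  have p2 := norm_ne_zero_iff.mpr g0
  have p3 := norm_ne_zero_iff.mpr z1
  have p4 := norm_ne_zero_iff.mpr z2
  have p5 := norm_ne_zero_iff.mpr a1
  have p6 := norm_ne_zero_iff.mpr a2
  have p7 := norm_ne_zero_iff.mpr a3
  have p8 := Real.pi_pos.ne'
  unfold Aser
  rw [Real.log_mul (x := ‖s + 2‖ * ‖s + 1‖ * (‖s.Gammaℝ‖ * ‖s‖ / 2 / Real.pi)) (by positivity) p4,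
    Real.log_mul (x := ‖s + 2‖ * ‖s + 1‖) (by positivity) (by positivity),
    Real.log_mul p5 p6, Real.log_div (by positivity) p8,
    Real.log_div (by positivity) (by norm_num), Real.log_mul p2 p1,
    Real.log_mul (by positivity) p3, Real.log_mul (by positivity) p2, Real.log_mul p1 p7,
    Real.log_mul (by norm_num) p8]
  ring

lemma zero_sum {K t : ℝ} (hK : 2 ≤ K) :
    Summable (fun ρ : NZ => mu ρ / (K ^ 2 + (t - ρ.1.im) ^ 2)) ∧
    ∑' ρ : NZ, mu ρ / (K ^ 2 + (t - ρ.1.im) ^ 2) ≤ 8 * Real.log (K + |t|) / K := by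
  set s : ℂ := ⟨K, t⟩ with hs
  have hsre : 2 ≤ s.re := hK
  have h := zero_formula hsre
  have hterm : ∀ ρ : NZ, mu ρ / (K ^ 2 + (t - ρ.1.im) ^ 2) ≤
      (2 / K) * (mu ρ * (Real.log ‖s + 2 - ρ.1‖ - Real.log ‖s - ρ.1‖)) := by
    intro ρ
    obtain ⟨_, hb0, hb1⟩ := ρ.2
    set x := t - ρ.1.im
    set b := ρ.1.re
    have e1 : Real.log ‖s + 2 - ρ.1‖ = 1/2 * Real.log ((K + 2 - b) ^ 2 + x ^ 2) := by
      rw [← Complex.normSq_add_mul_I, ← Complex.sq_norm, Real.log_pow]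
      have : ((K + 2 - b : ℝ) : ℂ) + x * Complex.I = s + 2 - ρ.1 := by
        apply Complex.ext <;> simp [hs, x, b]
      rw [this]; push_cast; ring
    have e2 : Real.log ‖s - ρ.1‖ = 1/2 * Real.log ((K - b) ^ 2 + x ^ 2) := by
      rw [← Complex.normSq_add_mul_I, ← Complex.sq_norm, Real.log_pow]
      have : ((K - b : ℝ) : ℂ) + x * Complex.I = s - ρ.1 := by
        apply Complex.ext <;> simp [hs, x, b]
      rw [this]; push_cast; ring
    have q1 : 0 < (K + 2 - b) ^ 2 + x ^ 2 := by nlinarith [sq_nonneg x]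
    have q2 : 0 < (K - b) ^ 2 + x ^ 2 := by nlinarith [sq_nonneg x]
    have e3 : Real.log ((K + 2 - b) ^ 2 + x ^ 2) - Real.log ((K - b) ^ 2 + x ^ 2) ≥
        (4 * (K - b) + 4) / ((K + 2 - b) ^ 2 + x ^ 2) := by
      have := Real.one_sub_inv_le_log_of_pos (div_pos q1 q2)
      rw [Real.log_div q1.ne' q2.ne'] at this
      refine le_trans (le_of_eq ?_) this
      field_simp
      ring
    have e4 : (4 * (K - b) + 4) / ((K + 2 - b) ^ 2 + x ^ 2) ≥ K / (K ^ 2 + x ^ 2) := by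
      rw [ge_iff_le, div_le_div_iff₀ (by positivity) q1]
      have : (K + 2 - b) ^ 2 + x ^ 2 ≤ 4 * (K ^ 2 + x ^ 2) := by nlinarith [sq_nonneg x]
      have h4 : 4 * K ≤ 4 * (K - b) + 4 := by linarith
      calc K * ((K + 2 - b) ^ 2 + x ^ 2) ≤ K * (4 * (K ^ 2 + x ^ 2)) := by gcongr
        _ = 4 * K * (K ^ 2 + x ^ 2) := by ring
        _ ≤ _ := by gcongr
    rw [e1, e2]
    have hm := mu_pos ρ
    have e5 : 1 / (K ^ 2 + x ^ 2) ≤ (2 / K) * (1/2 * Real.log ((K + 2 - b) ^ 2 + x ^ 2) - 1/2 * Real.log ((K - b) ^ 2 + x ^ 2)) := by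
      have : (2 / K) * (K / (K ^ 2 + x ^ 2) / 2) = 1 / (K ^ 2 + x ^ 2) := by
        have : K ≠ 0 := by linarith
        have : K ^ 2 + x ^ 2 ≠ 0 := by positivity
        field_simp
      rw [← this]
      refine mul_le_mul_of_nonneg_left ?_ (by positivity)
      linarith
    calc mu ρ / (K ^ 2 + x ^ 2) = mu ρ * (1 / (K ^ 2 + x ^ 2)) := by ring
      _ ≤ mu ρ * _ := mul_le_mul_of_nonneg_left e5 hm.le
      _ = _ := by ring
  have h' := h.mul_left (2 / K)
  have hS : Summable (fun ρ : NZ => mu ρ / (K ^ 2 + (t - ρ.1.im) ^ 2)) := by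
    refine Summable.of_nonneg_of_le (fun ρ => ?_) hterm h'.summable
    have := mu_pos ρ
    positivity
  refine ⟨hS, (hS.tsum_le_tsum hterm h'.summable).trans ?_⟩
  rw [h'.tsum_eq]
  have hA : Aser s ≤ 4 * Real.log (K + |t|) := by
    unfold Aser
    have z1 := zeta_bounds hsre
    have z2 := zeta_bounds (s := s + 2) (by simp; linarith)
    have l1 : Real.log ‖riemannZeta (s + 2)‖ ≤ Real.log (5/3) := Real.log_le_log (by linarith) z2.2
    have l2 : Real.log (1/3) ≤ Real.log ‖riemannZeta s‖ := Real.log_le_log (by norm_num) z1.1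
    have n1 : 1 ≤ ‖s - 1‖ := by
      refine le_trans ?_ (Complex.re_le_norm _)
      simp; linarith
    have n2 : ‖s + 1‖ ≤ 3 * ‖s - 1‖ := by
      have := norm_add_le (s - 1) 2
      rw [show s - 1 + 2 = s + 1 by ring] at this
      simp at this
      linarith
    have n3 : 0 < ‖s + 1‖ := by
      refine lt_of_lt_of_le ?_ (Complex.re_le_norm _)
      simp; linarith
    have l3 : Real.log ‖s + 1‖ ≤ Real.log 3 + Real.log ‖s - 1‖ := by
      rw [← Real.log_mul (by norm_num) (by linarith)]
      exact Real.log_le_log n3 n2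
    have n4 : ‖s + 2‖ ≤ 2 * (K + |t|) := by
      have := Complex.norm_le_abs_re_add_abs_im (s + 2)
      simp [hs] at this
      rw [abs_of_pos (by linarith)] at this
      have := abs_nonneg t
      linarith
    have n5 : 0 < ‖s + 2‖ := by
      refine lt_of_lt_of_le ?_ (Complex.re_le_norm _)
      simp; linarith
    have hKt : 2 ≤ K + |t| := by have := abs_nonneg t; linarith
    have l4 : Real.log ‖s + 2‖ ≤ Real.log 2 + Real.log (K + |t|) := by
      rw [← Real.log_mul (by norm_num) (by linarith)]
      exact Real.log_le_log n5 n4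
    have l5 : Real.log 2 ≤ Real.log (K + |t|) := Real.log_le_log (by norm_num) hKt
    have l6 : Real.log 2 + Real.log 3 - Real.log (2 * Real.pi) + Real.log (5/3) - Real.log (1/3) ≤ 3 * Real.log 2 := by
      have : Real.log 2 + Real.log 3 + Real.log (5/3) ≤ Real.log (2 * Real.pi) + Real.log (1/3) + 3 * Real.log 2 := by
        rw [show (3 : ℝ) * Real.log 2 = Real.log (2 ^ 3) by rw [Real.log_pow]; norm_num,
          ← Real.log_mul (by norm_num) (by norm_num), ← Real.log_mul (by norm_num) (by norm_num),
          ← Real.log_mul (by positivity) (by norm_num), ← Real.log_mul (by positivity) (by norm_num)]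
        refine Real.log_le_log (by norm_num) ?_
        have := Real.pi_gt_three
        linarith
      linarith
    linarith
  calc 2 / K * Aser s ≤ 2 / K * (4 * Real.log (K + |t|)) := mul_le_mul_of_nonneg_left hA (by positivity)
    _ = _ := by ring

noncomputable def ee (a : ℝ) : ℂ := Complex.exp (a * Complex.I)

lemma ee_norm (a : ℝ) : ‖ee a‖ = 1 := Complex.norm_exp_ofReal_mul_I a
lemma ee_add (a b : ℝ) : ee (a + b) = ee a * ee b := by
  simp [ee, add_mul, Complex.exp_add]
lemma ee_zero : ee 0 = 1 := by simp [ee]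
lemma ee_cont : Continuous ee := by unfold ee; fun_prop
lemma ee_conj (a : ℝ) : (starRingEnd ℂ) (ee a) = ee (-a) := by
  simp [ee, ← Complex.exp_conj]
lemma ee_re (a : ℝ) : (ee a).re = Real.cos a := Complex.exp_ofReal_mul_I_re a
lemma ee_two_cos (a : ℝ) : ((2 * Real.cos a : ℝ) : ℂ) = ee a + ee (-a) := by
  simp [ee, Complex.cos]
  ring
lemma ee_deriv (c v : ℝ) : HasDerivAt (fun v => ee (v * c)) (Complex.I * c * ee (v * c)) v := by
  have h1 : HasDerivAt (fun v : ℝ => ((v * c : ℝ) : ℂ) * Complex.I) (c * Complex.I) v := by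
    have : HasDerivAt (fun v : ℝ => v * c) c v := by simpa using (hasDerivAt_id v).mul_const c
    exact this.ofReal_comp.mul_const _
  convert! h1.cexp using 1
  unfold ee; ring

noncomputable def ft (f : ℝ → ℂ) (x : ℝ) : ℂ := ∫ u, f u * ee (u * x)

lemma ee_int {f : ℝ → ℂ} (hf : Integrable f) (x : ℝ) : Integrable (fun u => f u * ee (u * x)) := by
  refine hf.mul_bdd (c := 1) ?_ (Eventually.of_forall fun u => (ee_norm _).le)
  exact (ee_cont.comp (by fun_prop)).aestronglyMeasurable

open FourierTransform in
lemma ft_eq (f : ℝ → ℂ) (x : ℝ) : ft f x = 𝓕 f (-x / (2 * Real.pi)) := by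
  rw [Real.fourier_real_eq_integral_exp_smul]
  unfold ft ee
  congr 1; ext u
  rw [smul_eq_mul, mul_comm]
  congr 3
  have := Real.pi_ne_zero
  push_cast
  field_simp

lemma ft_norm_le (f : ℝ → ℂ) (x : ℝ) : ‖ft f x‖ ≤ ∫ u, ‖f u‖ := by
  refine (norm_integral_le_integral_norm _).trans (le_of_eq ?_)
  congr 1; ext u; simp [ee_norm]

lemma ft_cont {f : ℝ → ℂ} (hf : Integrable f) : Continuous (ft f) := by
  refine continuous_of_dominated (bound := fun u => ‖f u‖) (fun x => (ee_int hf x).1) ?_ hf.norm ?_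
  · intro x; refine Eventually.of_forall fun u => ?_
    simp [ee_norm]
  · refine Eventually.of_forall fun u => ?_
    have := ee_cont
    fun_prop

lemma ft_sub (f g : ℝ → ℂ) (hf : Integrable f) (hg : Integrable g) (x : ℝ) :
    ft (fun u => f u - g u) x = ft f x - ft g x := by
  unfold ft
  rw [← integral_sub (ee_int hf x) (ee_int hg x)]
  congr 1; ext u; ring

lemma ft_shift (f : ℝ → ℂ) (y x : ℝ) : ft (fun u => f (u - y)) x = ee (y * x) * ft f x := by
  unfold ft
  rw [← integral_const_mul, ← integral_add_right_eq_self _ y]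
  congr 1; ext u
  simp only [add_sub_cancel_right, add_mul, ee_add]; ring

open FourierTransform in
lemma ft_inv {f : ℝ → ℂ} (hc : Continuous f) (hf : Integrable f) (hF : Integrable (ft f)) (u : ℝ) :
    ∫ x, ft f (-x) * ee (u * x) = 2 * Real.pi * f u := by
  have hp : (2 * Real.pi) ≠ 0 := by positivity
  have hF' : Integrable (𝓕 f) := by
    have := hF.comp_mul_left' (R := -(2 * Real.pi)) (by simp)
    convert! this using 1
    ext x; rw [ft_eq]; field_simp
  have h := hf.fourierInv_fourier_eq hF' hc.continuousAt (v := u)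
  rw [← h, Real.fourierInv_eq']
  have := Measure.integral_comp_mul_left (fun x => ft f (-x) * ee (u * x)) (2 * Real.pi)
  rw [abs_inv, abs_of_pos (by positivity), eq_inv_smul_iff₀ hp] at this
  rw [← this, Complex.real_smul]
  push_cast
  congr 2; ext x
  rw [ft_eq, smul_eq_mul, mul_comm]
  congr 1
  · unfold ee; simp; ring_nf
  · congr 1; field_simp

lemma parseval {f w : ℝ → ℂ} (hc : Continuous f) (hf : Integrable f) (hF : Integrable (ft f))
    (hw : Integrable w) : ∫ x, ft f (-x) * ft w x = 2 * Real.pi * ∫ u, w u * f u := by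
  have e1 : ∀ x, ft f (-x) * ft w x = ∫ u, ft f (-x) * (w u * ee (u * x)) := by
    intro x; rw [integral_const_mul]; rfl
  simp_rw [e1]
  rw [integral_integral_swap]
  · rw [← integral_const_mul]
    congr 1; ext u
    have := ft_inv hc hf hF u
    calc ∫ x, ft f (-x) * (w u * ee (u * x)) = ∫ x, w u * (ft f (-x) * ee (u * x)) := by
          congr 1; ext x; ring
      _ = _ := by rw [integral_const_mul, this]; ring
  · have h1 := hF.comp_neg.mul_prod hw
    have : Integrable (fun z : ℝ × ℝ => (ft f (-z.1) * w z.2) * ee (z.2 * z.1)) (volume.prod volume) := by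
      refine h1.mul_bdd (c := 1) ?_ (Eventually.of_forall fun u => (ee_norm _).le)
      exact (ee_cont.comp (by fun_prop)).aestronglyMeasurable
    convert! this using 1
    ext z; simp [Function.uncurry]; ring

lemma int_inv_one_add_sq : Integrable (fun x : ℝ => (1 + x ^ 2)⁻¹) := integrable_inv_one_add_sq

lemma int_of_bound {F : ℝ → ℂ} (hF : Continuous F) {B : ℝ} (hB : ∀ x, ‖F x‖ ≤ B / (1 + x ^ 2)) :
    Integrable F := by
  refine (int_inv_one_add_sq.const_mul B).mono' hF.aestronglyMeasurable (Eventually.of_forall fun x => ?_)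
  simpa [div_eq_mul_inv] using hB x

lemma half_ibp {h h1 h2 : ℝ → ℝ} (hd : ∀ u, HasDerivAt h (h1 u) u) (hd1 : ∀ u, HasDerivAt h1 (h2 u) u)
    (hc : Continuous h2) (a b x : ℝ) :
    (Complex.I * x) ^ 2 * ∫ u in a..b, (h u : ℂ) * ee (u * x) =
      ((Complex.I * x) * h b - h1 b) * ee (b * x) - ((Complex.I * x) * h a - h1 a) * ee (a * x) +
        ∫ u in a..b, (h2 u : ℂ) * ee (u * x) := by
  have hee := ee_cont
  have c0 : Continuous h := continuous_iff_continuousAt.mpr fun u => (hd u).continuousAt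
  have key : ∀ u ∈ uIcc a b, HasDerivAt (fun u => ((Complex.I * x) * h u - h1 u) * ee (u * x))
      ((Complex.I * x) ^ 2 * ((h u : ℂ) * ee (u * x)) - (h2 u : ℂ) * ee (u * x)) u := by
    intro u _
    have := (((hd u).ofReal_comp.const_mul (Complex.I * x)).sub (hd1 u).ofReal_comp).mul (ee_deriv x u)
    convert! this using 1
    simp; ring
  have i1 : IntervalIntegrable (fun u => (h u : ℂ) * ee (u * x)) volume a b :=
    Continuous.intervalIntegrable (by fun_prop) _ _
  have i2 : IntervalIntegrable (fun u => (h2 u : ℂ) * ee (u * x)) volume a b :=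
    Continuous.intervalIntegrable (by fun_prop) _ _
  have := intervalIntegral.integral_eq_sub_of_hasDerivAt key ((i1.const_mul _).sub i2)
  rw [intervalIntegral.integral_sub (i1.const_mul _) i2, intervalIntegral.integral_const_mul] at this
  rw [← sub_eq_iff_eq_add, this]

lemma bound_combine {z : ℂ} {x A B : ℝ} (h1 : ‖z‖ ≤ A) (h2 : ‖(Complex.I * x) ^ 2 * z‖ ≤ B) :
    ‖z‖ ≤ (A + B) / (1 + x ^ 2) := by
  rw [norm_mul, norm_pow, norm_mul, Complex.norm_I, one_mul, Complex.norm_real, Real.norm_eq_abs, sq_abs] at h2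
  rw [le_div_iff₀ (by positivity)]
  linarith

lemma int_bound {h : ℝ → ℝ} {a b B x : ℝ} (hab : a ≤ b) (hB : ∀ u ∈ Icc a b, |h u| ≤ B) :
    ‖∫ u in a..b, (h u : ℂ) * ee (u * x)‖ ≤ B * (b - a) := by
  have := intervalIntegral.norm_integral_le_of_norm_le_const (a := a) (b := b) (C := B)
    (f := fun u => (h u : ℂ) * ee (u * x)) ?_
  · rwa [abs_of_nonneg (by linarith)] at this
  · intro u hu
    rw [uIoc_of_le hab] at hu
    simpa [ee_norm] using hB u ⟨hu.1.le, hu.2⟩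

lemma ft_interval {h : ℝ → ℝ} {a b : ℝ} (hab : a ≤ b) (hs : ∀ u, u ∉ Ioc a b → h u = 0) (x : ℝ) :
    ft (fun u => (h u : ℂ)) x = ∫ u in a..b, (h u : ℂ) * ee (u * x) := by
  rw [intervalIntegral.integral_of_le hab, setIntegral_eq_integral_of_forall_compl_eq_zero]
  · rfl
  · intro u hu; simp [hs u hu]

lemma ft_smooth_bound {h h1 h2 : ℝ → ℝ} (hd : ∀ u, HasDerivAt h (h1 u) u)
    (hd1 : ∀ u, HasDerivAt h1 (h2 u) u) (hc : Continuous h2) (hs : ∀ u, 1 ≤ |u| → h u = 0)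
    (hs1 : ∀ u, 1 ≤ |u| → h1 u = 0) {A B : ℝ}
    (hA : ∀ u ∈ Icc (-1 : ℝ) 1, |h u| ≤ A) (hB : ∀ u ∈ Icc (-1 : ℝ) 1, |h2 u| ≤ B) (x : ℝ) :
    ‖ft (fun u => (h u : ℂ)) x‖ ≤ (2 * A + 2 * B) / (1 + x ^ 2) := by
  have hsup : ∀ u, u ∉ Ioc (-1 : ℝ) 1 → h u = 0 := by
    intro u hu
    apply hs
    by_contra hcon
    rw [not_le, abs_lt] at hcon
    exact hu ⟨hcon.1, hcon.2.le⟩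
  rw [ft_interval (by norm_num) hsup]
  refine bound_combine ?_ ?_
  · refine (int_bound (by norm_num) hA).trans (by linarith)
  · rw [half_ibp hd hd1 hc, hs 1 (by simp), hs (-1) (by simp), hs1 1 (by simp), hs1 (-1) (by simp)]
    simp only [Complex.ofReal_zero, mul_zero, sub_zero, zero_mul, zero_add]
    refine (int_bound (by norm_num) hB).trans (by linarith)

noncomputable def psi : ContDiffBump (0 : ℝ) := ⟨1/4, 1/3, by norm_num, by norm_num⟩

lemma psi_cont : Continuous psi := psi.continuous
lemma psi_supp {v : ℝ} (h : 1/3 ≤ |v|) : psi v = 0 := psi.zero_of_le_dist (by simpa [psi] using h)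
lemma psi_int : Integrable psi := psi_cont.integrable_of_hasCompactSupport psi.hasCompactSupport

noncomputable def eta (v : ℝ) : ℝ := ∫ w, psi w * psi (v - w)
noncomputable def eta1 : ℝ → ℝ := deriv eta
noncomputable def eta2 : ℝ → ℝ := deriv eta1
noncomputable def phi (x : ℝ) : ℝ := (ft (fun u => (psi u : ℂ)) x).re ^ 2

lemma eta_smooth : ContDiff ℝ 2 eta := by
  have := HasCompactSupport.contDiff_convolution_left (n := 2) (ContinuousLinearMap.mul ℝ ℝ) psi.hasCompactSupport
    psi.contDiff (g := psi) (psi_int.locallyIntegrable) (μ := volume)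
  exact_mod_cast this

lemma eta_deriv (u : ℝ) : HasDerivAt eta (eta1 u) u :=
  (eta_smooth.differentiable (by norm_num)).differentiableAt.hasDerivAt
lemma eta1_smooth : ContDiff ℝ 1 eta1 := by
  have := eta_smooth
  rw [show (2 : WithTop ℕ∞) = 1 + 1 by norm_num, contDiff_succ_iff_deriv] at this
  exact this.2.2
lemma eta1_deriv (u : ℝ) : HasDerivAt eta1 (eta2 u) u :=
  (eta1_smooth.differentiable (by norm_num)).differentiableAt.hasDerivAt
lemma eta2_cont : Continuous eta2 := eta1_smooth.continuous_deriv (by norm_num)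
lemma eta1_cont : Continuous eta1 := eta1_smooth.continuous
lemma eta_cont : Continuous eta := eta_smooth.continuous

lemma eta_supp' {v : ℝ} (h : 2/3 ≤ |v|) : eta v = 0 := by
  unfold eta
  refine integral_eq_zero_of_ae (Eventually.of_forall fun w => ?_)
  by_cases hw : 1/3 ≤ |w|
  · simp [psi_supp hw]
  · have : 1/3 ≤ |v - w| := by
      have := abs_sub_abs_le_abs_sub v w
      linarith
    simp [psi_supp this]

lemma supp_deriv {f : ℝ → ℝ} {c : ℝ} (h : ∀ v, c ≤ |v| → f v = 0) {v : ℝ} (hv : c < |v|) :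
    deriv f v = 0 := by
  have : f =ᶠ[𝓝 v] fun _ => 0 := by
    have : ∀ᶠ u in 𝓝 v, c < |u| := (continuous_abs.tendsto v).eventually (lt_mem_nhds hv)
    filter_upwards [this] with u hu using h u hu.le
  rw [this.deriv_eq]; simp

lemma eta_supp {v : ℝ} (h : 1 ≤ |v|) : eta v = 0 := eta_supp' (by linarith)
lemma eta1_supp {v : ℝ} (h : 1 ≤ |v|) : eta1 v = 0 := supp_deriv (c := 2/3) (fun _ => eta_supp') (by linarith)
lemma eta2_supp {v : ℝ} (h : 1 ≤ |v|) : eta2 v = 0 :=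
  supp_deriv (c := 3/4) (fun _ h => supp_deriv (c := 2/3) (fun _ => eta_supp') (by linarith)) (by linarith)

lemma bdd_of_supp {f : ℝ → ℝ} (hc : Continuous f) (h : ∀ v, 1 ≤ |v| → f v = 0) :
    ∃ C, 0 < C ∧ ∀ v, |f v| ≤ C := by
  obtain ⟨C, hC⟩ := (isCompact_Icc (a := (-1 : ℝ)) (b := 1)).exists_bound_of_continuousOn hc.continuousOn
  refine ⟨|C| + 1, by positivity, fun v => ?_⟩
  by_cases hv : 1 ≤ |v|
  · rw [h v hv]; simp; positivity
  · have := hC v (by rw [not_le, abs_lt] at hv; exact ⟨hv.1.le, hv.2.le⟩)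
    have := le_abs_self C
    simp at *; linarith

lemma eta_bdd : ∃ C, 0 < C ∧ ∀ v, |eta v| ≤ C ∧ |eta1 v| ≤ C ∧ |eta2 v| ≤ C := by
  obtain ⟨a, ha, h1⟩ := bdd_of_supp eta_cont fun _ => eta_supp
  obtain ⟨b, hb, h2⟩ := bdd_of_supp eta1_cont fun _ => eta1_supp
  obtain ⟨c, hc, h3⟩ := bdd_of_supp eta2_cont fun _ => eta2_supp
  exact ⟨a + b + c, by positivity, fun v => ⟨by linarith [h1 v], by linarith [h2 v], by linarith [h3 v]⟩⟩

lemma eta_even (v : ℝ) : eta (-v) = eta v := by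
  unfold eta
  rw [← integral_neg_eq_self]
  congr 1; ext w
  rw [psi.neg, show -v - -w = -(v - w) by ring, psi.neg]

lemma eta_csupp : HasCompactSupport eta := by
  refine HasCompactSupport.of_support_subset_isCompact (isCompact_Icc (a := (-1 : ℝ)) (b := 1)) fun v hv => ?_
  by_contra h
  refine hv (eta_supp ?_)
  by_contra h2
  rw [not_le, abs_lt] at h2
  exact h ⟨h2.1.le, h2.2.le⟩

lemma eta_zero_pos : 0 < eta 0 := by
  have : eta 0 = ∫ w, psi w * psi w := by
    unfold eta; congr 1; ext w; rw [zero_sub, psi.neg]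
  rw [this]
  refine Continuous.integral_pos_of_hasCompactSupport_nonneg_nonzero (x := 0) (by have := psi_cont; fun_prop)
    psi.hasCompactSupport.mul_right (fun w => mul_self_nonneg _) ?_
  have := psi.pos_of_mem_ball (x := 0) (by simp [psi])
  simpa using this.ne'

noncomputable def E2 : ℝ := ∫ v, eta v ^ 2

lemma E2_pos : 0 < E2 := by
  have h0 := eta_zero_pos
  refine Continuous.integral_pos_of_hasCompactSupport_nonneg_nonzero (x := 0) (by have := eta_cont; fun_prop)
    ?_ (fun w => sq_nonneg _) (by positivity)
  have := eta_csupp.mul_right (f' := eta)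
  convert! this using 1
  ext v; simp [sq]

lemma eta_int : Integrable (fun u => (eta u : ℂ)) :=
  (eta_cont.integrable_of_hasCompactSupport eta_csupp).ofReal

open FourierTransform in
lemma ft_eta (x : ℝ) : ft (fun u => (eta u : ℂ)) x = phi x := by
  have h1 : ft (fun u => (eta u : ℂ)) x = ft (fun u => (psi u : ℂ)) x ^ 2 := by
    have hp : Integrable (fun u => (psi u : ℂ)) := psi_int.ofReal
    rw [ft_eq, ft_eq, sq, ← Real.fourier_mul_convolution_eq hp hp]
    refine Real.fourier_congr_ae (Eventually.of_forall fun v => ?_) _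
    show (eta v : ℂ) = _
    unfold eta
    rw [← integral_complex_ofReal]
    simp [convolution]
  have h2 : (starRingEnd ℂ) (ft (fun u => (psi u : ℂ)) x) = ft (fun u => (psi u : ℂ)) x := by
    unfold ft
    rw [← integral_conj, ← integral_neg_eq_self]
    congr 1; ext u
    simp [ee_conj, psi.neg]
  obtain ⟨r, hr⟩ := Complex.conj_eq_iff_real.mp h2
  rw [h1, phi, hr]; simp

lemma phi_nonneg (x : ℝ) : 0 ≤ phi x := sq_nonneg _
lemma phi_cont : Continuous phi := by
  have := ft_cont psi_int.ofReal
  unfold phi; fun_prop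

lemma phi_bound : ∃ C, 0 < C ∧ ∀ x, phi x ≤ C / (1 + x ^ 2) := by
  obtain ⟨C, hC, h⟩ := eta_bdd
  refine ⟨2 * C + 2 * C, by positivity, fun x => ?_⟩
  have := ft_smooth_bound eta_deriv eta1_deriv eta2_cont (fun _ => eta_supp) (fun _ => eta1_supp)
    (fun u _ => (h u).1) (fun u _ => (h u).2.2) x
  rw [ft_eta] at this
  simpa [abs_of_nonneg (phi_nonneg x)] using this

lemma phi_int : Integrable phi := by
  obtain ⟨C, hC, h⟩ := phi_bound
  refine (int_inv_one_add_sq.const_mul C).mono' phi_cont.aestronglyMeasurable (Eventually.of_forall fun x => ?_)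
  simpa [div_eq_mul_inv, abs_of_nonneg (phi_nonneg x)] using h x

lemma phi_even (x : ℝ) : phi (-x) = phi x := by
  have : (phi (-x) : ℂ) = phi x := by
    rw [← ft_eta, ← ft_eta]
    unfold ft
    rw [← integral_neg_eq_self]
    congr 1; ext u; simp [eta_even]
  exact_mod_cast this

lemma ft_eta_int : Integrable (ft (fun u => (eta u : ℂ))) := by
  convert! phi_int.ofReal (𝕜 := ℂ) using 1
  ext x; exact ft_eta x

lemma phi_integral : ∫ x, phi x = 2 * Real.pi * eta 0 := by
  have := ft_inv (Complex.continuous_ofReal.comp eta_cont) eta_int ft_eta_int 0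
  simp only [ft_eta, zero_mul, ee_zero, mul_one, phi_even, Function.comp_def] at this
  rw [integral_complex_ofReal] at this
  exact_mod_cast this

lemma phi_sq_integral : ∫ x, phi x ^ 2 = 2 * Real.pi * E2 := by
  have := parseval (Complex.continuous_ofReal.comp eta_cont) eta_int ft_eta_int eta_int
  simp only [ft_eta, phi_even, Function.comp_def, ← sq, ← Complex.ofReal_pow] at this
  rw [integral_complex_ofReal, integral_complex_ofReal] at this
  unfold E2
  exact_mod_cast this

noncomputable def pp : ℝ → ℝ := dslope (fun u => -Real.exp (-2 * u)) 0

lemma pp_ne {u : ℝ} (hu : u ≠ 0) : pp u = (1 - Real.exp (-2 * u)) / u := by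
  rw [pp, dslope_of_ne _ hu, slope_def_field]; simp; ring

lemma pp_zero : pp 0 = 2 := by
  rw [pp, dslope_same]
  have : HasDerivAt (fun u : ℝ => -Real.exp (-2 * u)) 2 0 := by
    have := (((hasDerivAt_id (0 : ℝ)).const_mul (-2)).exp).neg
    convert! this using 1
    simp
  exact this.deriv

lemma pp_pos (u : ℝ) : 0 < pp u := by
  by_cases hu : u = 0
  · rw [hu, pp_zero]; norm_num
  rw [pp_ne hu]
  rcases lt_or_gt_of_ne hu with h | h
  · refine div_pos_of_neg_of_neg ?_ h
    have := Real.one_lt_exp_iff.mpr (show 0 < -2 * u by linarith); linarith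
  · refine div_pos ?_ h
    have := Real.exp_lt_one_iff.mpr (show -2 * u < 0 by linarith); linarith

lemma pp_smooth : ContDiff ℝ 2 pp := by
  rw [contDiff_iff_contDiffAt]
  intro u
  by_cases hu : u = 0
  · have ha : AnalyticAt ℝ (fun u : ℝ => -Real.exp (-2 * u)) 0 := by fun_prop
    obtain ⟨p, hp⟩ := ha
    have := hp.has_fpower_series_dslope_fslope
    rw [hu]
    exact this.analyticAt.contDiffAt
  · have : pp =ᶠ[𝓝 u] fun u => (1 - Real.exp (-2 * u)) / u := by
      filter_upwards [isOpen_ne.mem_nhds hu] with v hv using pp_ne hv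
    refine ContDiffAt.congr_of_eventuallyEq ?_ this
    refine ContDiffAt.div (by fun_prop) (by fun_prop) hu

noncomputable def Q (u : ℝ) : ℝ := Real.exp (3 / 2 * u) / pp u
noncomputable def Q1 : ℝ → ℝ := deriv Q
noncomputable def Q2 : ℝ → ℝ := deriv Q1

lemma Q_smooth : ContDiff ℝ 2 Q := by
  unfold Q
  exact ContDiff.div (by fun_prop) pp_smooth fun u => (pp_pos u).ne'
lemma Q_deriv (u : ℝ) : HasDerivAt Q (Q1 u) u :=
  (Q_smooth.differentiable (by norm_num)).differentiableAt.hasDerivAt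
lemma Q1_smooth : ContDiff ℝ 1 Q1 := by
  have := Q_smooth
  rw [show (2 : WithTop ℕ∞) = 1 + 1 by norm_num, contDiff_succ_iff_deriv] at this
  exact this.2.2
lemma Q1_deriv (u : ℝ) : HasDerivAt Q1 (Q2 u) u :=
  (Q1_smooth.differentiable (by norm_num)).differentiableAt.hasDerivAt
lemma Q2_cont : Continuous Q2 := Q1_smooth.continuous_deriv (by norm_num)
lemma Q1_cont : Continuous Q1 := Q1_smooth.continuous
lemma Q_cont : Continuous Q := Q_smooth.continuous
lemma Q_zero : Q 0 = 1 / 2 := by simp [Q, pp_zero]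

lemma Q_bdd (B : ℝ) : ∃ C, 0 < C ∧ ∀ u ∈ Icc 0 B, |Q u| ≤ C ∧ |Q1 u| ≤ C ∧ |Q2 u| ≤ C := by
  have hc : Continuous fun u => |Q u| + |Q1 u| + |Q2 u| := by
    have := Q_cont; have := Q1_cont; have := Q2_cont; fun_prop
  obtain ⟨C, hC⟩ := (isCompact_Icc (a := (0 : ℝ)) (b := B)).exists_bound_of_continuousOn hc.continuousOn
  refine ⟨|C| + 1, by positivity, fun u hu => ?_⟩
  have h1 := hC u hu
  rw [Real.norm_eq_abs, abs_of_nonneg (by positivity)] at h1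
  have := abs_nonneg (Q u); have := abs_nonneg (Q1 u); have := abs_nonneg (Q2 u)
  have := le_abs_self C
  refine ⟨?_, ?_, ?_⟩ <;> linarith

noncomputable def kap (a b u : ℝ) : ℝ := (Real.exp (-a * |u|) - Real.exp (-b * |u|)) / |u|

lemma Q_kap {u : ℝ} (hu : u ≠ 0) : Q |u| * kap 2 4 u = Real.exp (-(1/2) * |u|) := by
  have h0 : 0 < |u| := abs_pos.mpr hu
  have h1 : 1 - Real.exp (-2 * |u|) ≠ 0 := by
    have := Real.exp_lt_one_iff.mpr (show -2 * |u| < 0 by linarith); linarith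
  rw [Q, pp_ne h0.ne', kap, show Real.exp (-4 * |u|) = Real.exp (-2 * |u|) * Real.exp (-2 * |u|) by
    rw [← Real.exp_add]; ring_nf, show Real.exp (-(1/2) * |u|) = Real.exp (3 / 2 * |u|) * Real.exp (-2 * |u|) by
    rw [← Real.exp_add]; ring_nf]
  set e := Real.exp (-2 * |u|)
  have : e - e * e = e * (1 - e) := by ring
  rw [this]
  field_simp

noncomputable def fy (y u : ℝ) : ℝ := eta (u - y) * Q |u|

lemma fy_cont (y : ℝ) : Continuous (fy y) := by
  have := eta_cont; have := Q_cont
  unfold fy; fun_prop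

lemma fy_supp {y M : ℝ} (hy : y ∈ Icc 0 M) {u : ℝ} (h : M + 1 ≤ |u|) : fy y u = 0 := by
  rw [fy, eta_supp, zero_mul]
  have := abs_sub_abs_le_abs_sub u y
  rw [abs_of_nonneg hy.1] at this
  linarith [hy.2]

lemma fy_int {y : ℝ} (hy : 0 ≤ y) : Integrable (fun u => (fy y u : ℂ)) := by
  refine Integrable.ofReal ((fy_cont y).integrable_of_hasCompactSupport ?_)
  refine HasCompactSupport.of_support_subset_isCompact (isCompact_Icc (a := -(y + 1)) (b := y + 1)) fun v hv => ?_
  by_contra h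
  refine hv (fy_supp (M := y) ⟨hy, le_rfl⟩ ?_)
  by_contra h2
  rw [not_le, abs_lt] at h2
  exact h ⟨h2.1.le, h2.2.le⟩

lemma fy_bound (M : ℝ) (hM : 0 ≤ M) : ∃ C, 0 < C ∧ ∀ y ∈ Icc 0 M, ∀ x,
    ‖ft (fun u => (fy y u : ℂ)) x‖ ≤ C / (1 + x ^ 2) := by
  obtain ⟨a, ha, he⟩ := eta_bdd
  obtain ⟨q, hq, hQ⟩ := Q_bdd (M + 1)
  refine ⟨a * q * (2 * (M + 1)) + (4 * (a * q) * (M + 1) + 4 * (a * q) * (M + 1) + 4 * (a * q)), by positivity, ?_⟩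
  intro y hy x
  have hB : (0 : ℝ) ≤ M + 1 := by linarith
  set B := M + 1 with hBdef
  have mm : ∀ s t : ℝ, |s| ≤ a → |t| ≤ q → |s * t| ≤ a * q := fun s t hs ht => by
    rw [abs_mul]; gcongr
  have hsup : ∀ u, u ∉ Ioc (-B) B → fy y u = 0 := by
    intro u hu
    apply fy_supp hy
    by_contra hcon
    rw [not_le, abs_lt] at hcon
    exact hu ⟨hcon.1, hcon.2.le⟩
  rw [ft_interval (by linarith) hsup]
  refine bound_combine ?_ ?_
  · refine (int_bound (B := a * q) (by linarith) fun u hu => ?_).trans (by linarith)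
    exact mm _ _ (he _).1 (hQ _ ⟨abs_nonneg u, abs_le.mpr hu⟩).1
  have hcont : Continuous fun u => (fy y u : ℂ) * ee (u * x) := by
    have := fy_cont y; have := ee_cont; fun_prop
  rw [← intervalIntegral.integral_add_adjacent_intervals (hcont.intervalIntegrable (-B) 0)
    (hcont.intervalIntegrable 0 B)]
  have dE : ∀ u, HasDerivAt (fun u => eta (u - y)) (eta1 (u - y)) u := fun u => by
    simpa using (eta_deriv (u - y)).comp_sub_const u y
  have dE1 : ∀ u, HasDerivAt (fun u => eta1 (u - y)) (eta2 (u - y)) u := fun u => by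
    simpa using (eta1_deriv (u - y)).comp_sub_const u y
  have dN : ∀ (F F1 : ℝ → ℝ) (_ : ∀ u, HasDerivAt F (F1 u) u) (u : ℝ), HasDerivAt (fun u => F (-u)) (-F1 (-u)) u :=
    fun F F1 hF u => by
      have := (hF (-u)).scomp u (hasDerivAt_neg u)
      convert! this using 1
      simp
  have ec := eta_cont; have ec1 := eta1_cont; have ec2 := eta2_cont
  have qc := Q_cont; have qc1 := Q1_cont; have qc2 := Q2_cont
  set h1 : ℝ → ℝ := fun u => eta1 (u - y) * Q u + eta (u - y) * Q1 u with hh1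
  set h2 : ℝ → ℝ := fun u => eta2 (u - y) * Q u + eta1 (u - y) * Q1 u + (eta1 (u - y) * Q1 u + eta (u - y) * Q2 u) with hh2
  set k1 : ℝ → ℝ := fun u => eta1 (u - y) * Q (-u) + eta (u - y) * -Q1 (-u) with hk1
  set k2 : ℝ → ℝ := fun u => eta2 (u - y) * Q (-u) + eta1 (u - y) * -Q1 (-u) +
    (eta1 (u - y) * -Q1 (-u) + eta (u - y) * Q2 (-u)) with hk2
  have A1 := half_ibp (h := fun u => eta (u - y) * Q u) (h1 := h1) (h2 := h2)
    (fun u => (dE u).mul (Q_deriv u)) (fun u => ((dE1 u).mul (Q_deriv u)).add ((dE u).mul (Q1_deriv u)))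
    (by fun_prop) 0 B x
  have A2 := half_ibp (h := fun u => eta (u - y) * Q (-u)) (h1 := k1) (h2 := k2)
    (fun u => (dE u).mul (dN _ _ Q_deriv u))
    (fun u => by
      have := ((dE1 u).mul (dN _ _ Q_deriv u)).add ((dE u).mul (dN _ _ Q1_deriv u).neg)
      convert! this using 1
      simp [hk2])
    (by fun_prop) (-B) 0 x
  have I1 : ∫ u in (0 : ℝ)..B, (fy y u : ℂ) * ee (u * x) = ∫ u in (0 : ℝ)..B, ((eta (u - y) * Q u : ℝ) : ℂ) * ee (u * x) := by
    refine intervalIntegral.integral_congr fun u hu => ?_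
    rw [uIcc_of_le hB] at hu
    simp only [fy, abs_of_nonneg hu.1]
  have I2 : ∫ u in (-B)..(0 : ℝ), (fy y u : ℂ) * ee (u * x) = ∫ u in (-B)..(0 : ℝ), ((eta (u - y) * Q (-u) : ℝ) : ℂ) * ee (u * x) := by
    refine intervalIntegral.integral_congr fun u hu => ?_
    rw [uIcc_of_le (by linarith)] at hu
    simp only [fy, abs_of_nonpos hu.2]
  have z1 : 1 ≤ |B - y| := by rw [abs_of_nonneg] <;> linarith [hy.2]
  have z2 : 1 ≤ |-B - y| := by rw [abs_of_nonpos] <;> linarith [hy.1]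
  have y1 : h1 B = 0 := by simp only [hh1, eta_supp z1, eta1_supp z1]; ring
  have y2 : k1 (-B) = 0 := by simp only [hk1, eta_supp z2, eta1_supp z2]; ring
  rw [I1, I2, mul_add, A1, A2, y1, y2]
  simp only [eta_supp z1, eta_supp z2, neg_zero, zero_sub, zero_mul, ee_zero]
  have b0 := hQ 0 ⟨le_rfl, hB⟩
  have bh1 : |h1 0| ≤ 2 * (a * q) := by
    refine (abs_add_le _ _).trans ?_
    linarith [mm _ _ (he (0 - y)).2.1 b0.1, mm _ _ (he (0 - y)).1 b0.2.1]
  have bk1 : |k1 0| ≤ 2 * (a * q) := by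
    refine (abs_add_le _ _).trans ?_
    simp only [neg_zero]
    linarith [mm _ _ (he (0 - y)).2.1 b0.1, mm _ _ (he (0 - y)).1 (by rw [abs_neg]; exact b0.2.1)]
  have bh2 : ∀ u ∈ Icc 0 B, |h2 u| ≤ 4 * (a * q) := by
    intro u hu
    have b0 := hQ u hu
    have e0 := he (u - y)
    refine (abs_add_le _ _).trans ((add_le_add (abs_add_le _ _) (abs_add_le _ _)).trans ?_)
    linarith [mm _ _ e0.2.2 b0.1, mm _ _ e0.2.1 b0.2.1, mm _ _ e0.1 b0.2.2]
  have bk2 : ∀ u ∈ Icc (-B) 0, |k2 u| ≤ 4 * (a * q) := by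
    intro u hu
    have b0 := hQ (-u) ⟨by linarith [hu.2], by linarith [hu.1]⟩
    have e0 := he (u - y)
    refine (abs_add_le _ _).trans ((add_le_add (abs_add_le _ _) (abs_add_le _ _)).trans ?_)
    linarith [mm _ _ e0.2.2 b0.1, mm _ _ e0.2.1 (show |-Q1 (-u)| ≤ q by rw [abs_neg]; exact b0.2.1), mm _ _ e0.1 b0.2.2]
  have J1 := int_bound (x := x) hB bh2
  have J2 := int_bound (x := x) (show -B ≤ 0 by linarith) bk2
  set X1 := ∫ u in (0 : ℝ)..B, (h2 u : ℂ) * ee (u * x)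
  set X2 := ∫ u in (-B)..(0 : ℝ), (k2 u : ℂ) * ee (u * x)
  have n1 : ‖(h1 0 : ℂ)‖ ≤ 2 * (a * q) := by simpa using bh1
  have n2 : ‖(k1 0 : ℂ)‖ ≤ 2 * (a * q) := by simpa using bk1
  calc _ = ‖X2 + X1 + (h1 0 : ℂ) - (k1 0 : ℂ)‖ := by congr 1; push_cast; ring
    _ ≤ ‖X2‖ + ‖X1‖ + ‖(h1 0 : ℂ)‖ + ‖(k1 0 : ℂ)‖ :=
      (norm_sub_le _ _).trans (by gcongr; exact (norm_add_le _ _).trans (by gcongr; exact norm_add_le _ _))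
    _ ≤ _ := by linarith

lemma fy_ft_int {y : ℝ} (hy : 0 ≤ y) : Integrable (ft (fun u => (fy y u : ℂ))) := by
  obtain ⟨C, _, h⟩ := fy_bound y hy
  exact int_of_bound (ft_cont (fy_int hy)) (h y ⟨hy, le_rfl⟩)

lemma exp_abs_int {c : ℝ} (hc : 0 < c) : Integrable (fun u : ℝ => Real.exp (-c * |u|)) := by
  rw [← integrableOn_univ, ← Iic_union_Ioi (a := (0 : ℝ))]
  refine IntegrableOn.union ?_ ?_
  · refine (integrableOn_exp_mul_Iic hc 0).congr_fun (fun u hu => ?_) measurableSet_Iic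
    simp only [mem_Iic] at hu
    simp [abs_of_nonpos hu]
  · refine (integrableOn_exp_mul_Ioi (a := -c) (by linarith) 0).congr_fun (fun u hu => ?_) measurableSet_Ioi
    simp only [mem_Ioi] at hu
    simp [abs_of_pos hu]

lemma ft_exp_abs {c : ℝ} (hc : 0 < c) (x : ℝ) :
    ft (fun u => (Real.exp (-c * |u|) : ℂ)) x = ((2 * c / (c ^ 2 + x ^ 2) : ℝ) : ℂ) := by
  have hi : Integrable (fun u : ℝ => (Real.exp (-c * |u|) : ℂ) * ee (u * x)) := ee_int (exp_abs_int hc).ofReal x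
  change ∫ u : ℝ, (Real.exp (-c * |u|) : ℂ) * ee (u * x) = _
  rw [← integral_add_compl measurableSet_Iic hi, compl_Iic]
  have e1 : ∫ u in Iic (0 : ℝ), (Real.exp (-c * |u|) : ℂ) * ee (u * x) = ∫ u in Iic (0 : ℝ), Complex.exp ((c + x * Complex.I) * u) := by
    refine setIntegral_congr_fun measurableSet_Iic fun u hu => ?_
    simp only [mem_Iic] at hu
    simp only [abs_of_nonpos hu, ee, Complex.ofReal_exp, ← Complex.exp_add]
    congr 1; push_cast; ring
  have e2 : ∫ u in Ioi (0 : ℝ), (Real.exp (-c * |u|) : ℂ) * ee (u * x) = ∫ u in Ioi (0 : ℝ), Complex.exp ((-c + x * Complex.I) * u) := by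
    refine setIntegral_congr_fun measurableSet_Ioi fun u hu => ?_
    simp only [mem_Ioi] at hu
    simp only [abs_of_pos hu, ee, Complex.ofReal_exp, ← Complex.exp_add]
    congr 1; push_cast; ring
  erw [e1, e2]
  rw [integral_exp_mul_complex_Iic (by simpa using hc), integral_exp_mul_complex_Ioi (by simpa using hc)]
  have n1 : (c + x * Complex.I : ℂ) ≠ 0 := by
    intro h; have := congrArg Complex.re h; simp at this; linarith
  have n2 : (-c + x * Complex.I : ℂ) ≠ 0 := by
    intro h; have := congrArg Complex.re h; simp at this; linarith
  have n3 : (c ^ 2 + x ^ 2 : ℂ) ≠ 0 := by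
    have : (0 : ℝ) < c ^ 2 + x ^ 2 := by positivity
    exact_mod_cast this.ne'
  simp only [Complex.ofReal_zero, mul_zero, Complex.exp_zero]
  push_cast
  field_simp
  ring_nf
  simp [Complex.I_sq]

lemma kap_eq {a b u : ℝ} (hu : u ≠ 0) : ∫ c in a..b, Real.exp (-c * |u|) = kap a b u := by
  have h0 : |u| ≠ 0 := abs_ne_zero.mpr hu
  have : ∀ c ∈ uIcc a b, HasDerivAt (fun c => -Real.exp (-c * |u|) / |u|) (Real.exp (-c * |u|)) c := by
    intro c _
    have := ((((hasDerivAt_id c).neg.mul_const |u|).exp).neg).div_const |u|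
    convert! this using 1
    field_simp
    simp [mul_comm]
  rw [intervalIntegral.integral_eq_sub_of_hasDerivAt this (Continuous.intervalIntegrable (by fun_prop) _ _), kap]
  ring

lemma kap_nonneg {a b : ℝ} (hab : a ≤ b) (u : ℝ) : 0 ≤ kap a b u := by
  refine div_nonneg (sub_nonneg.mpr (Real.exp_le_exp.mpr ?_)) (abs_nonneg u)
  nlinarith [abs_nonneg u]

lemma kap_le {a b : ℝ} (hab : a ≤ b) (u : ℝ) : kap a b u ≤ (b - a) * Real.exp (-a * |u|) := by
  by_cases hu : u = 0
  · simp [kap, hu]; linarith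
  have h0 : 0 < |u| := abs_pos.mpr hu
  rw [kap, div_le_iff₀ h0]
  have h := Real.add_one_le_exp (-(b - a) * |u|)
  have : Real.exp (-b * |u|) = Real.exp (-a * |u|) * Real.exp (-(b - a) * |u|) := by
    rw [← Real.exp_add]; ring_nf
  rw [this]
  nlinarith [Real.exp_pos (-a * |u|)]

lemma kap_meas (a b : ℝ) : Measurable (kap a b) := by unfold kap; fun_prop

lemma kap_int {a b : ℝ} (ha : 0 < a) (hab : a ≤ b) : Integrable (kap a b) := by
  refine ((exp_abs_int ha).const_mul (b - a)).mono' (kap_meas a b).aestronglyMeasurable (Eventually.of_forall fun u => ?_)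
  rw [Real.norm_eq_abs, abs_of_nonneg (kap_nonneg hab u)]
  exact kap_le hab u

lemma frullani {a b : ℝ} (ha : 0 < a) (hab : a ≤ b) (x : ℝ) :
    ft (fun u => (kap a b u : ℂ)) x = ((Real.log (b ^ 2 + x ^ 2) - Real.log (a ^ 2 + x ^ 2) : ℝ) : ℂ) := by
  have e1 : ft (fun u => (kap a b u : ℂ)) x = ∫ u, ∫ c in Ioc a b, (Real.exp (-c * |u|) : ℂ) * ee (u * x) := by
    unfold ft
    refine integral_congr_ae ?_
    have : ∀ᵐ u : ℝ, u ≠ 0 := by simp [ae_iff]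
    filter_upwards [this] with u hu
    rw [← kap_eq hu, intervalIntegral.integral_of_le hab, integral_mul_const, integral_complex_ofReal]
  rw [e1, integral_integral_swap]
  · have e2 : ∀ c ∈ Ioc a b, ∫ u, (Real.exp (-c * |u|) : ℂ) * ee (u * x) = ((2 * c / (c ^ 2 + x ^ 2) : ℝ) : ℂ) :=
      fun c hc => ft_exp_abs (ha.trans hc.1) x
    rw [setIntegral_congr_fun measurableSet_Ioc e2, integral_complex_ofReal, ← intervalIntegral.integral_of_le hab]
    congr 1
    have hd : ∀ c ∈ uIcc a b, HasDerivAt (fun c => Real.log (c ^ 2 + x ^ 2)) (2 * c / (c ^ 2 + x ^ 2)) c := by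
      intro c hc
      rw [uIcc_of_le hab] at hc
      have : 0 < c := by linarith [hc.1]
      have := ((hasDerivAt_pow 2 c).add_const (x ^ 2)).log (by positivity)
      simpa using this
    refine intervalIntegral.integral_eq_sub_of_hasDerivAt hd (ContinuousOn.intervalIntegrable ?_)
    intro c hc
    rw [uIcc_of_le hab] at hc
    have : 0 < c := by linarith [hc.1]
    have h2 : c ^ 2 + x ^ 2 ≠ 0 := by positivity
    exact ContinuousAt.continuousWithinAt (by fun_prop (disch := assumption))
  · have hb : Integrable (fun z : ℝ × ℝ => Real.exp (-a * |z.1|) * (1 : ℝ)) (volume.prod (volume.restrict (Ioc a b))) :=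
      (exp_abs_int ha).mul_prod (integrable_const 1)
    refine hb.mono' ?_ ?_
    · have := ee_cont
      refine Continuous.aestronglyMeasurable ?_
      simp only [Function.uncurry_def]
      fun_prop
    · have : ∀ᵐ z : ℝ × ℝ ∂(volume.prod (volume.restrict (Ioc a b))), z.2 ∈ Ioc a b := by
        refine Measure.quasiMeasurePreserving_snd.ae (p := fun c => c ∈ Ioc a b) ?_
        exact ae_restrict_mem measurableSet_Ioc
      filter_upwards [this] with z hz
      simp only [Function.uncurry_def, norm_mul, ee_norm, mul_one, Complex.norm_real, Real.norm_eq_abs, Real.abs_exp]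
      refine Real.exp_le_exp.mpr ?_
      nlinarith [abs_nonneg z.1, hz.1]

open ArithmeticFunction in
lemma mangoldt_hasSum {σ t : ℝ} (hσ : 2 ≤ σ) :
    HasSum (fun n : ℕ => Λ n * Real.exp (-σ * |Real.log n|) * Real.cos (t * Real.log n))
      (-(deriv riemannZeta (σ + t * Complex.I) / riemannZeta (σ + t * Complex.I)).re) := by
  have hs : 1 < (σ + t * Complex.I : ℂ).re := by simp; linarith
  have h := (LSeriesSummable_vonMangoldt hs).hasSum
  have h2 := LSeries_vonMangoldt_eq_deriv_riemannZeta_div hs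
  rw [LSeries] at h2
  rw [h2] at h
  have h3 := Complex.hasSum_re h
  rw [neg_div, Complex.neg_re] at h3
  convert! h3 using 1
  ext n
  rcases Nat.eq_zero_or_pos n with rfl | hn
  · simp
  · rw [LSeries.term_of_ne_zero hn.ne', Complex.cpow_def_of_ne_zero (by exact_mod_cast hn.ne'), div_eq_mul_inv,
      ← Complex.exp_neg, Complex.re_ofReal_mul, (Complex.natCast_log (n := n)).symm, Complex.exp_re,
      abs_of_nonneg (Real.log_natCast_nonneg n)]
    have e1 : (-((Real.log n : ℂ) * (σ + t * Complex.I))).re = -σ * Real.log n := by simp [-Complex.natCast_log, -Complex.ofReal_log]; ring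
    have e2 : (-((Real.log n : ℂ) * (σ + t * Complex.I))).im = -(t * Real.log n) := by simp [-Complex.natCast_log, -Complex.ofReal_log]; ring
    rw [e1, e2, Real.cos_neg]
    ring

open ArithmeticFunction in
lemma mangoldt_summable : Summable (fun n : ℕ => Λ n * Real.exp (-2 * |Real.log n|)) := by
  have := (mangoldt_hasSum (σ := 2) (t := 0) le_rfl).summable
  simpa using this

open ArithmeticFunction in
lemma zeta_log_series (t : ℝ) :
    HasSum (fun n : ℕ => -(Λ n * kap 2 4 (Real.log n) * (2 * Real.cos (t * Real.log n))))
      (2 * Real.log ‖riemannZeta (4 + t * Complex.I)‖ - 2 * Real.log ‖riemannZeta (2 + t * Complex.I)‖) := by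
  have hre : ∀ σ : ℝ, (σ + t * Complex.I : ℂ).re = σ := by simp
  have hd : ∀ σ ∈ uIcc (2 : ℝ) 4, HasDerivAt (fun σ : ℝ => 2 * Real.log ‖riemannZeta (σ + t * Complex.I)‖)
      (2 * (deriv riemannZeta (σ + t * Complex.I) / riemannZeta (σ + t * Complex.I)).re) σ := by
    intro σ hσ
    rw [uIcc_of_le (by norm_num)] at hσ
    have hs2 : 2 ≤ (σ + t * Complex.I : ℂ).re := by rw [hre]; exact hσ.1
    have hs1 : (σ + t * Complex.I : ℂ) ≠ 1 := by
      intro h; rw [h] at hs2; norm_num at hs2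
    have hz := (analyticAt_zeta hs1).differentiableAt.hasDerivAt
    have hl : HasDerivAt (fun σ : ℝ => (σ + t * Complex.I : ℂ)) 1 σ :=
      (Complex.ofRealCLM.hasDerivAt (x := σ)).add_const _
    have hc := hz.comp_of_eq σ hl rfl
    have hslit : riemannZeta (σ + t * Complex.I) ∈ Complex.slitPlane := by
      have := zeta_sub_one hs2
      have h3 := (Complex.abs_re_le_norm _).trans this
      rw [abs_le] at h3
      left
      simp at h3
      linarith [h3.1]
    have h4 := (hc.clog_real hslit)
    have h5 := (Complex.reCLM.hasFDerivAt.comp_hasDerivAt σ h4).const_mul 2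
    convert! h5 using 1
    · ext τ; simp [Complex.log_re]
    · simp
  have hcont : ContinuousOn (fun σ : ℝ => 2 * (deriv riemannZeta (σ + t * Complex.I) / riemannZeta (σ + t * Complex.I)).re) (uIcc (2:ℝ) 4) := by
    intro σ hσ
    rw [uIcc_of_le (by norm_num)] at hσ
    have hs2 : 2 ≤ (σ + t * Complex.I : ℂ).re := by rw [hre]; exact hσ.1
    have hs1 : (σ + t * Complex.I : ℂ) ≠ 1 := by
      intro h; rw [h] at hs2; norm_num at hs2
    have ha := analyticAt_zeta hs1
    have hne : riemannZeta (σ + t * Complex.I) ≠ 0 := riemannZeta_ne_zero_of_one_le_re (by linarith)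
    have hq : ContinuousAt (fun s => deriv riemannZeta s / riemannZeta s) (σ + t * Complex.I) :=
      ha.deriv.continuousAt.div ha.continuousAt hne
    have hl : ContinuousAt (fun σ : ℝ => (σ + t * Complex.I : ℂ)) σ := by fun_prop
    have := hq.comp_of_eq hl rfl
    exact (continuousAt_const.mul (Complex.continuous_re.continuousAt.comp this)).continuousWithinAt
  have hF := intervalIntegral.integral_eq_sub_of_hasDerivAt hd hcont.intervalIntegrable
  have h := intervalIntegral.hasSum_integral_of_dominated_convergence (a := 2) (b := 4) (μ := volume)
    (F := fun (n : ℕ) σ => -2 * (Λ n * Real.exp (-σ * |Real.log n|) * Real.cos (t * Real.log n)))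
    (f := fun σ : ℝ => 2 * (deriv riemannZeta (σ + t * Complex.I) / riemannZeta (σ + t * Complex.I)).re)
    (fun n σ => 2 * (Λ n * Real.exp (-2 * |Real.log n|))) (fun n => Continuous.aestronglyMeasurable (by fun_prop))
    (fun n => Eventually.of_forall fun σ hσ => ?_)
    (Eventually.of_forall fun σ hσ => mangoldt_summable.mul_left 2) intervalIntegrable_const
    (Eventually.of_forall fun σ hσ => ?_)
  · rw [hF] at h
    convert! h using 1
    ext n
    rw [intervalIntegral.integral_const_mul, intervalIntegral.integral_mul_const, intervalIntegral.integral_const_mul]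
    by_cases hn : Real.log n = 0
    · have : Λ n = 0 := by
        rw [vonMangoldt_eq_zero_iff]
        intro hp
        have h1 := hp.one_lt
        have : 0 < Real.log n := Real.log_pos (by exact_mod_cast h1)
        linarith
      simp [this]
    · rw [kap_eq hn]; ring
  · rw [uIoc_of_le (by norm_num)] at hσ
    rw [norm_mul, norm_mul, norm_mul, Real.norm_eq_abs (Λ n), abs_of_nonneg vonMangoldt_nonneg, Real.norm_eq_abs (Real.exp _), Real.abs_exp]
    have h1 : ‖Real.cos (t * Real.log n)‖ ≤ 1 := Real.abs_cos_le_one _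
    have h2 : Real.exp (-σ * |Real.log n|) ≤ Real.exp (-2 * |Real.log n|) := by
      refine Real.exp_le_exp.mpr ?_
      nlinarith [abs_nonneg (Real.log n), hσ.1]
    have h0 : 0 ≤ Λ n := vonMangoldt_nonneg
    simp only [norm_neg, Real.norm_ofNat]
    calc 2 * (Λ n * Real.exp (-σ * |Real.log n|) * ‖Real.cos (t * Real.log n)‖)
        ≤ 2 * (Λ n * Real.exp (-2 * |Real.log n|) * 1) := by gcongr
      _ = _ := by ring
  · rw [uIoc_of_le (by norm_num)] at hσ
    have := (mangoldt_hasSum (σ := σ) (t := t) hσ.1.le).mul_left (-2)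
    convert! this using 1
    ring

noncomputable def AG (t : ℝ) : ℝ :=
  Real.log (4 ^ 2 + t ^ 2) + Real.log (3 ^ 2 + t ^ 2) - Real.log (1 ^ 2 + t ^ 2) - 2 * Real.log (2 * Real.pi)
noncomputable def Zt (t : ℝ) : ℝ :=
  2 * Real.log ‖riemannZeta (4 + t * Complex.I)‖ - 2 * Real.log ‖riemannZeta (2 + t * Complex.I)‖
noncomputable def lr (ρ : NZ) (t : ℝ) : ℝ :=
  Real.log ((4 - ρ.1.re) ^ 2 + (t - ρ.1.im) ^ 2) - Real.log ((2 - ρ.1.re) ^ 2 + (t - ρ.1.im) ^ 2)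

lemma two_log_norm (z : ℂ) : 2 * Real.log ‖z‖ = Real.log (z.re ^ 2 + z.im ^ 2) := by
  have : z.re ^ 2 + z.im ^ 2 = ‖z‖ ^ 2 := by rw [Complex.sq_norm, Complex.normSq_apply]; ring
  rw [this, Real.log_pow]; norm_num

lemma zf (t : ℝ) : HasSum (fun ρ : NZ => mu ρ * lr ρ t) (AG t + Zt t) := by
  have h := (zero_formula (s := 2 + t * Complex.I) (by simp)).mul_left 2
  convert! h using 1
  · ext ρ
    have e1 : 2 * Real.log ‖2 + t * Complex.I + 2 - ρ.1‖ = Real.log ((4 - ρ.1.re) ^ 2 + (t - ρ.1.im) ^ 2) := by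
      rw [two_log_norm]; congr 3 <;> simp; norm_num
    have e2 : 2 * Real.log ‖2 + t * Complex.I - ρ.1‖ = Real.log ((2 - ρ.1.re) ^ 2 + (t - ρ.1.im) ^ 2) := by
      rw [two_log_norm]; congr 3 <;> simp
    unfold lr
    linear_combination mu ρ * (e2 - e1)
  · have e1 := two_log_norm (2 + t * Complex.I + 2)
    have e2 := two_log_norm (2 + t * Complex.I + 1)
    have e3 := two_log_norm (2 + t * Complex.I - 1)
    simp only [Complex.sub_re, Complex.add_re, Complex.mul_re, Complex.sub_im, Complex.add_im, Complex.mul_im, Complex.one_re, Complex.one_im,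
      Complex.ofReal_re, Complex.ofReal_im, Complex.I_re, Complex.I_im, Complex.re_ofNat, Complex.im_ofNat] at e1 e2 e3
    have e4 : (2 + t * Complex.I + 2 : ℂ) = 4 + t * Complex.I := by ring
    unfold AG Zt Aser
    rw [e4] at e1 ⊢
    ring_nf at e1 e2 e3 ⊢
    linear_combination e3 - e1 - e2

lemma lr_nonneg (ρ : NZ) (t : ℝ) : 0 ≤ lr ρ t := by
  obtain ⟨_, h0, h1⟩ := ρ.2
  refine sub_nonneg.mpr (Real.log_le_log ?_ ?_)
  · have : 0 < 2 - ρ.1.re := by linarith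
    positivity
  · nlinarith

lemma lr_cont (ρ : NZ) : Continuous (lr ρ) := by
  obtain ⟨_, h0, h1⟩ := ρ.2
  have p1 : ∀ t : ℝ, (4 - ρ.1.re) ^ 2 + (t - ρ.1.im) ^ 2 ≠ 0 := fun t => by
    have : 0 < 4 - ρ.1.re := by linarith
    positivity
  have p2 : ∀ t : ℝ, (2 - ρ.1.re) ^ 2 + (t - ρ.1.im) ^ 2 ≠ 0 := fun t => by
    have : 0 < 2 - ρ.1.re := by linarith
    positivity
  exact (Continuous.log (by fun_prop) p1).sub (Continuous.log (by fun_prop) p2)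

lemma AG_cont : Continuous AG := by
  unfold AG
  have p : ∀ a : ℝ, 0 < a → Continuous fun t : ℝ => Real.log (a ^ 2 + t ^ 2) := fun a ha =>
    Continuous.log (by fun_prop) fun t => by positivity
  exact (((p 4 (by norm_num)).add (p 3 (by norm_num))).sub (p 1 (by norm_num))).sub continuous_const

lemma Zt_cont : Continuous Zt := by
  have p : ∀ a : ℂ, 2 ≤ a.re → Continuous fun t : ℝ => Real.log ‖riemannZeta (a + t * Complex.I)‖ := by
    intro a ha
    have hre : ∀ t : ℝ, 2 ≤ (a + t * Complex.I).re := fun t => by simpa using ha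
    refine Continuous.log (Continuous.norm ?_) fun t => ?_
    · rw [continuous_iff_continuousAt]
      intro t
      have h1 : a + t * Complex.I ≠ 1 := by
        intro h; have := hre t; rw [h] at this; norm_num at this
      exact (analyticAt_zeta h1).continuousAt.comp_of_eq (by fun_prop : ContinuousAt (fun t : ℝ => a + t * Complex.I) t) rfl
    · have := (zeta_bounds (hre t)).1
      intro h; linarith
  exact ((p 4 (by norm_num)).const_mul 2).sub ((p 2 (by norm_num)).const_mul 2)

lemma Zt_bdd (t : ℝ) : |Zt t| ≤ 8 := by
  have z1 := zeta_bounds (s := 4 + t * Complex.I) (by simp; norm_num)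
  have z2 := zeta_bounds (s := 2 + t * Complex.I) (by simp)
  have g : ∀ z : ℝ, 1 / 3 ≤ z ∧ z ≤ 5 / 3 → |Real.log z| ≤ 2 := by
    intro z ⟨h1, h2⟩
    have h0 : 0 < z := by linarith
    rw [abs_le]
    constructor
    · have := Real.one_sub_inv_le_log_of_pos h0
      have : z⁻¹ ≤ 3 := by
        rw [inv_le_comm₀ h0 (by norm_num)]; linarith
      linarith
    · have := Real.log_le_sub_one_of_pos h0
      linarith
  have g1 := abs_le.mp (g _ z1)
  have g2 := abs_le.mp (g _ z2)
  rw [Zt, abs_le]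
  constructor <;> linarith [g1.1, g1.2, g2.1, g2.2]

lemma log_int : Integrable (fun x : ℝ => Real.log (2 + x ^ 2) / (1 + x ^ 2)) := by
  have h := (integrable_rpow_neg_one_add_norm_sq (E := ℝ) (μ := volume) (r := 3 / 2) (by simp; norm_num)).const_mul 8
  refine h.mono' ?_ (Eventually.of_forall fun x => ?_)
  · refine Continuous.aestronglyMeasurable ?_
    exact (Continuous.log (by fun_prop) fun t => by positivity).div (by fun_prop) fun t => by positivity
  · have hx : 0 < 1 + x ^ 2 := by positivity
    have hl : 0 ≤ Real.log (2 + x ^ 2) := Real.log_nonneg (by nlinarith)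
    rw [Real.norm_eq_abs, abs_of_nonneg (by positivity), div_le_iff₀ hx]
    have h1 : Real.log (2 + x ^ 2) ≤ (2 + x ^ 2) ^ (1 / 4 : ℝ) / (1 / 4) := Real.log_le_rpow_div (by positivity) (by norm_num)
    have h2 : (2 + x ^ 2) ^ (1 / 4 : ℝ) ≤ 2 * (1 + x ^ 2) ^ (1 / 4 : ℝ) := by
      calc (2 + x ^ 2) ^ (1 / 4 : ℝ) ≤ (2 * (1 + x ^ 2)) ^ (1 / 4 : ℝ) := by
            apply Real.rpow_le_rpow <;> nlinarith
        _ = 2 ^ (1 / 4 : ℝ) * (1 + x ^ 2) ^ (1 / 4 : ℝ) := Real.mul_rpow (by norm_num) hx.le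
        _ ≤ 2 * _ := by
          gcongr
          calc (2 : ℝ) ^ (1 / 4 : ℝ) ≤ 2 ^ (1 : ℝ) := Real.rpow_le_rpow_of_exponent_le (by norm_num) (by norm_num)
            _ = 2 := by norm_num
    have h3 : (1 + ‖x‖ ^ 2) ^ (-(3 / 2) / 2 : ℝ) * (1 + x ^ 2) = (1 + x ^ 2) ^ (1 / 4 : ℝ) := by
      rw [Real.norm_eq_abs, sq_abs]
      nth_rewrite 2 [← Real.rpow_one (1 + x ^ 2)]
      rw [← Real.rpow_add hx]; norm_num
    rw [mul_assoc, h3]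
    linarith

lemma log_dev {c t x : ℝ} (hc0 : 1 ≤ c) (hc : c ≤ 4) (ht : 2 ≤ t) :
    |Real.log (c ^ 2 + (t + x) ^ 2) - 2 * Real.log t| ≤ 3 + Real.log (2 + x ^ 2) := by
  have e : 2 * Real.log t = Real.log (t ^ 2) := by rw [Real.log_pow]; norm_num
  have hp : 0 < c ^ 2 + (t + x) ^ 2 := by positivity
  have h20 : Real.log 20 ≤ 3 := by
    rw [Real.log_le_iff_le_exp (by norm_num)]
    have h1 : (2.7182818283 : ℝ) < Real.exp 1 := Real.exp_one_gt_d9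
    have : Real.exp 3 = Real.exp 1 ^ 3 := by rw [← Real.exp_nat_mul]; norm_num
    rw [this]
    calc (20 : ℝ) ≤ 2.7182818283 ^ 3 := by norm_num
      _ ≤ _ := by gcongr
  have hm : Real.log (20 * (2 + x ^ 2)) ≤ 3 + Real.log (2 + x ^ 2) := by
    rw [Real.log_mul (by norm_num) (by positivity)]; linarith
  refine le_trans ?_ hm
  rw [e, ← Real.log_div hp.ne' (by positivity), abs_le]
  have ht2 : 4 ≤ t ^ 2 := by nlinarith
  have hcs : c ^ 2 ≤ 16 := by nlinarith
  have hc1 : 1 ≤ c ^ 2 := by nlinarith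
  constructor
  · rw [← Real.log_inv]
    refine Real.log_le_log (by positivity) ?_
    rw [inv_le_iff_one_le_mul₀ (by positivity), div_mul_eq_mul_div, le_div_iff₀ (by positivity)]
    nlinarith [sq_nonneg (t + 2 * x), mul_nonneg (sq_nonneg x) (sq_nonneg (t + x)), sq_nonneg x]
  · refine Real.log_le_log (by positivity) ?_
    rw [div_le_iff₀ (by positivity)]
    nlinarith [sq_nonneg (t - x), mul_nonneg (sub_nonneg.mpr ht2) (sq_nonneg x)]

lemma AG_dev {t x : ℝ} (ht : 2 ≤ t) : |AG (t + x) - 2 * Real.log t| ≤ 13 + 3 * Real.log (2 + x ^ 2) := by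
  have h1 := abs_le.mp (log_dev (c := 4) (t := t) (x := x) (by norm_num) (by norm_num) ht)
  have h2 := abs_le.mp (log_dev (c := 3) (t := t) (x := x) (by norm_num) (by norm_num) ht)
  have h3 := abs_le.mp (log_dev (c := 1) (t := t) (x := x) (by norm_num) (by norm_num) ht)
  have hpi : |Real.log (2 * Real.pi)| ≤ 2 := by
    have p1 := Real.pi_gt_three
    have p2 := Real.pi_lt_d2
    rw [abs_le]
    constructor
    · linarith [Real.log_nonneg (show 1 ≤ 2 * Real.pi by linarith)]
    · rw [Real.log_le_iff_le_exp (by linarith)]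
      have h1 : (2.7182818283 : ℝ) < Real.exp 1 := Real.exp_one_gt_d9
      have : Real.exp 2 = Real.exp 1 ^ 2 := by rw [← Real.exp_nat_mul]; norm_num
      rw [this]
      nlinarith
  have h4 := abs_le.mp hpi
  rw [AG, abs_le]
  constructor <;> linarith [h1.1, h1.2, h2.1, h2.2, h3.1, h3.2, h4.1, h4.2]

noncomputable def JJ : ℝ := ∫ x : ℝ, Real.log (2 + x ^ 2) / (1 + x ^ 2)

lemma W_int {F : ℝ → ℂ} {C A B : ℝ} (hF : Continuous F) (hb : ∀ x, ‖F x‖ ≤ C / (1 + x ^ 2)) {g : ℝ → ℝ}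
    (hg : Continuous g) (hgb : ∀ x, |g x| ≤ A + B * Real.log (2 + x ^ 2)) :
    Integrable (fun x => F (-x) * (g x : ℂ)) ∧ ‖∫ x, F (-x) * (g x : ℂ)‖ ≤ C * (A * Real.pi + B * JJ) := by
  have hi : Integrable (fun x : ℝ => C * (A * (1 + x ^ 2)⁻¹ + B * (Real.log (2 + x ^ 2) / (1 + x ^ 2)))) :=
    ((int_inv_one_add_sq.const_mul A).add (log_int.const_mul B)).const_mul C
  have hle : ∀ x, ‖F (-x) * (g x : ℂ)‖ ≤ C * (A * (1 + x ^ 2)⁻¹ + B * (Real.log (2 + x ^ 2) / (1 + x ^ 2))) := by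
    intro x
    rw [norm_mul, Complex.norm_real]
    have h1 := hb (-x)
    rw [neg_sq] at h1
    calc ‖F (-x)‖ * ‖g x‖ ≤ C / (1 + x ^ 2) * (A + B * Real.log (2 + x ^ 2)) :=
          mul_le_mul h1 (hgb x) (norm_nonneg _) ((norm_nonneg _).trans h1)
      _ = _ := by field_simp
  refine ⟨hi.mono' (Continuous.aestronglyMeasurable (by fun_prop)) (Eventually.of_forall hle), ?_⟩
  refine (norm_integral_le_of_norm_le hi (Eventually.of_forall hle)).trans (le_of_eq ?_)
  rw [integral_const_mul, integral_add (int_inv_one_add_sq.const_mul A) (log_int.const_mul B), integral_const_mul,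
    integral_const_mul, integral_univ_inv_one_add_sq, JJ]

lemma lr_ft (ρ : NZ) (x : ℝ) :
    ft (fun u => (kap (2 - ρ.1.re) (4 - ρ.1.re) u : ℂ)) (x - ρ.1.im) = lr ρ x := by
  obtain ⟨_, h0, h1⟩ := ρ.2
  rw [frullani (by linarith) (by linarith)]; rfl

noncomputable def Zr (ρ : NZ) (y t : ℝ) : ℂ :=
  ∫ u, ((eta (u - y) * Real.exp ((ρ.1.re - 1 / 2) * |u|) : ℝ) : ℂ) * ee (u * (t - ρ.1.im))

lemma ft_mod (f : ℝ → ℂ) (c x : ℝ) : ft (fun u => f u * ee (u * c)) x = ft f (c + x) := by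
  unfold ft
  congr 1; ext u
  rw [mul_add, ee_add, mul_assoc]

lemma per_zero {y : ℝ} (hy : 0 ≤ y) (t : ℝ) (ρ : NZ) :
    ∫ x, ft (fun u => (fy y u : ℂ)) (-x) * (lr ρ (t + x) : ℂ) = 2 * Real.pi * Zr ρ y t := by
  obtain ⟨_, h0, h1⟩ := ρ.2
  have hk : Integrable (fun u => (kap (2 - ρ.1.re) (4 - ρ.1.re) u : ℂ)) :=
    (kap_int (by linarith) (by linarith)).ofReal
  have hp := parseval (Complex.continuous_ofReal.comp (fy_cont y)) (fy_int hy) (fy_ft_int hy)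
    (ee_int hk (t - ρ.1.im))
  have e : ∀ x, ft (fun u => (kap (2 - ρ.1.re) (4 - ρ.1.re) u : ℂ) * ee (u * (t - ρ.1.im))) x = lr ρ (t + x) := by
    intro x
    rw [ft_mod, ← lr_ft]
    congr 1; ring
  simp only [e] at hp
  erw [hp]
  congr 1
  refine integral_congr_ae ?_
  have : ∀ᵐ u : ℝ, u ≠ 0 := by simp [ae_iff]
  filter_upwards [this] with u hu
  have e1 : kap (2 - ρ.1.re) (4 - ρ.1.re) u = Real.exp (ρ.1.re * |u|) * kap 2 4 u := by
    unfold kap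
    rw [← mul_div_assoc, mul_sub, ← Real.exp_add, ← Real.exp_add]
    ring_nf
  have e2 := Q_kap hu
  have e3 : kap (2 - ρ.1.re) (4 - ρ.1.re) u * fy y u = eta (u - y) * Real.exp ((ρ.1.re - 1 / 2) * |u|) := by
    rw [e1, fy, show (ρ.1.re - 1 / 2) * |u| = ρ.1.re * |u| + -(1 / 2) * |u| by ring, Real.exp_add, ← e2]
    ring
  rw [← e3]
  simp only [Function.comp_apply]
  push_cast
  ring

open ArithmeticFunction in
noncomputable def Pn (y t : ℝ) (n : ℕ) : ℂ :=
  ((Λ n * Real.exp (-(1 / 2) * |Real.log n|) : ℝ) : ℂ) *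
    (eta (Real.log n - y) * ee (t * Real.log n) + eta (-Real.log n - y) * ee (-(t * Real.log n)))

open ArithmeticFunction in
lemma Lam_zero {n : ℕ} (hn : Real.log n = 0) : Λ n = 0 := by
  rw [vonMangoldt_eq_zero_iff]
  intro hp
  have h1 := hp.one_lt
  have : 0 < Real.log n := Real.log_pos (by exact_mod_cast h1)
  linarith

open ArithmeticFunction in
lemma prime_side {y : ℝ} (hy : 0 ≤ y) (t : ℝ) :
    HasSum (fun n => -(2 * Real.pi * Pn y t n))
      (∫ x, ft (fun u => (fy y u : ℂ)) (-x) * (Zt (t + x) : ℂ)) := by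
  have hF := (fy_ft_int hy).comp_neg
  have hFc := ft_cont (fy_int hy)
  have hee := ee_cont
  have h := hasSum_integral_of_dominated_convergence (μ := (volume : Measure ℝ))
    (F := fun (n : ℕ) x => ft (fun u => (fy y u : ℂ)) (-x) *
      ((-(Λ n * kap 2 4 (Real.log n) * (2 * Real.cos ((t + x) * Real.log n))) : ℝ) : ℂ))
    (f := fun x => ft (fun u => (fy y u : ℂ)) (-x) * (Zt (t + x) : ℂ))
    (fun n x => ‖ft (fun u => (fy y u : ℂ)) (-x)‖ * (4 * (Λ n * Real.exp (-2 * |Real.log n|))))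
    (fun n => Continuous.aestronglyMeasurable (by fun_prop))
    (fun n => Eventually.of_forall fun x => ?_)
    (Eventually.of_forall fun x => (mangoldt_summable.mul_left 4).mul_left _)
    ?_
    (Eventually.of_forall fun x => ?_)
  · convert! h using 1
    ext n
    have hinv := fun u => ft_inv (Complex.continuous_ofReal.comp (fy_cont y)) (fy_int hy) (fy_ft_int hy) u
    have hi := fun u => ee_int hF u
    have e : ∀ x, ft (fun u => (fy y u : ℂ)) (-x) *
      ((-(Λ n * kap 2 4 (Real.log n) * (2 * Real.cos ((t + x) * Real.log n))) : ℝ) : ℂ) =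
      (-(Λ n * kap 2 4 (Real.log n) : ℝ) * ee (t * Real.log n)) * (ft (fun u => (fy y u : ℂ)) (-x) * ee (x * Real.log n)) +
      (-(Λ n * kap 2 4 (Real.log n) : ℝ) * ee (-(t * Real.log n))) * (ft (fun u => (fy y u : ℂ)) (-x) * ee (x * -Real.log n)) := by
      intro x
      have := ee_two_cos ((t + x) * Real.log n)
      rw [show (t + x) * Real.log n = t * Real.log n + x * Real.log n by ring, neg_add, ee_add, ee_add, ← mul_neg x] at this
      rw [show (t + x) * Real.log n = t * Real.log n + x * Real.log n by ring]
      rw [Complex.ofReal_neg, Complex.ofReal_mul (Λ n * kap 2 4 (Real.log n)), this]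
      ring
    simp only [e]
    rw [integral_add ((hi _).const_mul _) ((hi _).const_mul _), integral_const_mul, integral_const_mul]
    have h1 := hinv (Real.log n)
    have h2 := hinv (-Real.log n)
    simp only [mul_comm _ (_ : ℝ)] at h1 h2
    erw [h1, h2]
    simp only [Function.comp_apply, Pn]
    by_cases hn : Real.log n = 0
    · simp [Lam_zero hn]
    · have k := Q_kap hn
      rw [fy, fy, abs_neg, ← k]
      push_cast
      ring
  · rw [norm_mul, Complex.norm_real, Real.norm_eq_abs, abs_neg, abs_mul, abs_mul, abs_mul, abs_of_nonneg (vonMangoldt_nonneg (n := n)),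
      abs_of_nonneg (kap_nonneg (by norm_num) _), abs_two]
    have h1 := kap_le (a := 2) (b := 4) (by norm_num) (Real.log n)
    have h2 : |Real.cos ((t + x) * Real.log n)| ≤ 1 := Real.abs_cos_le_one _
    have h0 : 0 ≤ Λ n := vonMangoldt_nonneg
    refine mul_le_mul_of_nonneg_left ?_ (norm_nonneg _)
    calc Λ n * kap 2 4 (Real.log n) * (2 * |Real.cos ((t + x) * Real.log n)|)
        ≤ Λ n * ((4 - 2) * Real.exp (-2 * |Real.log n|)) * (2 * 1) := by gcongr
      _ = _ := by ring
  · simp only [tsum_mul_left]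
    exact hF.norm.mul_const _
  · exact (Complex.hasSum_ofReal.mpr (zeta_log_series (t + x))).mul_left _

noncomputable def Eg (y t : ℝ) : ℂ :=
  (2 * Real.pi : ℂ)⁻¹ * ∫ x, ft (fun u => (fy y u : ℂ)) (-x) * (AG (t + x) : ℂ)

lemma AG_int {y t : ℝ} (hy : 0 ≤ y) (ht : 2 ≤ t) :
    Integrable (fun x => ft (fun u => (fy y u : ℂ)) (-x) * (AG (t + x) : ℂ)) := by
  obtain ⟨C, hC, hb⟩ := fy_bound y hy
  have hA := AG_cont
  refine (W_int (A := 13 + 2 * Real.log t) (B := 3) (g := fun x => AG (t + x)) (ft_cont (fy_int hy)) (hb y ⟨hy, le_rfl⟩)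
    (by fun_prop) fun x => ?_).1
  have h1 := abs_le.mp (AG_dev (t := t) (x := x) ht)
  have h2 : 0 ≤ Real.log t := Real.log_nonneg (by linarith)
  rw [abs_le]; constructor <;> linarith [h1.1, h1.2]

lemma Zt_int {y : ℝ} (hy : 0 ≤ y) (t : ℝ) :
    Integrable (fun x => ft (fun u => (fy y u : ℂ)) (-x) * (Zt (t + x) : ℂ)) := by
  have hZ := Zt_cont
  refine (fy_ft_int hy).comp_neg.mul_bdd (c := 8) (Continuous.aestronglyMeasurable (by fun_prop)) (Eventually.of_forall fun x => ?_)
  rw [Complex.norm_real]; exact Zt_bdd _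

lemma explicit0 {y t : ℝ} (hy : 0 ≤ y) (ht : 2 ≤ t) :
    HasSum (fun ρ : NZ => (mu ρ : ℂ) * Zr ρ y t) (Eg y t - ∑' n, Pn y t n) := by
  have hP := prime_side hy t
  have hFc := ft_cont (fy_int hy)
  have hpi : (2 * Real.pi : ℂ) ≠ 0 := by exact_mod_cast (by positivity : 2 * Real.pi ≠ 0)
  have hcnt : Countable NZ := by
    have h : ({ρ : ℂ | IsNontrivialZero ρ}).Countable := by
      have : {ρ : ℂ | IsNontrivialZero ρ} ⊆ ⋃ n : ℕ, {ρ ∈ Metric.ball (0 : ℂ) n | IsNontrivialZero ρ} := by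
        intro ρ hρ
        obtain ⟨n, hn⟩ := exists_nat_gt ‖ρ‖
        exact mem_iUnion.mpr ⟨n, by simpa using hn, hρ⟩
      exact (countable_iUnion fun n : ℕ => (nz_finite _ Metric.isBounded_ball).countable).mono this
    exact h.to_subtype
  have hAZ : Integrable (fun x => ft (fun u => (fy y u : ℂ)) (-x) * ((AG (t + x) + Zt (t + x) : ℝ) : ℂ)) := by
    refine ((AG_int hy ht).add (Zt_int hy t)).congr (Eventually.of_forall fun x => ?_)
    simp only [Pi.add_apply]; push_cast; ring
  have h := hasSum_integral_of_dominated_convergence (μ := (volume : Measure ℝ))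
    (F := fun (ρ : NZ) x => ft (fun u => (fy y u : ℂ)) (-x) * ((mu ρ * lr ρ (t + x) : ℝ) : ℂ))
    (f := fun x => ft (fun u => (fy y u : ℂ)) (-x) * ((AG (t + x) + Zt (t + x) : ℝ) : ℂ))
    (fun ρ x => ‖ft (fun u => (fy y u : ℂ)) (-x)‖ * (mu ρ * lr ρ (t + x)))
    (fun ρ => by have := lr_cont ρ; exact Continuous.aestronglyMeasurable (by fun_prop))
    (fun ρ => Eventually.of_forall fun x => ?_)
    (Eventually.of_forall fun x => (zf (t + x)).summable.mul_left _)
    ?_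
    (Eventually.of_forall fun x => (Complex.hasSum_ofReal.mpr (zf (t + x))).mul_left _)
  · have e1 : ∫ x, ft (fun u => (fy y u : ℂ)) (-x) * ((AG (t + x) + Zt (t + x) : ℝ) : ℂ) =
        2 * Real.pi * (Eg y t - ∑' n, Pn y t n) := by
      have hs : ∑' n, -(2 * Real.pi * Pn y t n) = -(2 * Real.pi * ∑' n, Pn y t n) := by
        rw [tsum_neg, tsum_mul_left]
      rw [mul_sub, Eg, mul_inv_cancel_left₀ hpi, sub_eq_add_neg, ← hs, hP.tsum_eq, ← integral_add (AG_int hy ht) (Zt_int hy t)]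
      congr 1; ext x; push_cast; ring
    rw [e1] at h
    have h2 := h.mul_left (2 * Real.pi : ℂ)⁻¹
    rw [inv_mul_cancel_left₀ hpi] at h2
    convert! h2 using 1
    ext ρ
    have : ∀ x, ft (fun u => (fy y u : ℂ)) (-x) * ((mu ρ * lr ρ (t + x) : ℝ) : ℂ) =
        mu ρ * (ft (fun u => (fy y u : ℂ)) (-x) * (lr ρ (t + x) : ℂ)) := by intro x; push_cast; ring
    simp only [this]
    rw [integral_const_mul, per_zero hy]
    field_simp
  · rw [norm_mul, Complex.norm_real, Real.norm_eq_abs, abs_of_nonneg (mul_nonneg (mu_pos ρ).le (lr_nonneg ρ _))]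
  · simp only [tsum_mul_left, (zf _).tsum_eq]
    refine hAZ.norm.congr (Eventually.of_forall fun x => ?_)
    simp only [norm_mul, Complex.norm_real]
    rw [Real.norm_eq_abs, abs_of_nonneg]
    exact (zf _).nonneg fun ρ => mul_nonneg (mu_pos ρ).le (lr_nonneg ρ _)

noncomputable def symE : NZ ≃ NZ where
  toFun ρ := ⟨1 - starRingEnd ℂ ρ.1, nz_one_sub (nz_conj ρ.2)⟩
  invFun ρ := ⟨1 - starRingEnd ℂ ρ.1, nz_one_sub (nz_conj ρ.2)⟩
  left_inv ρ := by ext; simp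
  right_inv ρ := by ext; simp

lemma symE_re (ρ : NZ) : (symE ρ).1.re = 1 - ρ.1.re := by simp [symE]
lemma symE_im (ρ : NZ) : (symE ρ).1.im = ρ.1.im := by simp [symE]
lemma symE_mu (ρ : NZ) : mu (symE ρ) = mu ρ := by
  unfold mu
  simp only [symE, Equiv.coe_fn_mk]
  rw [zetaMult_one_sub (nz_conj ρ.2), zetaMult_conj]

noncomputable def Cr (ρ : NZ) (y t : ℝ) : ℂ :=
  ∫ u, ((eta (u - y) * Real.cosh ((ρ.1.re - 1 / 2) * u) : ℝ) : ℂ) * ee (u * (t - ρ.1.im))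

lemma eta_mul_int {g : ℝ → ℝ} (hg : Continuous g) (y x : ℝ) :
    Integrable (fun u => ((eta (u - y) * g u : ℝ) : ℂ) * ee (u * x)) := by
  have := eta_cont
  have hc : Continuous (fun u => eta (u - y) * g u) := by fun_prop
  refine ee_int (Integrable.ofReal (hc.integrable_of_hasCompactSupport ?_)) x
  exact (eta_csupp.comp_homeomorph (Homeomorph.subRight y)).mul_right

lemma explicit {y t : ℝ} (hy : 0 ≤ y) (ht : 2 ≤ t) :
    HasSum (fun ρ : NZ => (mu ρ : ℂ) * Cr ρ y t) (Eg y t - ∑' n, Pn y t n) := by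
  have h1 := explicit0 hy ht
  have h2 := (symE.hasSum_iff (f := fun ρ : NZ => (mu ρ : ℂ) * Zr ρ y t)).mpr h1
  have h3 := (h1.add h2).mul_left (1 / 2)
  have key : ∀ ρ : NZ, Cr ρ y t = 1 / 2 * (Zr ρ y t + Zr (symE ρ) y t) := by
    intro ρ
    unfold Zr Cr
    rw [symE_re, symE_im, ← integral_add (eta_mul_int (by fun_prop) y _) (eta_mul_int (by fun_prop) y _), ← integral_const_mul]
    refine integral_congr_ae (Eventually.of_forall fun u => ?_)
    simp only
    rw [← add_mul, ← mul_assoc]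
    congr 1
    have : Real.cosh ((ρ.1.re - 1 / 2) * u) = Real.cosh ((ρ.1.re - 1 / 2) * |u|) := by
      rcases abs_choice u with h | h <;> rw [h]
      rw [mul_neg, Real.cosh_neg]
    rw [this, Real.cosh_eq, show 1 - ρ.1.re - 1 / 2 = -(ρ.1.re - 1 / 2) by ring, neg_mul]
    push_cast
    ring
  convert! h3 using 1
  · ext ρ
    simp only [Function.comp_apply, symE_mu, key]
    ring
  · ring

lemma fy_zero (y : ℝ) : fy y 0 = eta y / 2 := by
  rw [fy, abs_zero, Q_zero, zero_sub, eta_even]; ring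

lemma fy_total {y : ℝ} (hy : 0 ≤ y) : ∫ x, ft (fun u => (fy y u : ℂ)) (-x) = Real.pi * eta y := by
  have h := ft_inv (Complex.continuous_ofReal.comp (fy_cont y)) (fy_int hy) (fy_ft_int hy) 0
  simp only [zero_mul, ee_zero, mul_one, Function.comp_apply, fy_zero] at h
  erw [h]
  push_cast; ring

lemma Eg_small : ∃ C, 0 < C ∧ ∀ y ∈ Icc (0 : ℝ) 2, ∀ t, 2 ≤ t → ‖Eg y t - ((Real.log t * eta y : ℝ) : ℂ)‖ ≤ C := by
  obtain ⟨C, hC, hb⟩ := fy_bound 2 (by norm_num)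
  refine ⟨|(2 * Real.pi)⁻¹ * (C * (13 * Real.pi + 3 * JJ))| + 1, by positivity, fun y hy t ht => ?_⟩
  have hA := AG_cont
  have h := (W_int (A := 13) (B := 3) (g := fun x => AG (t + x) - 2 * Real.log t) (ft_cont (fy_int hy.1)) (hb y hy)
    (by fun_prop) fun x => AG_dev ht).2
  have hpi : (2 * Real.pi : ℂ) ≠ 0 := by exact_mod_cast (by positivity : 2 * Real.pi ≠ 0)
  have e : Eg y t - ((Real.log t * eta y : ℝ) : ℂ) =
      (2 * Real.pi : ℂ)⁻¹ * ∫ x, ft (fun u => (fy y u : ℂ)) (-x) * ((AG (t + x) - 2 * Real.log t : ℝ) : ℂ) := by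
    have : ∀ x, ft (fun u => (fy y u : ℂ)) (-x) * ((AG (t + x) - 2 * Real.log t : ℝ) : ℂ) =
        ft (fun u => (fy y u : ℂ)) (-x) * (AG (t + x) : ℂ) - ft (fun u => (fy y u : ℂ)) (-x) * ((2 * Real.log t : ℝ) : ℂ) := by
      intro x; push_cast; ring
    simp only [this]
    rw [integral_sub (AG_int hy.1 ht) ((fy_ft_int hy.1).comp_neg.mul_const _), integral_mul_const, fy_total hy.1, Eg, mul_sub]
    congr 1
    rw [eq_inv_mul_iff_mul_eq₀ hpi]
    push_cast; ring
  rw [e, norm_mul]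
  have h3 : ‖(2 * Real.pi : ℂ)⁻¹‖ = (2 * Real.pi)⁻¹ := by
    rw [norm_inv, norm_mul, Complex.norm_real, Real.norm_eq_abs, abs_of_pos Real.pi_pos]; simp
  rw [h3]
  calc _ ≤ (2 * Real.pi)⁻¹ * (C * (13 * Real.pi + 3 * JJ)) := mul_le_mul_of_nonneg_left h (by positivity)
    _ ≤ _ := by linarith [le_abs_self ((2 * Real.pi)⁻¹ * (C * (13 * Real.pi + 3 * JJ)))]

lemma ibp1 {h h1 : ℝ → ℝ} {a b B x : ℝ} (hab : a ≤ b) (hx : 0 < x) (hd : ∀ u ∈ Icc a b, HasDerivAt h (h1 u) u)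
    (hc : ContinuousOn h1 (Icc a b)) (ha : h a = 0) (hb : h b = 0) (hB : ∀ u ∈ Icc a b, |h1 u| ≤ B) :
    ‖∫ u in a..b, (h u : ℂ) * ee (u * x)‖ ≤ B * (b - a) / x := by
  have hee := ee_cont
  have hI : (Complex.I * x : ℂ) ≠ 0 := mul_ne_zero Complex.I_ne_zero (by exact_mod_cast hx.ne')
  have hcont : ContinuousOn h (Icc a b) := fun u hu => (hd u hu).continuousAt.continuousWithinAt
  have hd2 : ∀ u ∈ uIcc a b, HasDerivAt (fun u => (h u : ℂ) * ee (u * x))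
      ((h1 u : ℂ) * ee (u * x) + Complex.I * x * ((h u : ℂ) * ee (u * x))) u := by
    intro u hu
    rw [uIcc_of_le hab] at hu
    convert! ((hd u hu).ofReal_comp).mul (ee_deriv x u) using 1
    ring
  have i1 : IntervalIntegrable (fun u => (h1 u : ℂ) * ee (u * x)) volume a b := by
    refine ContinuousOn.intervalIntegrable ?_
    rw [uIcc_of_le hab]
    exact (Complex.continuous_ofReal.comp_continuousOn hc).mul (by fun_prop)
  have i2 : IntervalIntegrable (fun u => (h u : ℂ) * ee (u * x)) volume a b := by
    refine ContinuousOn.intervalIntegrable ?_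
    rw [uIcc_of_le hab]
    exact (Complex.continuous_ofReal.comp_continuousOn hcont).mul (by fun_prop)
  have hF := intervalIntegral.integral_eq_sub_of_hasDerivAt hd2 (i1.add (i2.const_mul _))
  rw [intervalIntegral.integral_add i1 (i2.const_mul _), intervalIntegral.integral_const_mul, ha, hb] at hF
  simp only [Complex.ofReal_zero, zero_mul, sub_zero] at hF
  have hF2 : Complex.I * x * ∫ u in a..b, (h u : ℂ) * ee (u * x) = -∫ u in a..b, (h1 u : ℂ) * ee (u * x) := by
    linear_combination hF
  have hn := congrArg norm hF2
  rw [norm_mul, norm_mul, Complex.norm_I, one_mul, Complex.norm_real, Real.norm_eq_abs, abs_of_pos hx, norm_neg] at hn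
  rw [le_div_iff₀ hx, mul_comm, hn]
  exact int_bound hab hB

noncomputable def Rb (b u : ℝ) : ℝ :=
  (Real.exp (1 / 2 * u) - Real.exp (-(5 / 2) * u) - Real.exp (-(3 / 2) * u) + Real.exp (-(b - 3 / 2) * u)) * (1 - Real.exp (-2 * u))⁻¹
noncomputable def Rb1 (b u : ℝ) : ℝ :=
  (1 / 2 * Real.exp (1 / 2 * u) + 5 / 2 * Real.exp (-(5 / 2) * u) + 3 / 2 * Real.exp (-(3 / 2) * u) -
    (b - 3 / 2) * Real.exp (-(b - 3 / 2) * u)) * (1 - Real.exp (-2 * u))⁻¹ -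
  (Real.exp (1 / 2 * u) - Real.exp (-(5 / 2) * u) - Real.exp (-(3 / 2) * u) + Real.exp (-(b - 3 / 2) * u)) *
    (2 * Real.exp (-2 * u) * ((1 - Real.exp (-2 * u))⁻¹) ^ 2)

lemma exp_m2 {u : ℝ} (hu : 1 ≤ u) : Real.exp (-2 * u) ≤ 1 / 2 := by
  have h1 : Real.exp (-2 * u) ≤ Real.exp (-1) := Real.exp_le_exp.mpr (by linarith)
  have h2 : Real.exp (-1) ≤ 1 / 2 := by
    rw [Real.exp_neg, inv_le_comm₀ (Real.exp_pos _) (by norm_num)]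
    linarith [Real.exp_one_gt_d9]
  linarith

lemma Rb_deriv {b u : ℝ} (hu : 1 ≤ u) : HasDerivAt (Rb b) (Rb1 b u) u := by
  have he : ∀ c : ℝ, HasDerivAt (fun u => Real.exp (c * u)) (c * Real.exp (c * u)) u := fun c => by
    have := ((hasDerivAt_id u).const_mul c).exp
    convert! this using 1
    simp [mul_comm]
  have hne : 1 - Real.exp (-2 * u) ≠ 0 := by have := exp_m2 hu; intro h; linarith
  have h2 : HasDerivAt (fun u => (1 - Real.exp (-2 * u))⁻¹) (-(-(-2 * Real.exp (-2 * u))) / (1 - Real.exp (-2 * u)) ^ 2) u :=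
    ((he (-2)).const_sub 1).inv hne
  have h1 := ((((he (1/2)).sub (he (-(5/2)))).sub (he (-(3/2)))).add (he (-(b - 3/2)))).mul h2
  convert! h1 using 1
  simp only [Rb1, Pi.add_apply, Pi.sub_apply]
  field_simp
  ring

lemma Rb_bound {b u : ℝ} (hb : 4 ≤ b) (hu : 1 ≤ u) :
    |Rb b u| ≤ 8 * Real.exp (1 / 2 * u) ∧ |Rb1 b u| ≤ 44 * Real.exp (1 / 2 * u) := by
  have hm := exp_m2 hu
  have hp := Real.exp_pos (-2 * u)
  set D := (1 - Real.exp (-2 * u))⁻¹ with hD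
  have hD2 : D ≤ 2 := by rw [hD, inv_le_comm₀ (by linarith) (by norm_num)]; linarith
  have hD0 : 0 < D := by rw [hD, inv_pos]; linarith
  have hle : ∀ c : ℝ, c ≤ 0 → 0 < Real.exp (c * u) ∧ Real.exp (c * u) ≤ 1 := fun c hc =>
    ⟨Real.exp_pos _, Real.exp_le_one_iff.mpr (by nlinarith)⟩
  obtain ⟨a1, a2⟩ := hle (-(5/2)) (by norm_num)
  obtain ⟨b1, b2⟩ := hle (-(3/2)) (by norm_num)
  obtain ⟨c1, c2⟩ := hle (-(b - 3/2)) (by linarith)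
  have hg : 1 ≤ Real.exp (1 / 2 * u) := Real.one_le_exp (by linarith)
  have hx : (b - 3 / 2) * Real.exp (-(b - 3 / 2) * u) ≤ 1 := by
    have h1 : Real.exp (-(b - 3 / 2) * u) ≤ Real.exp (-(b - 3 / 2)) := Real.exp_le_exp.mpr (by nlinarith)
    have h2 := Real.add_one_le_exp (b - 3 / 2)
    have h3 : Real.exp (b - 3 / 2) * Real.exp (-(b - 3 / 2)) = 1 := by rw [← Real.exp_add]; simp
    nlinarith [Real.exp_pos (-(b - 3 / 2))]
  have hx0 : 0 ≤ (b - 3 / 2) * Real.exp (-(b - 3 / 2) * u) := mul_nonneg (by linarith) c1.le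
  have n1 : |Real.exp (1 / 2 * u) - Real.exp (-(5 / 2) * u) - Real.exp (-(3 / 2) * u) + Real.exp (-(b - 3 / 2) * u)| ≤ 4 * Real.exp (1 / 2 * u) := by
    rw [abs_le]; constructor <;> linarith
  have n2 : |1 / 2 * Real.exp (1 / 2 * u) + 5 / 2 * Real.exp (-(5 / 2) * u) + 3 / 2 * Real.exp (-(3 / 2) * u) -
    (b - 3 / 2) * Real.exp (-(b - 3 / 2) * u)| ≤ 6 * Real.exp (1 / 2 * u) := by
    rw [abs_le]; constructor <;> linarith
  constructor
  · rw [Rb, ← hD, abs_mul, abs_of_pos hD0]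
    calc _ ≤ 4 * Real.exp (1 / 2 * u) * 2 := by gcongr
      _ = _ := by ring
  · rw [Rb1, ← hD]
    refine (abs_sub _ _).trans ?_
    rw [abs_mul, abs_mul, abs_of_pos hD0, abs_of_nonneg (by positivity : 0 ≤ 2 * Real.exp (-2 * u) * D ^ 2)]
    calc _ ≤ 6 * Real.exp (1 / 2 * u) * 2 + 4 * Real.exp (1 / 2 * u) * (2 * (1/2) * 2 ^ 2) := by gcongr
      _ ≤ _ := by linarith

lemma Gb_bound : ∃ C, 0 < C ∧ ∀ b, 4 ≤ b → ∀ y, 2 ≤ y → ∀ t, 0 < t →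
    ‖∫ u, ((kap 1 4 u - kap 3 b u : ℝ) : ℂ) * ee (u * t) * (fy y u : ℂ)‖ ≤ C * Real.exp (1 / 2 * y) / t := by
  obtain ⟨a, ha, he⟩ := eta_bdd
  have hec := eta_cont
  have he1 := eta1_cont
  refine ⟨(8 * a + 44 * a) * 2 * 2, by positivity, fun b hb y hy t ht => ?_⟩
  have e1 : ∀ u, ((kap 1 4 u - kap 3 b u : ℝ) : ℂ) * ee (u * t) * (fy y u : ℂ) = ((eta (u - y) * Rb b u : ℝ) : ℂ) * ee (u * t) := by
    intro u
    by_cases hu : |u - y| < 1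
    · have hu1 : 1 < u := by rw [abs_lt] at hu; linarith [hu.1]
      have hne : 1 - Real.exp (-2 * u) ≠ 0 := by have := exp_m2 hu1.le; intro h; linarith
      have h0 : u ≠ 0 := by linarith
      have : (kap 1 4 u - kap 3 b u) * fy y u = eta (u - y) * Rb b u := by
        rw [fy, Q, kap, kap, Rb, abs_of_pos (by linarith : 0 < u), pp_ne h0]
        have x1 : Real.exp (1 / 2 * u) = Real.exp (3 / 2 * u) * Real.exp (-1 * u) := by rw [← Real.exp_add]; ring_nf
        have x2 : Real.exp (-(5 / 2) * u) = Real.exp (3 / 2 * u) * Real.exp (-4 * u) := by rw [← Real.exp_add]; ring_nf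
        have x3 : Real.exp (-(3 / 2) * u) = Real.exp (3 / 2 * u) * Real.exp (-3 * u) := by rw [← Real.exp_add]; ring_nf
        have x4 : Real.exp (-(b - 3 / 2) * u) = Real.exp (3 / 2 * u) * Real.exp (-b * u) := by rw [← Real.exp_add]; ring_nf
        rw [x1, x2, x3, x4]
        field_simp
        ring
      rw [← this]; push_cast; ring
    · rw [fy, eta_supp (not_lt.mp hu)]; simp
  simp only [e1]
  have hsup : ∀ u, u ∉ Ioc (y - 1) (y + 1) → eta (u - y) * Rb b u = 0 := by
    intro u hu
    rw [eta_supp, zero_mul]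
    by_contra h
    rw [not_le, abs_lt] at h
    exact hu ⟨by linarith [h.1], by linarith [h.2]⟩
  have hft := ft_interval (a := y - 1) (b := y + 1) (by linarith) hsup t
  unfold ft at hft
  rw [hft]
  have := ibp1 (h := fun u => eta (u - y) * Rb b u) (h1 := fun u => eta1 (u - y) * Rb b u + eta (u - y) * Rb1 b u)
    (a := y - 1) (b := y + 1) (x := t) (B := (8 * a + 44 * a) * (2 * Real.exp (1 / 2 * y))) (by linarith) ht ?_ ?_ ?_ ?_ ?_
  · refine this.trans (le_of_eq ?_); ring
  · intro u hu
    have h1 : HasDerivAt (fun u => eta (u - y)) (eta1 (u - y)) u := by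
      have := (eta_deriv (u - y)).comp u ((hasDerivAt_id u).sub_const y)
      convert! this using 1; simp
    exact h1.mul (Rb_deriv (by linarith [hu.1]))
  · have hne : ∀ u ∈ Icc (y - 1) (y + 1), 1 - Real.exp (-2 * u) ≠ 0 := fun u hu => by
      have := exp_m2 (u := u) (by linarith [hu.1]); intro h; linarith
    unfold Rb Rb1
    fun_prop (disch := assumption)
  · rw [eta_supp, zero_mul]; simp
  · rw [eta_supp, zero_mul]; simp
  · intro u hu
    obtain ⟨r1, r2⟩ := Rb_bound hb (u := u) (by linarith [hu.1])
    obtain ⟨v1, v2, _⟩ := he (u - y)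
    have hx : Real.exp (1 / 2 * u) ≤ 2 * Real.exp (1 / 2 * y) := by
      have h1 : Real.exp (1 / 2 * u) ≤ Real.exp (1 / 2) * Real.exp (1 / 2 * y) := by
        rw [← Real.exp_add]; exact Real.exp_le_exp.mpr (by linarith [hu.2])
      have h2 : Real.exp (1 / 2) ≤ 2 := by
        have h3 : Real.exp (1 / 2) ^ 2 = Real.exp 1 := by rw [← Real.exp_nat_mul]; norm_num
        nlinarith [Real.exp_one_lt_d9, Real.exp_pos (1 / 2)]
      nlinarith [Real.exp_pos (1 / 2 * y)]
    calc |eta1 (u - y) * Rb b u + eta (u - y) * Rb1 b u| ≤ |eta1 (u - y)| * |Rb b u| + |eta (u - y)| * |Rb1 b u| := by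
          rw [← abs_mul, ← abs_mul]; exact abs_add_le _ _
      _ ≤ a * (8 * Real.exp (1 / 2 * u)) + a * (44 * Real.exp (1 / 2 * u)) := by gcongr
      _ = (8 * a + 44 * a) * Real.exp (1 / 2 * u) := by ring
      _ ≤ _ := by gcongr

lemma Eg_split {y t b : ℝ} (hy : 2 ≤ y) (ht : 2 ≤ t) (hb : 4 ≤ b) :
    Eg y t = (∫ u, ((kap 1 4 u - kap 3 b u : ℝ) : ℂ) * ee (u * t) * (fy y u : ℂ)) +
      (2 * Real.pi : ℂ)⁻¹ * ∫ x, ft (fun u => (fy y u : ℂ)) (-x) * ((Real.log (b ^ 2 + (t + x) ^ 2) - 2 * Real.log b : ℝ) : ℂ) := by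
  have hy0 : 0 ≤ y := by linarith
  have hpi : (2 * Real.pi : ℂ) ≠ 0 := by exact_mod_cast (by positivity : 2 * Real.pi ≠ 0)
  have hk : Integrable (fun u => ((kap 1 4 u - kap 3 b u : ℝ) : ℂ)) :=
    ((kap_int (by norm_num) (by norm_num)).sub (kap_int (by norm_num) (by linarith))).ofReal
  have hp := parseval (Complex.continuous_ofReal.comp (fy_cont y)) (fy_int hy0) (fy_ft_int hy0) (ee_int hk t)
  have h0 : ∫ x, ft (fun u => (fy y u : ℂ)) (-x) = 0 := by
    rw [fy_total hy0, eta_supp (by rw [abs_of_nonneg hy0]; linarith)]; simp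
  have e : ∀ x, ft (fun u => ((kap 1 4 u - kap 3 b u : ℝ) : ℂ) * ee (u * t)) x =
      ((AG (t + x) + 2 * Real.log (2 * Real.pi) - Real.log (b ^ 2 + (t + x) ^ 2) : ℝ) : ℂ) := by
    intro x
    rw [ft_mod]
    simp only [Complex.ofReal_sub (kap 1 4 _)]
    rw [ft_sub (fun u => (kap 1 4 u : ℂ)) (fun u => (kap 3 b u : ℂ)) (kap_int (a := 1) (b := 4) (by norm_num) (by norm_num)).ofReal
        (kap_int (a := 3) (b := b) (by norm_num) (by linarith)).ofReal,
      frullani (by norm_num) (by norm_num), frullani (by norm_num) (by linarith), AG]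
    push_cast; ring
  have e2 : ∫ x, ft (fun u => (fy y u : ℂ)) (-x) * ft (fun u => ((kap 1 4 u - kap 3 b u : ℝ) : ℂ) * ee (u * t)) x
      = 2 * Real.pi * ∫ u, ((kap 1 4 u - kap 3 b u : ℝ) : ℂ) * ee (u * t) * (fy y u : ℂ) := hp
  rw [Eg, ← sub_eq_iff_eq_add, ← mul_sub, inv_mul_eq_iff_eq_mul₀ hpi, ← e2]
  simp only [e]
  have hi1 := AG_int hy0 ht
  have hF := (fy_ft_int hy0).comp_neg
  have hi2 : Integrable (fun x => ft (fun u => (fy y u : ℂ)) (-x) *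
      ((AG (t + x) + 2 * Real.log (2 * Real.pi) - Real.log (b ^ 2 + (t + x) ^ 2) : ℝ) : ℂ)) := by
    simp only [← e]
    refine hF.mul_bdd (c := ∫ u, ‖((kap 1 4 u - kap 3 b u : ℝ) : ℂ) * ee (u * t)‖) ?_ (Eventually.of_forall fun x => ft_norm_le _ _)
    exact (ft_cont (ee_int hk t)).aestronglyMeasurable
  have e3 : ∀ x, ft (fun u => (fy y u : ℂ)) (-x) * ((Real.log (b ^ 2 + (t + x) ^ 2) - 2 * Real.log b : ℝ) : ℂ) =
      ft (fun u => (fy y u : ℂ)) (-x) * (AG (t + x) : ℂ) - ft (fun u => (fy y u : ℂ)) (-x) *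
      ((AG (t + x) + 2 * Real.log (2 * Real.pi) - Real.log (b ^ 2 + (t + x) ^ 2) : ℝ) : ℂ) +
      ft (fun u => (fy y u : ℂ)) (-x) * ((2 * Real.log (2 * Real.pi) - 2 * Real.log b : ℝ) : ℂ) := by
    intro x; push_cast; ring
  simp only [e3]
  have hi12 : Integrable (fun x => ft (fun u => (fy y u : ℂ)) (-x) * (AG (t + x) : ℂ) - ft (fun u => (fy y u : ℂ)) (-x) *
      ((AG (t + x) + 2 * Real.log (2 * Real.pi) - Real.log (b ^ 2 + (t + x) ^ 2) : ℝ) : ℂ)) := hi1.sub hi2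
  rw [integral_add hi12 (hF.mul_const _), integral_sub hi1 hi2, integral_mul_const, h0]
  ring

lemma Eg_rem {y t : ℝ} (hy : 0 ≤ y) (ht : 2 ≤ t) : Tendsto (fun b : ℝ =>
    ∫ x, ft (fun u => (fy y u : ℂ)) (-x) * ((Real.log (b ^ 2 + (t + x) ^ 2) - 2 * Real.log b : ℝ) : ℂ)) atTop (𝓝 0) := by
  obtain ⟨C, hC, hb⟩ := fy_bound y hy
  have hFc := ft_cont (fy_int hy)
  have hl : ∀ b : ℝ, 0 < b → Continuous fun x : ℝ => Real.log (b ^ 2 + (t + x) ^ 2) := fun b hb =>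
    Continuous.log (by fun_prop) fun x => by positivity
  have hlim : (∫ x, ft (fun u => (fy y u : ℂ)) (-x) * (0 : ℂ)) = 0 := by simp
  rw [← hlim]
  refine tendsto_integral_filter_of_dominated_convergence
    (fun x => ‖ft (fun u => (fy y u : ℂ)) (-x) * (Real.log (1 ^ 2 + (t + x) ^ 2) : ℂ)‖) ?_ ?_ ?_ ?_
  · filter_upwards [eventually_ge_atTop 4] with b hb
    have := hl b (by linarith)
    exact Continuous.aestronglyMeasurable (by fun_prop)
  · filter_upwards [eventually_ge_atTop 4] with b hb
    refine Eventually.of_forall fun x => ?_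
    rw [norm_mul, norm_mul, Complex.norm_real, Complex.norm_real]
    refine mul_le_mul_of_nonneg_left ?_ (norm_nonneg _)
    have e : 2 * Real.log b = Real.log (b ^ 2) := by rw [Real.log_pow]; norm_num
    have hb2 : 1 ≤ b ^ 2 := by nlinarith
    have h1 : Real.log (b ^ 2) ≤ Real.log (b ^ 2 + (t + x) ^ 2) := Real.log_le_log (by positivity) (by nlinarith)
    have h2 : Real.log (b ^ 2 + (t + x) ^ 2) ≤ Real.log (b ^ 2) + Real.log (1 ^ 2 + (t + x) ^ 2) := by
      rw [← Real.log_mul (by positivity) (by positivity)]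
      exact Real.log_le_log (by positivity) (by nlinarith [sq_nonneg (t + x)])
    rw [Real.norm_eq_abs, Real.norm_eq_abs, e, abs_of_nonneg (by linarith), abs_of_nonneg (by linarith)]
    linarith
  · have := hl 1 one_pos
    refine (W_int (A := 3 + 2 * Real.log t) (B := 1) (g := fun x => Real.log (1 ^ 2 + (t + x) ^ 2)) hFc (hb y ⟨hy, le_rfl⟩)
      this fun x => ?_).1.norm
    have h1 := abs_le.mp (log_dev (c := 1) (t := t) (x := x) le_rfl (by norm_num) ht)
    have h2 : 0 ≤ Real.log t := Real.log_nonneg (by linarith)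
    rw [abs_le]; constructor <;> linarith [h1.1, h1.2]
  · refine Eventually.of_forall fun x => Tendsto.const_mul _ ?_
    have h1 : Tendsto (fun b : ℝ => Real.log (1 + (t + x) ^ 2 / b ^ 2)) atTop (𝓝 0) := by
      have h2 : Tendsto (fun b : ℝ => 1 + (t + x) ^ 2 / b ^ 2) atTop (𝓝 (1 + 0)) :=
        tendsto_const_nhds.add (tendsto_const_nhds.div_atTop (tendsto_pow_atTop two_ne_zero))
      rw [add_zero] at h2
      simpa using h2.log one_ne_zero
    have h3 : Tendsto (fun b : ℝ => ((Real.log (1 + (t + x) ^ 2 / b ^ 2) : ℝ) : ℂ)) atTop (𝓝 ((0 : ℝ) : ℂ)) :=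
      (Complex.continuous_ofReal.tendsto _).comp h1
    rw [Complex.ofReal_zero] at h3
    refine h3.congr' ?_
    filter_upwards [eventually_ge_atTop 4] with b hb
    congr 1
    have e : 2 * Real.log b = Real.log (b ^ 2) := by rw [Real.log_pow]; norm_num
    rw [e, ← Real.log_div (by positivity) (by positivity)]
    congr 1; field_simp

lemma Eg_large : ∃ C, 0 < C ∧ ∀ y, 2 ≤ y → ∀ t, 2 ≤ t → ‖Eg y t‖ ≤ C * Real.exp (1 / 2 * y) / t := by
  obtain ⟨C, hC, h⟩ := Gb_bound
  refine ⟨C, hC, fun y hy t ht => ?_⟩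
  have h1 := ((Eg_rem (y := y) (by linarith) ht).const_mul (2 * Real.pi : ℂ)⁻¹).norm.const_add (C * Real.exp (1 / 2 * y) / t)
  rw [mul_zero, norm_zero, add_zero] at h1
  refine ge_of_tendsto h1 ?_
  filter_upwards [eventually_ge_atTop 4] with b hb
  rw [Eg_split hy ht hb]
  exact (norm_add_le _ _).trans (add_le_add_left (h b hb y hy t (by linarith)) _)

open ArithmeticFunction in
lemma Pn_small : ∃ C, 0 < C ∧ ∀ y ∈ Icc (0 : ℝ) 2, ∀ t, ‖∑' n, Pn y t n‖ ≤ C := by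
  obtain ⟨a, ha, he⟩ := eta_bdd
  refine ⟨∑ n ∈ Finset.range 21, Λ n * (2 * a) + 1, ?_, fun y hy t => ?_⟩
  · have : 0 ≤ ∑ n ∈ Finset.range 21, Λ n * (2 * a) := Finset.sum_nonneg fun n _ => mul_nonneg vonMangoldt_nonneg (by linarith)
    linarith
  have hz : ∀ n ∉ Finset.range 21, Pn y t n = 0 := by
    intro n hn
    rw [Finset.mem_range, not_lt] at hn
    have h3 : 3 ≤ Real.log n := by
      rw [Real.le_log_iff_exp_le (by exact_mod_cast (by omega : 0 < n))]
      have : Real.exp 3 = Real.exp 1 ^ 3 := by rw [← Real.exp_nat_mul]; norm_num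
      rw [this]
      have h1 : Real.exp 1 < 2.7182818286 := Real.exp_one_lt_d9
      calc Real.exp 1 ^ 3 ≤ 2.7182818286 ^ 3 := by gcongr
        _ ≤ 21 := by norm_num
        _ ≤ n := by exact_mod_cast hn
    rw [Pn, eta_supp, eta_supp]
    · simp
    · rw [abs_of_nonpos (by linarith [hy.1])]; linarith [hy.1]
    · rw [abs_of_nonneg (by linarith [hy.2])]; linarith [hy.2]
  rw [tsum_eq_sum hz]
  refine (norm_sum_le _ _).trans ?_
  refine (Finset.sum_le_sum fun n _ => ?_).trans (le_add_of_nonneg_right zero_le_one)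
  rw [Pn, norm_mul, Complex.norm_real, Real.norm_eq_abs, abs_mul, abs_of_nonneg (vonMangoldt_nonneg (n := n)), Real.abs_exp]
  have h1 : Real.exp (-(1 / 2) * |Real.log n|) ≤ 1 := Real.exp_le_one_iff.mpr (by nlinarith [abs_nonneg (Real.log n)])
  have h2 : ‖(eta (Real.log n - y) * ee (t * Real.log n) + eta (-Real.log n - y) * ee (-(t * Real.log n)) : ℂ)‖ ≤ 2 * a := by
    refine (norm_add_le _ _).trans ?_
    rw [norm_mul, norm_mul, ee_norm, ee_norm, Complex.norm_real, Complex.norm_real, Real.norm_eq_abs, Real.norm_eq_abs]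
    linarith [(he (Real.log n - y)).1, (he (-Real.log n - y)).1]
  have h0 : 0 ≤ Λ n := vonMangoldt_nonneg
  calc Λ n * Real.exp (-(1 / 2) * |Real.log n|) * _ ≤ Λ n * 1 * (2 * a) := by gcongr
    _ = _ := by ring

open ArithmeticFunction in
noncomputable def an (y : ℝ) (n : ℕ) : ℝ := Λ n * Real.exp (-(1 / 2) * Real.log n) * eta (Real.log n - y)

lemma an_zero {y : ℝ} {N n : ℕ} (hN : Real.exp (y + 1) ≤ N) (hn : N ≤ n) : an y n = 0 := by
  have h1 : Real.exp (y + 1) ≤ n := hN.trans (by exact_mod_cast hn)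
  have h2 : y + 1 ≤ Real.log n := (Real.le_log_iff_exp_le ((Real.exp_pos _).trans_le h1)).mpr h1
  rw [an, eta_supp, mul_zero]
  rw [abs_of_nonneg (by linarith)]; linarith

lemma Pn_large {y : ℝ} (hy : 2 ≤ y) {N : ℕ} (hN : Real.exp (y + 1) ≤ N) (t : ℝ) :
    ∑' n, Pn y t n = ∑ n ∈ Finset.range N, (an y n : ℂ) * ee (t * Real.log n) := by
  have e : ∀ n, Pn y t n = (an y n : ℂ) * ee (t * Real.log n) := by
    intro n
    have h0 := Real.log_natCast_nonneg n
    rw [Pn, eta_supp (v := -Real.log n - y), an, abs_of_nonneg h0]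
    · push_cast; ring
    · rw [abs_of_nonpos (by linarith)]; linarith
  simp only [e]
  refine tsum_eq_sum fun n hn => ?_
  rw [Finset.mem_range, not_lt] at hn
  rw [an_zero hN hn]; simp

noncomputable def Sy (y t : ℝ) : ℂ := ∑' ρ : NZ, (mu ρ : ℂ) * Cr ρ y t

lemma Sy_small : ∃ C, 0 < C ∧ ∀ y ∈ Icc (0 : ℝ) 2, ∀ t, 2 ≤ t → ‖Sy y t - ((Real.log t * eta y : ℝ) : ℂ)‖ ≤ C := by
  obtain ⟨C1, h1, hE⟩ := Eg_small
  obtain ⟨C2, h2, hP⟩ := Pn_small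
  refine ⟨C1 + C2, by positivity, fun y hy t ht => ?_⟩
  rw [Sy, (explicit hy.1 ht).tsum_eq, sub_right_comm]
  exact (norm_sub_le _ _).trans (add_le_add (hE y hy t ht) (hP y hy t))

lemma Sy_large : ∃ C, 0 < C ∧ ∀ y, 2 ≤ y → ∀ t, 2 ≤ t → ∀ N : ℕ, Real.exp (y + 1) ≤ N →
    ‖Sy y t + ∑ n ∈ Finset.range N, (an y n : ℂ) * ee (t * Real.log n)‖ ≤ C * Real.exp (1 / 2 * y) / t := by
  obtain ⟨C, hC, h⟩ := Eg_large
  refine ⟨C, hC, fun y hy t ht N hN => ?_⟩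
  rw [Sy, (explicit (by linarith) ht).tsum_eq, Pn_large hy hN, sub_add_cancel]
  exact h y hy t ht

lemma mert_nat {N : ℕ} (hN : 1 ≤ N) :
    Real.log N - 1 ≤ ∑ n ∈ Finset.Ioc 0 N, ArithmeticFunction.vonMangoldt n / n ∧
    ∑ n ∈ Finset.Ioc 0 N, ArithmeticFunction.vonMangoldt n / n ≤ Real.log N + 6 := by
  have hN0 : (0 : ℝ) < N := by exact_mod_cast hN
  have h1 := ArithmeticFunction.sum_Ioc_mul_zeta_eq_sum ArithmeticFunction.vonMangoldt N
  rw [ArithmeticFunction.vonMangoldt_mul_zeta] at h1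
  have h2 : Real.log (N.factorial) = ∑ n ∈ Finset.Ioc 0 N, ArithmeticFunction.log n := by
    clear h1 hN0 hN
    induction N with
    | zero => simp
    | succ k ih =>
      rw [Finset.sum_Ioc_succ_top (by omega), ← ih, Nat.factorial_succ, ArithmeticFunction.log_apply]
      push_cast
      rw [Real.log_mul (by positivity) (by positivity)]; ring
  rw [← h2] at h1
  have h3 : Real.log (N.factorial) ≤ N * Real.log N := by
    rw [← Real.log_pow]
    exact Real.log_le_log (by positivity) (by exact_mod_cast Nat.factorial_le_pow N)
  have h4 := Stirling.le_log_factorial_stirling (n := N) (by omega)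
  have h5 : 0 ≤ Real.log N := Real.log_natCast_nonneg N
  have h6 : 0 ≤ Real.log (2 * Real.pi) := Real.log_nonneg (by linarith [Real.pi_gt_three])
  have h7 := Chebyshev.psi_le_const_mul_self (x := N) hN0.le
  rw [Chebyshev.psi, Nat.floor_natCast] at h7
  have h8 : Real.log 4 ≤ 2 := by
    rw [show (4 : ℝ) = 2 ^ 2 by norm_num, Real.log_pow]; have := Real.log_two_lt_d9; norm_num; linarith
  have a1 : ∑ n ∈ Finset.Ioc 0 N, ArithmeticFunction.vonMangoldt n * ((N / n : ℕ) : ℝ) ≤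
      N * ∑ n ∈ Finset.Ioc 0 N, ArithmeticFunction.vonMangoldt n / n := by
    rw [Finset.mul_sum]
    refine Finset.sum_le_sum fun n _ => ?_
    have := mul_le_mul_of_nonneg_left (Nat.cast_div_le (α := ℝ) (m := N) (n := n)) (ArithmeticFunction.vonMangoldt_nonneg (n := n))
    refine this.trans_eq (by ring)
  have a2 : N * ∑ n ∈ Finset.Ioc 0 N, ArithmeticFunction.vonMangoldt n / n ≤
     ∑ n ∈ Finset.Ioc 0 N, ArithmeticFunction.vonMangoldt n * ((N / n : ℕ) : ℝ) + ∑ n ∈ Finset.Ioc 0 N, ArithmeticFunction.vonMangoldt n := by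
    rw [Finset.mul_sum, ← Finset.sum_add_distrib]
    refine Finset.sum_le_sum fun n hn => ?_
    have hn0 : (0 : ℝ) < n := by exact_mod_cast (Finset.mem_Ioc.mp hn).1
    have : (N : ℝ) / n ≤ (N / n : ℕ) + 1 := by
      rw [div_le_iff₀ hn0]
      have := Nat.lt_div_mul_add (a := N) (Finset.mem_Ioc.mp hn).1
      have h' : (N : ℝ) < (N / n : ℕ) * n + n := by exact_mod_cast this
      linarith
    have := mul_le_mul_of_nonneg_left this (ArithmeticFunction.vonMangoldt_nonneg (n := n))
    refine le_trans (le_of_eq (by ring)) (this.trans_eq (by ring))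
  constructor
  · refine le_of_mul_le_mul_left ?_ hN0
    nlinarith
  · refine le_of_mul_le_mul_left ?_ hN0
    nlinarith

lemma mert_real {s : ℝ} (hs : 0 ≤ s) :
    |∑ n ∈ Finset.Ioc 0 ⌊Real.exp s⌋₊, ArithmeticFunction.vonMangoldt n / n - s| ≤ 7 := by
  have h1 : 1 ≤ ⌊Real.exp s⌋₊ := Nat.le_floor (by simpa using Real.one_le_exp hs)
  have h0 : (1 : ℝ) ≤ (⌊Real.exp s⌋₊ : ℝ) := by exact_mod_cast h1
  obtain ⟨a, b⟩ := mert_nat h1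
  have c : Real.log ⌊Real.exp s⌋₊ ≤ s := by
    rw [Real.log_le_iff_le_exp (by linarith)]; exact Nat.floor_le (by positivity)
  have d : s ≤ Real.log ⌊Real.exp s⌋₊ + 1 := by
    have e1 : s ≤ Real.log (2 * ⌊Real.exp s⌋₊) := by
      rw [Real.le_log_iff_exp_le (by linarith)]
      linarith [Nat.lt_floor_add_one (Real.exp s)]
    rw [Real.log_mul (by norm_num) (by linarith)] at e1
    linarith [Real.log_two_lt_d9]
  rw [abs_le]; constructor <;> linarith

lemma part_sum {f f1 : ℝ → ℝ} {Z B : ℝ} (hZ : 0 ≤ Z) (hf : ∀ x, HasDerivAt f (f1 x) x) (hc : Continuous f1)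
    (hz : f Z = 0) (hB : ∀ s ∈ Icc 0 Z, |f1 s| ≤ B) :
    ∑ n ∈ Finset.Ioc 0 ⌊Real.exp Z⌋₊, ArithmeticFunction.vonMangoldt n / n * f (Real.log n) ≤
      (∫ s in (0)..Z, f s) + 7 * B * Z := by
  set c : ℕ → ℝ := fun n => ArithmeticFunction.vonMangoldt n / n with hcdef
  have hfc : Continuous f := continuous_iff_continuousAt.mpr fun x => (hf x).continuousAt
  have key : ∀ n ∈ Finset.Ioc 0 ⌊Real.exp Z⌋₊, c n * f (Real.log n) =
      - ∫ s in (0)..Z, c n * (Ici (Real.log n)).indicator f1 s := by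
    intro n hn
    have hn0 : (0 : ℝ) < n := by exact_mod_cast (Finset.mem_Ioc.mp hn).1
    have hl0 : 0 ≤ Real.log n := Real.log_natCast_nonneg n
    have hlZ : Real.log n ≤ Z := by
      rw [Real.log_le_iff_le_exp hn0]
      exact (Nat.le_floor_iff (by positivity)).mp (Finset.mem_Ioc.mp hn).2
    rw [intervalIntegral.integral_const_mul, intervalIntegral.integral_of_le hZ, ← integral_Icc_eq_integral_Ioc,
      setIntegral_indicator measurableSet_Ici]
    have : Icc 0 Z ∩ Ici (Real.log n) = Icc (Real.log n) Z := by
      ext x; simp only [mem_inter_iff, mem_Icc, mem_Ici]; constructor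
      · rintro ⟨⟨_, h⟩, h'⟩; exact ⟨h', h⟩
      · rintro ⟨h, h'⟩; exact ⟨⟨by linarith, h'⟩, h⟩
    rw [this, integral_Icc_eq_integral_Ioc, ← intervalIntegral.integral_of_le hlZ,
      intervalIntegral.integral_eq_sub_of_hasDerivAt (fun x _ => hf x) (hc.intervalIntegrable _ _), hz]
    ring
  have hii : ∀ n ∈ Finset.Ioc 0 ⌊Real.exp Z⌋₊, IntervalIntegrable (fun s => c n * (Ici (Real.log n)).indicator f1 s) volume 0 Z := by
    intro n _
    refine IntervalIntegrable.const_mul ?_ _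
    rw [intervalIntegrable_iff_integrableOn_Ioc_of_le hZ]
    exact (hc.integrableOn_Ioc).indicator measurableSet_Ici
  rw [Finset.sum_congr rfl key, Finset.sum_neg_distrib, ← intervalIntegral.integral_finsetSum hii]
  have hs : ∫ s in (0)..Z, f s = - ∫ s in (0)..Z, s * f1 s := by
    have := intervalIntegral.integral_mul_deriv_eq_deriv_mul (u := fun s => s) (v := f) (u' := fun _ => 1) (v' := f1) (a := 0) (b := Z)
      (fun x _ => hasDerivAt_id x) (fun x _ => hf x) (by simp) (hc.intervalIntegrable _ _)
    rw [this, hz]; simp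
  have hM : ∀ s ∈ Icc 0 Z, ∑ n ∈ Finset.Ioc 0 ⌊Real.exp Z⌋₊, c n * (Ici (Real.log n)).indicator f1 s =
      f1 s * ∑ n ∈ Finset.Ioc 0 ⌊Real.exp s⌋₊, c n := by
    intro s hs
    have hsub : Finset.Ioc 0 ⌊Real.exp s⌋₊ ⊆ Finset.Ioc 0 ⌊Real.exp Z⌋₊ :=
      Finset.Ioc_subset_Ioc_right (Nat.floor_mono (Real.exp_le_exp.mpr hs.2))
    rw [← Finset.sum_subset hsub, Finset.mul_sum]
    · refine Finset.sum_congr rfl fun n hn => ?_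
      have hn0 : (0 : ℝ) < n := by exact_mod_cast (Finset.mem_Ioc.mp hn).1
      rw [indicator_of_mem, mul_comm]
      rw [mem_Ici, Real.log_le_iff_le_exp hn0]
      exact (Nat.le_floor_iff (by positivity)).mp (Finset.mem_Ioc.mp hn).2
    · intro n hn hn'
      have hn1 := (Finset.mem_Ioc.mp hn).1
      have hn0 : (0 : ℝ) < n := by exact_mod_cast hn1
      rw [indicator_of_notMem, mul_zero]
      rw [mem_Ici, Real.log_le_iff_le_exp hn0]
      intro h
      exact hn' (Finset.mem_Ioc.mpr ⟨hn1, (Nat.le_floor_iff (by positivity)).mpr h⟩)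
  have hd : ‖∫ s in (0)..Z, (∑ n ∈ Finset.Ioc 0 ⌊Real.exp Z⌋₊, c n * (Ici (Real.log n)).indicator f1 s - s * f1 s)‖ ≤ 7 * B * |Z - 0| := by
    refine intervalIntegral.norm_integral_le_of_norm_le_const fun s hs => ?_
    rw [uIoc_of_le hZ] at hs
    have hs' : s ∈ Icc 0 Z := ⟨hs.1.le, hs.2⟩
    rw [hM s hs', mul_comm s, ← mul_sub, norm_mul, mul_comm]
    have h1 := mert_real hs'.1
    have h2 := hB s hs'
    exact mul_le_mul h1 h2 (abs_nonneg _) (by norm_num)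
  rw [intervalIntegral.integral_sub (by
    have := IntervalIntegrable.sum (Finset.Ioc 0 ⌊Real.exp Z⌋₊) hii
    convert! this using 1
    ext s; simp) ((by fun_prop : Continuous fun s => s * f1 s).intervalIntegrable _ _), sub_zero, abs_of_nonneg hZ, Real.norm_eq_abs] at hd
  have := (abs_le.mp hd).1
  rw [hs]; linarith

noncomputable def gg (e u : ℝ) : ℝ := (1 - u) + e * (1 - u) ^ 2

lemma gg_cont (e : ℝ) : Continuous (gg e) := by unfold gg; fun_prop

lemma gg_nonneg {e u : ℝ} (he : 0 ≤ e) (hu : u ≤ 1) : 0 ≤ gg e u := by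
  unfold gg; have : 0 ≤ 1 - u := by linarith
  positivity

lemma gg_anti {e u v : ℝ} (he : 0 ≤ e) (hv : v ≤ 1) (huv : u ≤ v) : gg e v ≤ gg e u := by
  unfold gg
  have h1 : 0 ≤ 1 - v := by linarith
  have : (1 - v) ^ 2 ≤ (1 - u) ^ 2 := by gcongr
  have := mul_le_mul_of_nonneg_left this he
  linarith

lemma an_sq (y : ℝ) (n : ℕ) : an y n ^ 2 = ArithmeticFunction.vonMangoldt n ^ 2 / n * eta (Real.log n - y) ^ 2 := by
  rcases Nat.eq_zero_or_pos n with rfl | hn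
  · simp [an]
  have hn0 : (0 : ℝ) < n := by exact_mod_cast hn
  rw [an, mul_pow, mul_pow, ← Real.exp_nat_mul]
  have : ((2 : ℕ) : ℝ) * (-(1 / 2) * Real.log n) = - Real.log n := by push_cast; ring
  rw [this, Real.exp_neg, Real.exp_log hn0]; ring

lemma prime_sum : ∃ C, 0 < C ∧ ∀ e ∈ Icc (0 : ℝ) 1, ∀ Y, 2 ≤ Y → ∀ N : ℕ,
    ∫ y in (2)..Y, gg e (y / Y) * ∑ n ∈ Finset.range N, an y n ^ 2 ≤
      E2 * (Y ^ 2 * (1 / 6 + e / 12) + C * Y) := by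
  refine ⟨1000, by norm_num, fun e he Y hY N => ?_⟩
  have hY0 : 0 < Y := by linarith
  have hec := eta_cont
  have hlc : ∀ n : ℕ, Continuous fun y => gg e (y / Y) * an y n ^ 2 := fun n => by
    simp only [an_sq, gg]; fun_prop
  have e2i : Integrable (fun u => eta u ^ 2) := by
    refine Continuous.integrable_of_hasCompactSupport (by fun_prop) ?_
    simp only [pow_two]
    exact eta_csupp.mul_right (f' := eta)
  have hterm : ∀ n : ℕ, ∫ y in (2)..Y, gg e (y / Y) * an y n ^ 2 ≤
      if n ∈ Finset.Ioc 0 ⌊Real.exp (Y + 1)⌋₊ then E2 * (ArithmeticFunction.vonMangoldt n / n * (Real.log n * gg e ((Real.log n - 1) / Y))) else 0 := by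
    intro n
    rcases Nat.eq_zero_or_pos n with rfl | hn
    · simp [an]
    have hn0 : (0 : ℝ) < n := by exact_mod_cast hn
    have hl0 : 0 ≤ Real.log n := Real.log_natCast_nonneg n
    split_ifs with h
    · have hl : Real.log n ≤ Y + 1 := by
        rw [Real.log_le_iff_le_exp hn0]
        exact (Nat.le_floor_iff (by positivity)).mp (Finset.mem_Ioc.mp h).2
      have hu1 : (Real.log n - 1) / Y ≤ 1 := by rw [div_le_one hY0]; linarith
      have hG := gg_nonneg he.1 hu1
      have b1 : ∫ y in (2)..Y, gg e (y / Y) * an y n ^ 2 ≤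
          ∫ y in (2)..Y, (ArithmeticFunction.vonMangoldt n ^ 2 / n * gg e ((Real.log n - 1) / Y)) * eta (Real.log n - y) ^ 2 := by
        refine intervalIntegral.integral_mono_on hY ((hlc n).intervalIntegrable _ _)
          ((by fun_prop : Continuous _).intervalIntegrable _ _) fun y hy => ?_
        rw [an_sq]
        by_cases hc : 1 ≤ |Real.log n - y|
        · rw [eta_supp hc]; simp
        · push Not at hc
          have := (abs_lt.mp hc).2
          have hle : (Real.log n - 1) / Y ≤ y / Y := by gcongr; linarith
          have := gg_anti he.1 (by rw [div_le_one hY0]; exact hy.2) hle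
          have h0 : 0 ≤ ArithmeticFunction.vonMangoldt n ^ 2 / n * eta (Real.log n - y) ^ 2 := by positivity
          nlinarith
      rw [intervalIntegral.integral_const_mul] at b1
      have b2 : ∫ y in (2)..Y, eta (Real.log n - y) ^ 2 ≤ E2 := by
        rw [intervalIntegral.integral_of_le hY, E2, ← integral_sub_left_eq_self (fun u => eta u ^ 2) volume (Real.log n)]
        exact setIntegral_le_integral (e2i.comp_sub_left (Real.log n)) (Eventually.of_forall fun _ => sq_nonneg _)
      have b3 : ArithmeticFunction.vonMangoldt n ^ 2 / n * gg e ((Real.log n - 1) / Y) ≤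
          ArithmeticFunction.vonMangoldt n / n * (Real.log n * gg e ((Real.log n - 1) / Y)) := by
        have h1 : ArithmeticFunction.vonMangoldt n ≤ Real.log n := ArithmeticFunction.vonMangoldt_le_log
        have h2 := ArithmeticFunction.vonMangoldt_nonneg (n := n)
        have : ArithmeticFunction.vonMangoldt n ^ 2 / n ≤ ArithmeticFunction.vonMangoldt n / n * Real.log n := by
          rw [div_mul_eq_mul_div]; gcongr; nlinarith
        calc _ ≤ ArithmeticFunction.vonMangoldt n / n * Real.log n * gg e ((Real.log n - 1) / Y) := by gcongr
          _ = _ := by ring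
      have h2 := ArithmeticFunction.vonMangoldt_nonneg (n := n)
      calc _ ≤ _ := b1
        _ ≤ (ArithmeticFunction.vonMangoldt n ^ 2 / n * gg e ((Real.log n - 1) / Y)) * E2 :=
          mul_le_mul_of_nonneg_left b2 (by positivity)
        _ ≤ _ := by rw [mul_comm]; exact mul_le_mul_of_nonneg_left b3 E2_pos.le
    · have hl : Y + 1 < Real.log n := by
        rw [Real.lt_log_iff_exp_lt hn0]
        by_contra hc
        exact h (Finset.mem_Ioc.mpr ⟨hn, (Nat.le_floor_iff (by positivity)).mpr (not_lt.mp hc)⟩)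
      rw [intervalIntegral.integral_congr (g := fun _ => (0 : ℝ))]
      · simp
      · intro y hy
        rw [uIcc_of_le hY] at hy
        simp only [an_sq]
        rw [eta_supp]
        · simp
        · rw [abs_of_nonneg] <;> linarith [hy.2]
  have hnn : ∀ n : ℕ, n ∈ Finset.Ioc 0 ⌊Real.exp (Y + 1)⌋₊ → 0 ≤ E2 * (ArithmeticFunction.vonMangoldt n / n * (Real.log n * gg e ((Real.log n - 1) / Y))) := by
    intro n h
    have hn0 : (0 : ℝ) < n := by exact_mod_cast (Finset.mem_Ioc.mp h).1
    have hl : Real.log n ≤ Y + 1 := by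
        rw [Real.log_le_iff_le_exp hn0]
        exact (Nat.le_floor_iff (by positivity)).mp (Finset.mem_Ioc.mp h).2
    have hG := gg_nonneg he.1 (by rw [div_le_one hY0]; linarith : (Real.log n - 1) / Y ≤ 1)
    have h2 := ArithmeticFunction.vonMangoldt_nonneg (n := n)
    have := E2_pos
    have := Real.log_natCast_nonneg n
    positivity
  have s1 : ∫ y in (2)..Y, gg e (y / Y) * ∑ n ∈ Finset.range N, an y n ^ 2 ≤
      E2 * ∑ n ∈ Finset.Ioc 0 ⌊Real.exp (Y + 1)⌋₊, ArithmeticFunction.vonMangoldt n / n * (Real.log n * gg e ((Real.log n - 1) / Y)) := by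
    simp only [Finset.mul_sum]
    rw [intervalIntegral.integral_finsetSum fun n _ => (hlc n).intervalIntegrable _ _]
    refine (Finset.sum_le_sum fun n _ => hterm n).trans ?_
    rw [← Finset.sum_filter]
    refine Finset.sum_le_sum_of_subset_of_nonneg ?_ fun n hn _ => hnn n hn
    intro n hn; exact (Finset.mem_filter.mp hn).2
  refine s1.trans (mul_le_mul_of_nonneg_left ?_ E2_pos.le)
  have hd : ∀ v : ℝ, HasDerivAt (fun v => v * gg e ((v - 1) / Y)) (gg e ((v - 1) / Y) + v * ((-1 - 2 * e * (1 - (v - 1) / Y)) / Y)) v := by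
    intro v
    have h1 : HasDerivAt (fun v : ℝ => (v - 1) / Y) (1 / Y) v := ((hasDerivAt_id v).sub_const 1).div_const Y
    have h2 : HasDerivAt (fun v : ℝ => gg e ((v - 1) / Y)) ((-1 - 2 * e * (1 - (v - 1) / Y)) / Y) v := by
      unfold gg
      have h3 := h1.const_sub 1
      convert! h3.add ((h3.pow 2).const_mul e) using 1
      push_cast; ring
    convert! (hasDerivAt_id v).mul h2 using 1
    simp
  have hB : ∀ v ∈ Icc 0 (Y + 1), |gg e ((v - 1) / Y) + v * ((-1 - 2 * e * (1 - (v - 1) / Y)) / Y)| ≤ 12 := by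
    intro v hv
    have hw0 : 0 ≤ 1 - (v - 1) / Y := by
      have : (v - 1) / Y ≤ 1 := by rw [div_le_one hY0]; linarith [hv.2]
      linarith
    have hw1 : 1 - (v - 1) / Y ≤ 3 / 2 := by
      have : -(1 / 2) ≤ (v - 1) / Y := by rw [le_div_iff₀ hY0]; linarith [hv.1]
      linarith
    have hz0 : 0 ≤ v / Y := div_nonneg hv.1 hY0.le
    have hz1 : v / Y ≤ 3 / 2 := by rw [div_le_iff₀ hY0]; linarith [hv.2]
    rw [gg, show v * ((-1 - 2 * e * (1 - (v - 1) / Y)) / Y) = - ((v / Y) * (1 + 2 * e * (1 - (v - 1) / Y))) by ring]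
    generalize 1 - (v - 1) / Y = w at *
    generalize v / Y = z at *
    obtain ⟨he0, he1⟩ := he
    have p1 : e * w ≤ 3 / 2 := by nlinarith
    have p2 : e * w ^ 2 ≤ 9 / 4 := by nlinarith [mul_nonneg he0 hw0]
    have p3 : 0 ≤ e * w ^ 2 := by positivity
    have p4 : 0 ≤ e * w := by positivity
    have p5 : z * (1 + 2 * e * w) ≤ 3 / 2 * 4 := by
      apply mul_le_mul hz1 (by linarith) (by linarith) (by norm_num)
    have p6 : 0 ≤ z * (1 + 2 * e * w) := mul_nonneg hz0 (by linarith)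
    rw [abs_le]; constructor <;> linarith
  have hps := part_sum (f := fun v => v * gg e ((v - 1) / Y)) (Z := Y + 1) (B := 12) (by linarith) hd
    (by have := gg_cont e; fun_prop) (by simp [gg, hY0.ne']) hB
  refine hps.trans ?_
  have hint : ∫ s in (0)..(Y + 1), s * gg e ((s - 1) / Y) = (Y + 1) ^ 3 / (6 * Y) + e * (Y + 1) ^ 4 / (12 * Y ^ 2) := by
    have hP : ∀ s : ℝ, HasDerivAt (fun s : ℝ => ((Y + 1) * s ^ 2 / 2 - s ^ 3 / 3) / Y +
        e * ((Y + 1) ^ 2 * s ^ 2 / 2 - 2 * (Y + 1) * s ^ 3 / 3 + s ^ 4 / 4) / Y ^ 2) (s * gg e ((s - 1) / Y)) s := by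
      intro s
      have q2 := hasDerivAt_pow 2 s
      have q3 := hasDerivAt_pow 3 s
      have q4 := hasDerivAt_pow 4 s
      convert! (((q2.const_mul (Y + 1)).div_const 2).sub (q3.div_const 3) |>.div_const Y).add
        ((((((q2.const_mul ((Y + 1) ^ 2)).div_const 2).sub ((q3.const_mul (2 * (Y + 1))).div_const 3)).add (q4.div_const 4)).const_mul e).div_const (Y ^ 2)) using 1
      unfold gg; push_cast; field_simp; ring
    rw [intervalIntegral.integral_eq_sub_of_hasDerivAt (fun s _ => hP s)
      ((by have := gg_cont e; fun_prop : Continuous _).intervalIntegrable _ _)]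
    field_simp; ring
  rw [hint]
  have r1 : (Y + 1) ^ 3 / (6 * Y) ≤ Y ^ 2 / 6 + Y := by
    rw [div_le_iff₀ (by positivity)]; nlinarith
  have r2 : (Y + 1) ^ 4 / (12 * Y ^ 2) ≤ Y ^ 2 / 12 + 10 * Y := by
    rw [div_le_iff₀ (by positivity)]
    nlinarith [mul_nonneg hY0.le (sub_nonneg.mpr hY), mul_nonneg (sq_nonneg Y) (sub_nonneg.mpr hY), pow_pos hY0 3]
  have r3 : e * (Y + 1) ^ 4 / (12 * Y ^ 2) ≤ e * Y ^ 2 / 12 + 10 * Y := by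
    rw [mul_div_assoc]
    have := mul_le_mul_of_nonneg_left r2 he.1
    nlinarith [he.2]
  nlinarith

lemma inv_dist_sum (N n : ℕ) (hn : n < N) :
    ∑ m ∈ Finset.range N, |(m : ℝ) - n|⁻¹ ≤ 2 * (1 + Real.log N) := by
  have hh : ∀ k ≤ N, ∑ i ∈ Finset.range k, ((i : ℝ) + 1)⁻¹ ≤ 1 + Real.log N := by
    intro k hk
    have h1 := harmonic_le_one_add_log N
    have h2 : ((harmonic N : ℚ) : ℝ) = ∑ i ∈ Finset.range N, ((i : ℝ) + 1)⁻¹ := by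
      simp [harmonic]
    rw [h2] at h1
    refine le_trans ?_ h1
    exact Finset.sum_le_sum_of_subset_of_nonneg (Finset.range_mono hk) fun i _ _ => by positivity
  rw [Finset.range_eq_Ico, ← Finset.sum_Ico_consecutive _ (Nat.zero_le n) hn.le, two_mul]
  refine add_le_add ?_ ?_
  · rw [← Finset.range_eq_Ico, ← Finset.sum_range_reflect]
    refine le_trans (le_of_eq (Finset.sum_congr rfl fun i hi => ?_)) (hh n hn.le)
    have hi := Finset.mem_range.mp hi
    congr 1
    rw [Nat.sub_sub, Nat.cast_sub (by omega)]; push_cast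
    rw [show (n : ℝ) - (1 + i) - n = -(i + 1) by ring, abs_neg, abs_of_nonneg (by positivity)]
  · rw [Finset.sum_Ico_eq_sum_range]
    obtain ⟨k, hk⟩ : ∃ k, N - n = k + 1 := ⟨N - n - 1, by omega⟩
    rw [hk, Finset.sum_range_succ']
    refine le_trans (le_of_eq ?_) (hh k (by omega))
    simp only [Nat.cast_add, add_zero, sub_self, abs_zero, inv_zero, add_sub_cancel_left]
    refine Finset.sum_congr rfl fun i hi => ?_
    push_cast
    rw [abs_of_nonneg (by positivity)]

lemma log_gap {N m n : ℕ} (hm : 0 < m) (hmn : m < n) (hn : n ≤ N) :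
    ((n : ℝ) - m) / N ≤ Real.log n - Real.log m := by
  have m0 : (0 : ℝ) < m := by exact_mod_cast hm
  have n0 : (0 : ℝ) < n := by exact_mod_cast hm.trans hmn
  have h : (m : ℝ) < n := by exact_mod_cast hmn
  have hN : (n : ℝ) ≤ N := by exact_mod_cast hn
  rw [← Real.log_div n0.ne' m0.ne']
  have := Real.one_sub_inv_le_log_of_pos (div_pos n0 m0)
  refine le_trans ?_ this
  rw [inv_div, one_sub_div n0.ne']
  exact div_le_div_of_nonneg_left (by linarith) n0 hN

lemma mean_value (a : ℕ → ℝ) (ha : a 0 = 0) {N : ℕ} {T : ℝ} (hT : 0 ≤ T) :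
    ∫ t in T..(2 * T), ‖∑ n ∈ Finset.range N, (a n : ℂ) * ee (t * Real.log n)‖ ^ 2 ≤
      (T + 4 * N * (1 + Real.log N)) * ∑ n ∈ Finset.range N, a n ^ 2 := by
  have e1 : ∀ t : ℝ, ‖∑ n ∈ Finset.range N, (a n : ℂ) * ee (t * Real.log n)‖ ^ 2 =
      ∑ m ∈ Finset.range N, ∑ n ∈ Finset.range N, a m * a n * Real.cos ((Real.log m - Real.log n) * t) := by
    intro t
    have hz : ∑ n ∈ Finset.range N, (a n : ℂ) * ee (t * Real.log n) =
        ⟨∑ n ∈ Finset.range N, a n * Real.cos (t * Real.log n), ∑ n ∈ Finset.range N, a n * Real.sin (t * Real.log n)⟩ := by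
      apply Complex.ext
      · simp [ee, Complex.re_sum, Complex.exp_ofReal_mul_I_re, ← Complex.ofReal_mul]
      · simp [ee, Complex.im_sum, Complex.exp_ofReal_mul_I_im, ← Complex.ofReal_mul]
    rw [hz, ← Complex.normSq_eq_norm_sq, Complex.normSq_mk, Finset.sum_mul_sum, Finset.sum_mul_sum, ← Finset.sum_add_distrib]
    refine Finset.sum_congr rfl fun m _ => ?_
    rw [← Finset.sum_add_distrib]
    refine Finset.sum_congr rfl fun n _ => ?_
    rw [sub_mul, Real.cos_sub, mul_comm t, mul_comm t]; ring
  simp only [e1]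
  have hci : ∀ m n : ℕ, IntervalIntegrable (fun t => a m * a n * Real.cos ((Real.log m - Real.log n) * t)) volume T (2 * T) :=
    fun m n => (by fun_prop : Continuous _).intervalIntegrable _ _
  rw [intervalIntegral.integral_finsetSum fun m _ => (by fun_prop : Continuous _).intervalIntegrable _ _]
  simp_rw [intervalIntegral.integral_finsetSum fun n _ => hci _ n]
  set w : ℕ → ℕ → ℝ := fun m n => (if m = n then T else 0) + 2 * N * |(m : ℝ) - n|⁻¹ with hw
  have hw0 : ∀ m n, 0 ≤ w m n := fun m n => by simp only [hw]; split_ifs <;> positivity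
  have hws : ∀ m n, w m n = w n m := fun m n => by simp only [hw, eq_comm, abs_sub_comm]
  have hterm : ∀ m ∈ Finset.range N, ∀ n ∈ Finset.range N,
      ∫ t in T..(2 * T), a m * a n * Real.cos ((Real.log m - Real.log n) * t) ≤ (a m ^ 2 + a n ^ 2) / 2 * w m n := by
    intro m hm n hn
    rw [Finset.mem_range] at hm hn
    have hamgm : |a m * a n| ≤ (a m ^ 2 + a n ^ 2) / 2 := by
      rw [abs_mul]; nlinarith [sq_nonneg (|a m| - |a n|), sq_abs (a m), sq_abs (a n)]
    rcases Nat.eq_zero_or_pos m with rfl | hm0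
    · simp only [ha, zero_mul, intervalIntegral.integral_zero]
      exact mul_nonneg (by positivity) (hw0 _ _)
    rcases Nat.eq_zero_or_pos n with rfl | hn0
    · simp only [ha, zero_mul, mul_zero, intervalIntegral.integral_zero]
      exact mul_nonneg (by positivity) (hw0 _ _)
    rw [intervalIntegral.integral_const_mul]
    refine (le_abs_self _).trans ?_
    rw [abs_mul]
    refine mul_le_mul hamgm ?_ (abs_nonneg _) (by positivity)
    by_cases hmn : m = n
    · subst hmn
      simp only [hw, sub_self, zero_mul, Real.cos_zero, intervalIntegral.integral_const, if_true, abs_zero, inv_zero, mul_zero, add_zero]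
      rw [smul_eq_mul, mul_one, abs_of_nonneg] <;> linarith
    · have hgap : |(m : ℝ) - n| / N ≤ |Real.log m - Real.log n| := by
        rcases lt_or_gt_of_ne hmn with h | h
        · rw [abs_sub_comm, abs_sub_comm (Real.log _)]
          have h' : (m : ℝ) < n := by exact_mod_cast h
          rw [abs_of_pos (by linarith)]
          exact (log_gap hm0 h hn.le).trans (le_abs_self _)
        · have h' : (n : ℝ) < m := by exact_mod_cast h
          rw [abs_of_pos (by linarith)]
          exact (log_gap hn0 h hm.le).trans (le_abs_self _)
      have hd : 0 < |(m : ℝ) - n| := abs_pos.mpr (sub_ne_zero.mpr (by exact_mod_cast hmn))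
      have hN : (0 : ℝ) < N := by exact_mod_cast hm0.trans hm
      have hl : 0 < |Real.log m - Real.log n| := lt_of_lt_of_le (by positivity) hgap
      have hl' : Real.log m - Real.log n ≠ 0 := abs_pos.mp hl
      rw [intervalIntegral.integral_comp_mul_left (fun x => Real.cos x) hl', integral_cos, smul_eq_mul, abs_mul, abs_inv]
      simp only [hw, if_neg hmn, zero_add]
      have h2 : |Real.sin ((Real.log m - Real.log n) * (2 * T)) - Real.sin ((Real.log m - Real.log n) * T)| ≤ 2 := by
        rw [abs_le]
        constructor <;> linarith [Real.sin_le_one ((Real.log m - Real.log n) * (2 * T)), Real.neg_one_le_sin ((Real.log m - Real.log n) * (2 * T)),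
          Real.sin_le_one ((Real.log m - Real.log n) * T), Real.neg_one_le_sin ((Real.log m - Real.log n) * T)]
      have h3 : |Real.log m - Real.log n|⁻¹ ≤ N * |(m : ℝ) - n|⁻¹ := by
        have := inv_anti₀ (by positivity) hgap
        rw [inv_div, div_eq_mul_inv] at this; exact this
      calc _ ≤ (N * |(m : ℝ) - n|⁻¹) * 2 := mul_le_mul h3 h2 (abs_nonneg _) (by positivity)
        _ = _ := by ring
  refine (Finset.sum_le_sum fun m hm => Finset.sum_le_sum fun n hn => hterm m hm n hn).trans ?_
  have sy : ∑ m ∈ Finset.range N, ∑ n ∈ Finset.range N, (a m ^ 2 + a n ^ 2) / 2 * w m n =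
      ∑ n ∈ Finset.range N, a n ^ 2 * ∑ m ∈ Finset.range N, w m n := by
    have q1 : ∑ m ∈ Finset.range N, ∑ n ∈ Finset.range N, a n ^ 2 / 2 * w m n =
      ∑ n ∈ Finset.range N, a n ^ 2 / 2 * ∑ m ∈ Finset.range N, w m n := by
      rw [Finset.sum_comm]; simp only [Finset.mul_sum]
    have q2 : ∑ m ∈ Finset.range N, ∑ n ∈ Finset.range N, a m ^ 2 / 2 * w m n =
      ∑ n ∈ Finset.range N, a n ^ 2 / 2 * ∑ m ∈ Finset.range N, w m n := by
      simp only [Finset.mul_sum]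
      exact Finset.sum_congr rfl fun m _ => Finset.sum_congr rfl fun n _ => by rw [hws]
    calc _ = ∑ m ∈ Finset.range N, ∑ n ∈ Finset.range N, a m ^ 2 / 2 * w m n + ∑ m ∈ Finset.range N, ∑ n ∈ Finset.range N, a n ^ 2 / 2 * w m n := by
          simp only [← Finset.sum_add_distrib]
          exact Finset.sum_congr rfl fun m _ => Finset.sum_congr rfl fun n _ => by ring
      _ = _ := by
          rw [q1, q2, ← Finset.sum_add_distrib]
          exact Finset.sum_congr rfl fun m _ => by ring
  rw [sy, mul_comm, Finset.sum_mul]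
  refine Finset.sum_le_sum fun n hn => mul_le_mul_of_nonneg_left ?_ (sq_nonneg _)
  simp only [hw]
  rw [Finset.sum_add_distrib, ← Finset.mul_sum, Finset.sum_ite_eq', if_pos hn]
  have := mul_le_mul_of_nonneg_left (inv_dist_sum N n (Finset.mem_range.mp hn)) (by positivity : (0 : ℝ) ≤ 2 * N)
  linarith

lemma convex_cos {G G1 G2 : ℝ → ℝ} {Y : ℝ} (hY : 0 ≤ Y) (h1 : ∀ y, HasDerivAt G (G1 y) y)
    (h2 : ∀ y, HasDerivAt G1 (G2 y) y) (hc : Continuous G2) (hp : ∀ y ∈ Icc 0 Y, 0 ≤ G2 y)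
    (h0 : ∀ y ∈ Icc 0 Y, 0 ≤ G y) (hz : G Y = 0) (hz1 : G1 Y ≤ 0) (x : ℝ) :
    0 ≤ ∫ y in (0)..Y, G y * Real.cos (x * y) := by
  have hGc : Continuous G := continuous_iff_continuousAt.mpr fun x => (h1 x).continuousAt
  by_cases hx : x = 0
  · subst hx
    refine intervalIntegral.integral_nonneg hY fun y hy => ?_
    simpa using h0 y hy
  have hd : ∀ y ∈ uIcc 0 Y, HasDerivAt (fun y => G y * (Real.sin (x * y) / x) - G1 y * ((1 - Real.cos (x * y)) / x ^ 2))
      (G y * Real.cos (x * y) - G2 y * ((1 - Real.cos (x * y)) / x ^ 2)) y := by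
    intro y _
    have hm : HasDerivAt (fun y : ℝ => x * y) x y := by simpa using (hasDerivAt_id y).const_mul x
    have hs := hm.sin.div_const x
    have hcs := (hm.cos.const_sub 1).div_const (x ^ 2)
    convert! ((h1 y).mul hs).sub ((h2 y).mul hcs) using 1
    field_simp; ring
  have hi1 : IntervalIntegrable (fun y => G y * Real.cos (x * y)) volume 0 Y := (by fun_prop : Continuous _).intervalIntegrable _ _
  have hi2 : IntervalIntegrable (fun y => G2 y * ((1 - Real.cos (x * y)) / x ^ 2)) volume 0 Y := (by fun_prop : Continuous _).intervalIntegrable _ _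
  have key := intervalIntegral.integral_eq_sub_of_hasDerivAt hd (hi1.sub hi2)
  rw [intervalIntegral.integral_sub hi1 hi2] at key
  simp only [hz, mul_zero, Real.sin_zero, Real.cos_zero, zero_div, sub_self, zero_mul, sub_zero, zero_sub] at key
  have hH : ∀ y, 0 ≤ (1 - Real.cos (x * y)) / x ^ 2 := fun y => div_nonneg (by linarith [Real.cos_le_one (x * y)]) (sq_nonneg _)
  have p2 : 0 ≤ ∫ y in (0)..Y, G2 y * ((1 - Real.cos (x * y)) / x ^ 2) :=
    intervalIntegral.integral_nonneg hY fun y hy => mul_nonneg (hp y hy) (hH y)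
  have := mul_nonneg (neg_nonneg.mpr hz1) (hH Y)
  linarith

lemma sinh_le_two {z : ℝ} (h0 : 0 ≤ z) (h1 : z ≤ 1) : Real.sinh z ≤ 2 * z := by
  have hm : MonotoneOn (fun z => 2 * z - Real.sinh z) (Icc 0 1) := by
    refine monotoneOn_of_deriv_nonneg (convex_Icc 0 1) (by fun_prop) (by fun_prop) fun z hz => ?_
    rw [interior_Icc] at hz
    have : HasDerivAt (fun z => 2 * z - Real.sinh z) (2 * 1 - Real.cosh z) z :=
      ((hasDerivAt_id z).const_mul 2).sub (Real.hasDerivAt_sinh z)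
    rw [this.deriv]
    have h3 : Real.cosh z ≤ Real.cosh 1 := by rw [Real.cosh_le_cosh, abs_of_pos hz.1, abs_one]; exact hz.2.le
    have h4 : Real.cosh 1 ≤ 2 := by
      rw [Real.cosh_eq]
      have a := Real.exp_one_lt_d9
      have b : Real.exp (-1) ≤ 1 := Real.exp_le_one_iff.mpr (by norm_num)
      linarith
    linarith
  have := hm ⟨le_refl _, zero_le_one⟩ ⟨h0, h1⟩ h0
  simp at this; linarith

lemma pos_cosh {e Y a : ℝ} (he0 : 0 < e) (he1 : e ≤ 1) (hY : 0 < Y) (ha : 6 * (a * Y) ^ 2 ≤ e) (x : ℝ) :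
    0 ≤ ∫ y in (0)..Y, gg e (y / Y) * Real.cosh (a * y) * Real.cos (x * y) := by
  have hg : ∀ y, HasDerivAt (fun y => gg e (y / Y)) ((-1 - 2 * e * (1 - y / Y)) / Y) y := by
    intro y
    have h3 := ((hasDerivAt_id y).div_const Y).const_sub 1
    unfold gg
    convert! h3.add ((h3.pow 2).const_mul e) using 1
    simp only [id]; push_cast; ring
  have hg1 : ∀ y, HasDerivAt (fun y => (-1 - 2 * e * (1 - y / Y)) / Y) (2 * e / Y ^ 2) y := by
    intro y
    have h3 := ((hasDerivAt_id y).div_const Y).const_sub 1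
    convert! ((h3.const_mul (2 * e)).const_sub (-1)).div_const Y using 1
    ring
  have hm : ∀ y : ℝ, HasDerivAt (fun y : ℝ => a * y) a y := fun y => by simpa using (hasDerivAt_id y).const_mul a
  have hch := fun y => (hm y).cosh
  have hsh := fun y => (hm y).sinh
  refine convex_cos hY.le (G := fun y => gg e (y / Y) * Real.cosh (a * y))
    (G1 := fun y => (-1 - 2 * e * (1 - y / Y)) / Y * Real.cosh (a * y) + gg e (y / Y) * (Real.sinh (a * y) * a))
    (G2 := fun y => 2 * e / Y ^ 2 * Real.cosh (a * y) + (-1 - 2 * e * (1 - y / Y)) / Y * (Real.sinh (a * y) * a) +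
      ((-1 - 2 * e * (1 - y / Y)) / Y * (Real.sinh (a * y) * a) + gg e (y / Y) * (Real.cosh (a * y) * a * a)))
    (fun y => (hg y).mul (hch y))
    (fun y => ((hg1 y).mul (hch y)).add ((hg y).mul ((hsh y).mul_const a))) ?_ ?_ ?_ ?_ ?_ x
  · have := gg_cont e; fun_prop
  · intro y hy
    have hu : 0 ≤ 1 - y / Y := by have := (div_le_one hY).mpr hy.2; linarith
    have hu' : 1 - y / Y ≤ 1 := by have := div_nonneg hy.1 hY.le; linarith
    have hgn := gg_nonneg he0.le ((div_le_one hY).mpr hy.2)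
    have hcosh := Real.one_le_cosh (a * y)
    set z := |a| * Y
    have hz0 : 0 ≤ z := by positivity
    have hzz : z ^ 2 = (a * Y) ^ 2 := by simp only [z, mul_pow, sq_abs]
    have hz1 : z ≤ 1 := by nlinarith
    have hs : Real.sinh (a * y) * a * Y ≤ 2 * z ^ 2 := by
      refine (le_abs_self _).trans ?_
      rw [abs_mul, abs_mul, abs_of_pos hY, Real.abs_sinh, mul_assoc, abs_mul, abs_of_nonneg hy.1]
      have h5 : Real.sinh (|a| * y) ≤ 2 * z := by
        refine le_trans (Real.sinh_le_sinh.mpr ?_) (sinh_le_two hz0 hz1)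
        exact mul_le_mul_of_nonneg_left hy.2 (abs_nonneg _)
      calc _ ≤ (2 * z) * z := mul_le_mul_of_nonneg_right h5 hz0
        _ = _ := by ring
    have e1 : (-1 - 2 * e * (1 - y / Y)) / Y * (Real.sinh (a * y) * a) = - ((1 + 2 * e * (1 - y / Y)) * (Real.sinh (a * y) * a * Y)) / Y ^ 2 := by
      field_simp; ring
    have h6 : (1 + 2 * e * (1 - y / Y)) * (Real.sinh (a * y) * a * Y) ≤ 3 * (2 * z ^ 2) := by
      have hpos : 0 ≤ 1 + 2 * e * (1 - y / Y) := by positivity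
      have hle : 1 + 2 * e * (1 - y / Y) ≤ 3 := by nlinarith
      calc _ ≤ (1 + 2 * e * (1 - y / Y)) * (2 * z ^ 2) := mul_le_mul_of_nonneg_left hs hpos
        _ ≤ _ := mul_le_mul_of_nonneg_right hle (by positivity)
    rw [e1]
    have h7 : 0 ≤ gg e (y / Y) * (Real.cosh (a * y) * a * a) := by
      rw [mul_assoc]; have := mul_self_nonneg a; positivity
    have h8 : 2 * e / Y ^ 2 ≤ 2 * e / Y ^ 2 * Real.cosh (a * y) := le_mul_of_one_le_right (by positivity) hcosh
    have h9 : 0 ≤ (2 * e - 2 * ((1 + 2 * e * (1 - y / Y)) * (Real.sinh (a * y) * a * Y))) / Y ^ 2 := by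
      refine div_nonneg ?_ (by positivity)
      nlinarith
    have h10 : (2 * e - 2 * ((1 + 2 * e * (1 - y / Y)) * (Real.sinh (a * y) * a * Y))) / Y ^ 2 = 2 * e / Y ^ 2 +
       (- ((1 + 2 * e * (1 - y / Y)) * (Real.sinh (a * y) * a * Y)) / Y ^ 2 + - ((1 + 2 * e * (1 - y / Y)) * (Real.sinh (a * y) * a * Y)) / Y ^ 2) := by ring
    linarith
  · intro y hy
    exact mul_nonneg (gg_nonneg he0.le ((div_le_one hY).mpr hy.2)) (by linarith [Real.one_le_cosh (a * y)])
  · simp [gg, hY.ne']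
  · have : gg e 1 = 0 := by simp [gg]
    simp only [this, zero_mul, add_zero, div_self hY.ne', sub_self, mul_zero]
    refine mul_nonpos_of_nonpos_of_nonneg ?_ (by linarith [Real.one_le_cosh (a * Y)])
    rw [sub_zero, neg_div]
    exact neg_nonpos.mpr (by positivity)

lemma pos_cosh2 {e Y a b d : ℝ} (he0 : 0 < e) (he1 : e ≤ 1) (hY : 0 < Y) (ha : |a| ≤ d) (hb : |b| ≤ d) (hd : 24 * (d * Y) ^ 2 ≤ e) (x : ℝ) :
    0 ≤ ∫ y in (0)..Y, gg e (y / Y) * (Real.cosh (a * y) * Real.cosh (b * y) * Real.cos (x * y)) := by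
  have hd0 : 0 ≤ d := (abs_nonneg a).trans ha
  have hgc := gg_cont e
  have aux : ∀ c, |c| ≤ 2 * d → 6 * (c * Y) ^ 2 ≤ e := by
    intro c hc
    have : (c * Y) ^ 2 ≤ (2 * d * Y) ^ 2 := by
      rw [← sq_abs (c * Y), abs_mul, abs_of_pos hY]; gcongr
    nlinarith
  have h1 := pos_cosh he0 he1 hY (aux (a + b) (by have := abs_add_le a b; linarith)) x
  have h2 := pos_cosh he0 he1 hY (aux (a - b) (by have := abs_sub a b; linarith)) x
  have := add_nonneg h1 h2
  rw [← intervalIntegral.integral_add ((by fun_prop : Continuous _).intervalIntegrable _ _) ((by fun_prop : Continuous _).intervalIntegrable _ _)] at this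
  have e1 : ∀ y, gg e (y / Y) * (Real.cosh (a * y) * Real.cosh (b * y) * Real.cos (x * y)) =
    (1 / 2) * (gg e (y / Y) * Real.cosh ((a + b) * y) * Real.cos (x * y) + gg e (y / Y) * Real.cosh ((a - b) * y) * Real.cos (x * y)) := by
    intro y
    rw [add_mul, sub_mul, Real.cosh_add, Real.cosh_sub]; ring
  simp only [e1]
  rw [intervalIntegral.integral_const_mul]
  positivity

lemma gg_integral (e : ℝ) {Y : ℝ} (hY : 0 < Y) : ∫ y in (0)..Y, gg e (y / Y) = Y * (1 / 2 + e / 3) := by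
  have hP : ∀ s : ℝ, HasDerivAt (fun s : ℝ => - Y * (1 - s / Y) ^ 2 / 2 - e * Y * (1 - s / Y) ^ 3 / 3) (gg e (s / Y)) s := by
    intro s
    have h3 := ((hasDerivAt_id s).div_const Y).const_sub 1
    convert! (((h3.pow 2).const_mul (-Y)).div_const 2).sub (((h3.pow 3).const_mul (e * Y)).div_const 3) using 1
    unfold gg; simp only [id]; push_cast; field_simp; ring
  rw [intervalIntegral.integral_eq_sub_of_hasDerivAt (fun s _ => hP s)
      ((by have := gg_cont e; fun_prop : Continuous _).intervalIntegrable _ _)]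
  field_simp; ring

lemma norm_sq_sum {ι : Type*} (s : Finset ι) (c θ : ι → ℝ) :
    ‖∑ i ∈ s, (c i : ℂ) * ee (θ i)‖ ^ 2 = ∑ i ∈ s, ∑ j ∈ s, c i * c j * Real.cos (θ i - θ j) := by
  have hz : ∑ n ∈ s, (c n : ℂ) * ee (θ n) = ⟨∑ n ∈ s, c n * Real.cos (θ n), ∑ n ∈ s, c n * Real.sin (θ n)⟩ := by
    apply Complex.ext
    · simp [ee, Complex.re_sum, Complex.exp_ofReal_mul_I_re, ← Complex.ofReal_mul]
    · simp [ee, Complex.im_sum, Complex.exp_ofReal_mul_I_im, ← Complex.ofReal_mul]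
  rw [hz, ← Complex.normSq_eq_norm_sq, Complex.normSq_mk, Finset.sum_mul_sum, Finset.sum_mul_sum, ← Finset.sum_add_distrib]
  refine Finset.sum_congr rfl fun m _ => ?_
  rw [← Finset.sum_add_distrib]
  refine Finset.sum_congr rfl fun n _ => ?_
  rw [Real.cos_sub]; ring

noncomputable def S0 (F : Finset NZ) (y t : ℝ) : ℂ :=
  ∑ ρ ∈ F, ((mu ρ * Real.cosh ((ρ.1.re - 1 / 2) * y) * phi (t - ρ.1.im) : ℝ) : ℂ) * ee (y * (t - ρ.1.im))

lemma S0_cont (F : Finset NZ) : Continuous fun p : ℝ × ℝ => S0 F p.1 p.2 := by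
  unfold S0
  have := phi_cont
  have := ee_cont
  fun_prop

open Classical in
lemma pos_lower {e Y d T : ℝ} (he0 : 0 < e) (he1 : e ≤ 1) (hY : 0 < Y) (hT : 0 ≤ T) (F : Finset NZ)
    (hF : ∀ ρ ∈ F, |ρ.1.re - 1 / 2| ≤ d) (hd : 24 * (d * Y) ^ 2 ≤ e) :
    Y * (1 / 2 + e / 3) * ∑ ρ ∈ F, ∑ ρ' ∈ F, (if ρ.1.im = ρ'.1.im then mu ρ * mu ρ' * ∫ t in T..(2 * T), phi (t - ρ.1.im) ^ 2 else 0) ≤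
    ∫ y in (0)..Y, gg e (y / Y) * ∫ t in T..(2 * T), ‖S0 F y t‖ ^ 2 := by
  have hgc := gg_cont e
  have hpc := phi_cont
  have hT2 : T ≤ 2 * T := by linarith
  have e1 : ∀ y, gg e (y / Y) * ∫ t in T..(2 * T), ‖S0 F y t‖ ^ 2 = ∑ ρ ∈ F, ∑ ρ' ∈ F,
      (mu ρ * mu ρ' * ∫ t in T..(2 * T), phi (t - ρ.1.im) * phi (t - ρ'.1.im)) *
      (gg e (y / Y) * (Real.cosh ((ρ.1.re - 1 / 2) * y) * Real.cosh ((ρ'.1.re - 1 / 2) * y) * Real.cos ((ρ'.1.im - ρ.1.im) * y))) := by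
    intro y
    simp only [S0, norm_sq_sum]
    rw [intervalIntegral.integral_finsetSum fun m _ => (by fun_prop : Continuous _).intervalIntegrable _ _, Finset.mul_sum]
    refine Finset.sum_congr rfl fun ρ _ => ?_
    rw [intervalIntegral.integral_finsetSum fun m _ => (by fun_prop : Continuous _).intervalIntegrable _ _, Finset.mul_sum]
    refine Finset.sum_congr rfl fun ρ' _ => ?_
    have e2 : ∀ t, mu ρ * Real.cosh ((ρ.1.re - 1 / 2) * y) * phi (t - ρ.1.im) * (mu ρ' * Real.cosh ((ρ'.1.re - 1 / 2) * y) * phi (t - ρ'.1.im)) *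
        Real.cos (y * (t - ρ.1.im) - y * (t - ρ'.1.im)) = (mu ρ * Real.cosh ((ρ.1.re - 1 / 2) * y) * (mu ρ' * Real.cosh ((ρ'.1.re - 1 / 2) * y)) *
        Real.cos ((ρ'.1.im - ρ.1.im) * y)) * (phi (t - ρ.1.im) * phi (t - ρ'.1.im)) := by
      intro t
      rw [show y * (t - ρ.1.im) - y * (t - ρ'.1.im) = (ρ'.1.im - ρ.1.im) * y by ring]; ring
    simp only [e2]
    rw [intervalIntegral.integral_const_mul]; ring
  simp only [e1]
  rw [intervalIntegral.integral_finsetSum fun m _ => (by fun_prop : Continuous _).intervalIntegrable _ _, Finset.mul_sum]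
  refine Finset.sum_le_sum fun ρ hρ => ?_
  rw [intervalIntegral.integral_finsetSum fun m _ => (by fun_prop : Continuous _).intervalIntegrable _ _, Finset.mul_sum]
  refine Finset.sum_le_sum fun ρ' hρ' => ?_
  rw [intervalIntegral.integral_const_mul]
  have hm : 0 ≤ mu ρ * mu ρ' := mul_nonneg (mu_pos ρ).le (mu_pos ρ').le
  have hq : 0 ≤ ∫ t in T..(2 * T), phi (t - ρ.1.im) * phi (t - ρ'.1.im) :=
    intervalIntegral.integral_nonneg hT2 fun t _ => mul_nonneg (phi_nonneg _) (phi_nonneg _)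
  split_ifs with h
  · rw [h]
    simp only [sub_self, zero_mul, Real.cos_zero, mul_one, ← pow_two]
    rw [h] at hq; simp only [← pow_two] at hq
    rw [mul_comm (Y * _)]
    refine mul_le_mul_of_nonneg_left ?_ (mul_nonneg hm hq)
    rw [← gg_integral e hY]
    refine intervalIntegral.integral_mono_on hY.le ((by fun_prop : Continuous _).intervalIntegrable _ _) ((by fun_prop : Continuous _).intervalIntegrable _ _) fun y hy => ?_
    refine le_mul_of_one_le_right (gg_nonneg he0.le ((div_le_one hY).mpr hy.2)) ?_
    exact one_le_mul_of_one_le_of_one_le (Real.one_le_cosh _) (Real.one_le_cosh _)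
  · rw [mul_zero]
    exact mul_nonneg (mul_nonneg hm hq) (pos_cosh2 he0 he1 hY (hF ρ hρ) (hF ρ' hρ') hd _)

lemma Cr_shift (ρ : NZ) (y t : ℝ) : Cr ρ y t = ee (y * (t - ρ.1.im)) *
    ft (fun v => ((eta v * Real.cosh ((ρ.1.re - 1 / 2) * (v + y)) : ℝ) : ℂ)) (t - ρ.1.im) := by
  rw [← ft_shift, Cr, ft]
  simp only [sub_add_cancel]

lemma nz_half (ρ : NZ) : |ρ.1.re - 1 / 2| ≤ 1 / 2 := by
  have := ρ.2.2
  rw [abs_le]; constructor <;> linarith [this.1, this.2]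

lemma bump_bound : ∃ C, 0 < C ∧ ∀ δ y c M : ℝ, |δ| ≤ 1 → ∀ A, 0 ≤ A →
    (∀ v ∈ Icc (-1 : ℝ) 1, |Real.cosh (δ * (v + y)) - c| ≤ A) → (∀ v ∈ Icc (-1 : ℝ) 1, Real.cosh (δ * (v + y)) ≤ M) → ∀ x,
    ‖ft (fun v => ((eta v * (Real.cosh (δ * (v + y)) - c) : ℝ) : ℂ)) x‖ ≤ C * (A + M * |δ|) / (1 + x ^ 2) := by
  obtain ⟨C, hC, h⟩ := eta_bdd
  refine ⟨10 * C, by positivity, fun δ y c M hδ A hA h1 h2 x => ?_⟩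
  have hM : 0 < M := lt_of_lt_of_le (Real.cosh_pos _) (h2 0 (by norm_num))
  have hl : ∀ v : ℝ, HasDerivAt (fun v => δ * (v + y)) δ v := fun v => by
    simpa using ((hasDerivAt_id v).add_const y).const_mul δ
  have dc : ∀ v, HasDerivAt (fun v => Real.cosh (δ * (v + y)) - c) (Real.sinh (δ * (v + y)) * δ) v := fun v => (hl v).cosh.sub_const c
  have ds : ∀ v, HasDerivAt (fun v => Real.sinh (δ * (v + y)) * δ) (Real.cosh (δ * (v + y)) * δ * δ) v := fun v => (hl v).sinh.mul_const δ
  have c2 := eta2_cont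
  have c1 := eta1_cont
  have c0 := eta_cont
  have hsc : ∀ z : ℝ, |Real.sinh z| ≤ Real.cosh z := fun z => by
    rw [abs_le]; constructor
    · have := Real.exp_pos z; rw [Real.sinh_eq, Real.cosh_eq]; linarith
    · exact (Real.sinh_lt_cosh z).le
  have key := ft_smooth_bound (h := fun v => eta v * (Real.cosh (δ * (v + y)) - c))
    (h1 := fun v => eta1 v * (Real.cosh (δ * (v + y)) - c) + eta v * (Real.sinh (δ * (v + y)) * δ))
    (h2 := fun v => (eta2 v * (Real.cosh (δ * (v + y)) - c) + eta1 v * (Real.sinh (δ * (v + y)) * δ)) +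
      (eta1 v * (Real.sinh (δ * (v + y)) * δ) + eta v * (Real.cosh (δ * (v + y)) * δ * δ)))
    (A := C * A) (B := C * A + 3 * (C * (M * |δ|)))
    (fun v => (eta_deriv v).mul (dc v)) (fun v => ((eta1_deriv v).mul (dc v)).add ((eta_deriv v).mul (ds v)))
    (by fun_prop) (fun v hv => by simp only [eta_supp hv, zero_mul]) (fun v hv => by simp only [eta1_supp hv, eta_supp hv, zero_mul, add_zero])
    (fun v hv => by rw [abs_mul]; exact mul_le_mul (h v).1 (h1 v hv) (abs_nonneg _) hC.le)
    (fun v hv => by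
      have hs : |Real.sinh (δ * (v + y)) * δ| ≤ M * |δ| := by
        rw [abs_mul]; exact mul_le_mul_of_nonneg_right ((hsc _).trans (h2 v hv)) (abs_nonneg _)
      have hcc : |Real.cosh (δ * (v + y)) * δ * δ| ≤ M * |δ| := by
        rw [abs_mul, abs_mul, abs_of_pos (Real.cosh_pos _)]
        have : Real.cosh (δ * (v + y)) * |δ| ≤ M * |δ| := mul_le_mul_of_nonneg_right (h2 v hv) (abs_nonneg _)
        calc _ ≤ (M * |δ|) * 1 := mul_le_mul this hδ (abs_nonneg _) (by positivity)
          _ = _ := mul_one _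
      have p1 : |eta2 v * (Real.cosh (δ * (v + y)) - c)| ≤ C * A := by
        rw [abs_mul]; exact mul_le_mul (h v).2.2 (h1 v hv) (abs_nonneg _) hC.le
      have p2 : |eta1 v * (Real.sinh (δ * (v + y)) * δ)| ≤ C * (M * |δ|) := by
        rw [abs_mul]; exact mul_le_mul (h v).2.1 hs (abs_nonneg _) hC.le
      have p3 : |eta v * (Real.cosh (δ * (v + y)) * δ * δ)| ≤ C * (M * |δ|) := by
        rw [abs_mul]; exact mul_le_mul (h v).1 hcc (abs_nonneg _) hC.le
      refine (abs_add_le _ _).trans ?_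
      have q1 := abs_add_le (eta2 v * (Real.cosh (δ * (v + y)) - c)) (eta1 v * (Real.sinh (δ * (v + y)) * δ))
      have q2 := abs_add_le (eta1 v * (Real.sinh (δ * (v + y)) * δ)) (eta v * (Real.cosh (δ * (v + y)) * δ * δ))
      linarith) x
  refine key.trans ?_
  gcongr
  have : 0 ≤ C * (M * |δ|) := by positivity
  have : 0 ≤ C * A := by positivity
  nlinarith

lemma Cr_far : ∃ C, 0 < C ∧ ∀ (ρ : NZ) (y t : ℝ), 0 ≤ y →
    ‖Cr ρ y t‖ ≤ C * Real.exp (y / 2) / (1 + (t - ρ.1.im) ^ 2) := by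
  obtain ⟨C, hC, h⟩ := bump_bound
  refine ⟨C * (2 * Real.exp 1), by positivity, fun ρ y t hy => ?_⟩
  have hδ := nz_half ρ
  rw [Cr_shift, norm_mul, ee_norm, one_mul]
  have hM : ∀ v ∈ Icc (-1 : ℝ) 1, Real.cosh ((ρ.1.re - 1 / 2) * (v + y)) ≤ Real.exp 1 * Real.exp (y / 2) := by
    intro v hv
    rw [← Real.exp_add]
    have hce : ∀ z : ℝ, Real.cosh z ≤ Real.exp |z| := fun z => by
      have : Real.exp (-|z|) ≤ Real.exp |z| := Real.exp_le_exp.mpr (by linarith [abs_nonneg z])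
      rw [← Real.cosh_abs, Real.cosh_eq]; linarith
    refine (hce _).trans (Real.exp_le_exp.mpr ?_)
    rw [abs_mul]
    have : |v + y| ≤ 1 + y := by rw [abs_le]; constructor <;> linarith [hv.1, hv.2]
    calc _ ≤ 1 / 2 * (1 + y) := mul_le_mul hδ this (abs_nonneg _) (by norm_num)
      _ ≤ _ := by linarith
  have := h (ρ.1.re - 1 / 2) y 0 (Real.exp 1 * Real.exp (y / 2)) (by linarith) (Real.exp 1 * Real.exp (y / 2)) (by positivity)
    (fun v hv => by rw [sub_zero, abs_of_pos (Real.cosh_pos _)]; exact hM v hv) hM (t - ρ.1.im)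
  simp only [sub_zero] at this
  refine this.trans (div_le_div_of_nonneg_right ?_ (by positivity))
  have hp : 0 < Real.exp 1 * Real.exp (y / 2) := by positivity
  have : Real.exp 1 * Real.exp (y / 2) * |ρ.1.re - 1 / 2| ≤ Real.exp 1 * Real.exp (y / 2) * 1 :=
    mul_le_mul_of_nonneg_left (by linarith) hp.le
  calc _ ≤ C * (Real.exp 1 * Real.exp (y / 2) + Real.exp 1 * Real.exp (y / 2) * 1) := by gcongr
    _ = _ := by ring

lemma Cr_near : ∃ C, 0 < C ∧ ∀ (ρ : NZ) (y t d : ℝ), 0 ≤ y → |ρ.1.re - 1 / 2| ≤ d → d * (y + 1) ≤ 2 →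
    ‖Cr ρ y t - ((Real.cosh ((ρ.1.re - 1 / 2) * y) * phi (t - ρ.1.im) : ℝ) : ℂ) * ee (y * (t - ρ.1.im))‖ ≤ C * d / (1 + (t - ρ.1.im) ^ 2) := by
  obtain ⟨C, hC, h⟩ := bump_bound
  refine ⟨C * 8, by positivity, fun ρ y t d hy hd hdy => ?_⟩
  have hδ := nz_half ρ
  set δ := ρ.1.re - 1 / 2 with hδd
  have hd0 : 0 ≤ d := (abs_nonneg _).trans hd
  have hc2 : Real.cosh 2 ≤ 4 := by
    rw [Real.cosh_eq]
    have a : Real.exp 2 = Real.exp 1 * Real.exp 1 := by rw [← Real.exp_add]; norm_num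
    have b : Real.exp (-2) ≤ 0.2 := by
      rw [Real.exp_neg, a]
      have := Real.exp_one_gt_d9
      rw [inv_le_comm₀ (by positivity) (by norm_num)]; nlinarith
    have := Real.exp_one_lt_d9
    have := Real.exp_pos 1
    nlinarith
  have hb : ∀ w, |w| ≤ y + 1 → Real.cosh (δ * w) ≤ 4 := by
    intro w hw
    refine le_trans (Real.cosh_le_cosh.mpr ?_) hc2
    rw [abs_mul, abs_two]
    exact (mul_le_mul hd hw (abs_nonneg _) hd0).trans hdy
  have hM : ∀ v ∈ Icc (-1 : ℝ) 1, Real.cosh (δ * (v + y)) ≤ 4 := by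
    intro v hv
    apply hb
    rw [abs_le]; constructor <;> linarith [hv.1, hv.2]
  have hA : ∀ v ∈ Icc (-1 : ℝ) 1, |Real.cosh (δ * (v + y)) - Real.cosh (δ * y)| ≤ 4 * |δ| := by
    intro v hv
    have hder : ∀ w ∈ Icc (-(y + 1)) (y + 1), HasDerivWithinAt (fun w => Real.cosh (δ * w)) (Real.sinh (δ * w) * δ) (Icc (-(y + 1)) (y + 1)) w := fun w _ => by
      have : HasDerivAt (fun w : ℝ => δ * w) δ w := by simpa using (hasDerivAt_id w).const_mul δ
      exact this.cosh.hasDerivWithinAt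
    have := (convex_Icc (-(y + 1)) (y + 1)).norm_image_sub_le_of_norm_hasDerivWithin_le hder (C := 4 * |δ|) (fun w hw => by
      rw [norm_mul, Real.norm_eq_abs, Real.norm_eq_abs]
      refine mul_le_mul_of_nonneg_right ?_ (abs_nonneg _)
      refine le_trans ?_ (hb w (abs_le.mpr hw))
      rw [abs_le]; constructor
      · have := Real.exp_pos (δ * w); rw [Real.sinh_eq, Real.cosh_eq]; linarith
      · exact (Real.sinh_lt_cosh _).le) (x := y) (y := v + y) ⟨by linarith, by linarith⟩ ⟨by linarith [hv.1], by linarith [hv.2]⟩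
    rw [Real.norm_eq_abs, Real.norm_eq_abs, add_sub_cancel_right] at this
    refine this.trans (mul_le_of_le_one_right (by positivity) (abs_le.mpr hv))
  have key := h δ y (Real.cosh (δ * y)) 4 (by linarith) (4 * |δ|) (by positivity) hA hM (t - ρ.1.im)
  have e1 : Cr ρ y t - ((Real.cosh (δ * y) * phi (t - ρ.1.im) : ℝ) : ℂ) * ee (y * (t - ρ.1.im)) =
      ee (y * (t - ρ.1.im)) * ft (fun v => ((eta v * (Real.cosh (δ * (v + y)) - Real.cosh (δ * y)) : ℝ) : ℂ)) (t - ρ.1.im) := by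
    rw [Cr_shift, ← hδd]
    have i1 : Integrable (fun v => ((eta v * Real.cosh (δ * (v + y)) : ℝ) : ℂ)) := by
      have := eta_mul_int (g := fun v => Real.cosh (δ * (v + y))) (by fun_prop) 0 0
      simpa [ee_zero] using this
    have i2 : Integrable (fun v => (Real.cosh (δ * y) : ℂ) * (eta v : ℂ)) := eta_int.const_mul _
    have e2 : (fun v => ((eta v * (Real.cosh (δ * (v + y)) - Real.cosh (δ * y)) : ℝ) : ℂ)) =
        fun v => ((eta v * Real.cosh (δ * (v + y)) : ℝ) : ℂ) - (Real.cosh (δ * y) : ℂ) * (eta v : ℂ) := by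
      ext v; push_cast; ring
    rw [e2, ft_sub _ _ i1 i2]
    have e3 : ft (fun v => (Real.cosh (δ * y) : ℂ) * (eta v : ℂ)) (t - ρ.1.im) = (Real.cosh (δ * y) : ℂ) * phi (t - ρ.1.im) := by
      rw [← ft_eta, ft, ft, ← integral_const_mul]
      simp only [mul_assoc]
    rw [e3, Complex.ofReal_mul (Real.cosh _)]; ring
  rw [e1, norm_mul, ee_norm, one_mul]
  refine key.trans (div_le_div_of_nonneg_right ?_ (by positivity))
  nlinarith

lemma log_le_two_sqrt {T : ℝ} (hT : 0 < T) : Real.log T ≤ 2 * Real.sqrt T := by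
  have h1 := Real.log_le_sub_one_of_pos (Real.sqrt_pos.mpr hT)
  rw [Real.log_sqrt hT.le] at h1; linarith

lemma Sy_S0 : ∃ C, 0 < C ∧ ∀ (T d : ℝ) (F : Finset NZ), 2 ≤ T → (∀ ρ : NZ, ρ ∈ F ↔ T / 2 < ρ.1.im ∧ ρ.1.im ≤ 4 * T) →
    (∀ ρ ∈ F, |ρ.1.re - 1 / 2| ≤ d) → 0 ≤ d → d ≤ 1 → d * Real.log T ≤ 1 → ∀ y ∈ Icc 0 (Real.log T), ∀ t ∈ Icc T (2 * T),
    ‖Sy y t - S0 F y t‖ ≤ C := by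
  obtain ⟨C1, hC1, h1⟩ := Cr_far
  obtain ⟨C2, hC2, h2⟩ := Cr_near
  refine ⟨4 * C2 * 12 + 5 * C1 * 32, by positivity, fun T d F hT hF hFd hd0 hd1 hdl y hy t ht => ?_⟩
  have ht2 : 2 ≤ t := hT.trans ht.1
  have hT0 : 0 < T := by linarith
  have hsum := (explicit hy.1 ht2).summable.hasSum
  classical
  set f : NZ → ℂ := fun ρ => if ρ ∈ F then ((mu ρ * Real.cosh ((ρ.1.re - 1 / 2) * y) * phi (t - ρ.1.im) : ℝ) : ℂ) * ee (y * (t - ρ.1.im)) else 0 with hf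
  have hS0 : HasSum f (S0 F y t) := by
    have := hasSum_sum_of_ne_finset_zero (f := f) (s := F) (L := .unconditional NZ) (fun ρ hρ => by simp [hf, hρ])
    convert! this using 1
    rw [S0]
    exact Finset.sum_congr rfl fun ρ hρ => by simp [hf, hρ]
  have hd := hsum.sub hS0
  rw [show Sy y t - S0 F y t = ∑' ρ : NZ, ((mu ρ : ℂ) * Cr ρ y t - f ρ) from hd.tsum_eq.symm]
  obtain ⟨z1, z2⟩ := zero_sum (K := 2) (t := t) le_rfl
  obtain ⟨w1, w2⟩ := zero_sum (K := T) (t := t) hT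
  have hG := ((z1.hasSum.mul_left (4 * C2 * d)).add (w1.hasSum.mul_left (5 * C1 * Real.exp (y / 2))))
  refine (tsum_of_norm_bounded hG fun ρ => ?_).trans ?_
  · have hm := mu_pos ρ
    have a1 : 0 ≤ 4 * C2 * d * (mu ρ / (2 ^ 2 + (t - ρ.1.im) ^ 2)) := by positivity
    have a2 : 0 ≤ 5 * C1 * Real.exp (y / 2) * (mu ρ / (T ^ 2 + (t - ρ.1.im) ^ 2)) := by positivity
    by_cases hρ : ρ ∈ F
    · have hn := h2 ρ y t d hy.1 (hFd ρ hρ) (by nlinarith [hy.2, hy.1])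
      have e1 : (mu ρ : ℂ) * Cr ρ y t - f ρ = (mu ρ : ℂ) * (Cr ρ y t - ((Real.cosh ((ρ.1.re - 1 / 2) * y) * phi (t - ρ.1.im) : ℝ) : ℂ) * ee (y * (t - ρ.1.im))) := by
        simp only [hf, if_pos hρ]; push_cast; ring
      rw [e1, norm_mul, Complex.norm_real, Real.norm_eq_abs, abs_of_pos hm]
      have b1 : C2 * d / (1 + (t - ρ.1.im) ^ 2) ≤ 4 * C2 * d / (2 ^ 2 + (t - ρ.1.im) ^ 2) := by
        rw [div_le_div_iff₀ (by positivity) (by positivity)]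
        have : 0 ≤ C2 * d * (t - ρ.1.im) ^ 2 := by positivity
        nlinarith
      have b2 := mul_le_mul_of_nonneg_left (hn.trans b1) hm.le
      refine b2.trans ?_
      rw [show mu ρ * (4 * C2 * d / (2 ^ 2 + (t - ρ.1.im) ^ 2)) = 4 * C2 * d * (mu ρ / (2 ^ 2 + (t - ρ.1.im) ^ 2)) by ring]
      linarith
    · have hn := h1 ρ y t hy.1
      simp only [hf, if_neg hρ, sub_zero]
      rw [norm_mul, Complex.norm_real, Real.norm_eq_abs, abs_of_pos hm]
      have hx : T ^ 2 / 4 ≤ (t - ρ.1.im) ^ 2 := by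
        rw [hF] at hρ
        by_cases h' : T / 2 < ρ.1.im
        · have : 4 * T < ρ.1.im := by by_contra hc; exact hρ ⟨h', not_lt.mp hc⟩
          nlinarith [ht.2]
        · nlinarith [ht.1]
      have b1 : C1 * Real.exp (y / 2) / (1 + (t - ρ.1.im) ^ 2) ≤ 5 * C1 * Real.exp (y / 2) / (T ^ 2 + (t - ρ.1.im) ^ 2) := by
        rw [div_le_div_iff₀ (by positivity) (by positivity)]
        have : 0 < C1 * Real.exp (y / 2) := by positivity
        nlinarith
      have b2 := mul_le_mul_of_nonneg_left (hn.trans b1) hm.le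
      refine b2.trans ?_
      rw [show mu ρ * (5 * C1 * Real.exp (y / 2) / (T ^ 2 + (t - ρ.1.im) ^ 2)) = 5 * C1 * Real.exp (y / 2) * (mu ρ / (T ^ 2 + (t - ρ.1.im) ^ 2)) by ring]
      linarith
  · have hta : |t| = t := abs_of_pos (by linarith)
    rw [hta] at z2 w2
    have hs := log_le_two_sqrt hT0
    have hs1 : 1 ≤ Real.sqrt T := Real.one_le_sqrt.mpr (by linarith)
    have l4 : Real.log 4 ≤ 2 := by
      rw [show (4 : ℝ) = 2 ^ 2 by norm_num, Real.log_pow]; have := Real.log_two_lt_d9; norm_num; linarith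
    have hlT : ∀ z, 0 < z → z ≤ 4 * T → Real.log z ≤ 2 + Real.log T := by
      intro z hz hz4
      have := Real.log_le_log hz hz4
      rw [Real.log_mul (by norm_num) hT0.ne'] at this; linarith
    have q1 : d * ∑' ρ : NZ, mu ρ / (2 ^ 2 + (t - ρ.1.im) ^ 2) ≤ 12 := by
      have := hlT (2 + t) (by linarith) (by linarith [ht.2])
      calc _ ≤ d * (8 * (2 + Real.log T) / 2) := mul_le_mul_of_nonneg_left (z2.trans (by gcongr)) hd0
        _ ≤ _ := by nlinarith
    have q2 : Real.exp (y / 2) * ∑' ρ : NZ, mu ρ / (T ^ 2 + (t - ρ.1.im) ^ 2) ≤ 32 := by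
      have hl := hlT (T + t) (by linarith) (by linarith [ht.2])
      have he : Real.exp (y / 2) ≤ Real.sqrt T := by
        rw [Real.sqrt_eq_rpow, Real.rpow_def_of_pos hT0]
        exact Real.exp_le_exp.mpr (by linarith [hy.2])
      have hw : ∑' ρ : NZ, mu ρ / (T ^ 2 + (t - ρ.1.im) ^ 2) ≤ 8 * (4 * Real.sqrt T) / T := w2.trans (by gcongr; linarith)
      have hn : 0 ≤ ∑' ρ : NZ, mu ρ / (T ^ 2 + (t - ρ.1.im) ^ 2) := tsum_nonneg fun ρ => by have := mu_pos ρ; positivity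
      calc _ ≤ Real.sqrt T * (8 * (4 * Real.sqrt T) / T) := mul_le_mul he hw hn (Real.sqrt_nonneg _)
        _ = 32 * (Real.sqrt T * Real.sqrt T) / T := by ring
        _ = 32 := by rw [Real.mul_self_sqrt hT0.le]; field_simp
    nlinarith

def Good (T d : ℝ) (F : Finset NZ) : Prop := Real.exp 2 ≤ T ∧ (∀ ρ : NZ, ρ ∈ F ↔ T / 2 < ρ.1.im ∧ ρ.1.im ≤ 4 * T) ∧
    (∀ ρ ∈ F, |ρ.1.re - 1 / 2| ≤ d) ∧ 0 ≤ d ∧ d ≤ 1 ∧ d * Real.log T ≤ 1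

lemma Good.two {T d : ℝ} {F : Finset NZ} (h : Good T d F) : 2 ≤ T ∧ 2 ≤ Real.log T := by
  have h1 := Real.add_one_le_exp 2
  have h2 := h.1
  refine ⟨by linarith, (Real.le_log_iff_exp_le (by linarith)).mpr h2⟩

lemma S0_ii (F : Finset NZ) (y a b : ℝ) : IntervalIntegrable (fun t => ‖S0 F y t‖ ^ 2) volume a b := by
  have h := (S0_cont F).comp (Continuous.prodMk_right y)
  exact (h.norm.pow 2).intervalIntegrable _ _

lemma S0_icont (F : Finset NZ) (a b : ℝ) : Continuous fun y => ∫ t in a..b, ‖S0 F y t‖ ^ 2 := by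
  refine intervalIntegral.continuous_parametric_intervalIntegral_of_continuous' ?_ a b
  exact ((S0_cont F).norm.pow 2)

lemma S0_near : ∃ C, 0 < C ∧ ∀ T d F, Good T d F → ∀ y ∈ Icc (0 : ℝ) 2, ∀ t ∈ Icc T (2 * T),
    ‖S0 F y t - ((Real.log T * eta y : ℝ) : ℂ)‖ ≤ C := by
  obtain ⟨C1, hC1, h1⟩ := Sy_S0
  obtain ⟨C2, hC2, h2⟩ := Sy_small
  obtain ⟨C3, hC3, h3⟩ := eta_bdd
  refine ⟨C1 + C2 + C3, by positivity, fun T d F hG y hy t ht => ?_⟩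
  obtain ⟨g1, g2⟩ := hG.two
  have k1 := h1 T d F g1 hG.2.1 hG.2.2.1 hG.2.2.2.1 hG.2.2.2.2.1 hG.2.2.2.2.2 y ⟨hy.1, hy.2.trans g2⟩ t ht
  have k2 := h2 y hy t (g1.trans ht.1)
  have k3 : ‖((Real.log t * eta y : ℝ) : ℂ) - ((Real.log T * eta y : ℝ) : ℂ)‖ ≤ C3 := by
    rw [← Complex.ofReal_sub, Complex.norm_real, Real.norm_eq_abs, ← sub_mul, abs_mul]
    have a1 : Real.log T ≤ Real.log t := Real.log_le_log (by linarith) ht.1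
    have a2 : Real.log t ≤ Real.log 2 + Real.log T := by
      rw [← Real.log_mul (by norm_num) (by linarith)]
      exact Real.log_le_log (by linarith [ht.1]) ht.2
    have : |Real.log t - Real.log T| ≤ 1 := by
      rw [abs_of_nonneg (by linarith)]; linarith [Real.log_two_lt_d9]
    calc _ ≤ 1 * C3 := mul_le_mul this (h3 y).1 (abs_nonneg _) zero_le_one
      _ = _ := one_mul _
  have e : S0 F y t - ((Real.log T * eta y : ℝ) : ℂ) = -(Sy y t - S0 F y t) + (Sy y t - ((Real.log t * eta y : ℝ) : ℂ)) +
    (((Real.log t * eta y : ℝ) : ℂ) - ((Real.log T * eta y : ℝ) : ℂ)) := by ring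
  rw [e]
  refine (norm_add₃_le).trans ?_
  rw [norm_neg]; linarith

lemma up_small : ∃ C, 0 < C ∧ ∀ T d F, Good T d F → ∀ y ∈ Icc (0 : ℝ) 2,
    ∫ t in T..(2 * T), ‖S0 F y t‖ ^ 2 ≤ T * (Real.log T ^ 2 * eta y ^ 2 + C * Real.log T) := by
  obtain ⟨C1, hC1, h1⟩ := S0_near
  obtain ⟨C3, hC3, h3⟩ := eta_bdd
  refine ⟨2 * C1 * C3 + C1 ^ 2, by positivity, fun T d F hG y hy => ?_⟩
  obtain ⟨g1, g2⟩ := hG.two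
  have hT : T ≤ 2 * T := by linarith
  have : ∀ t ∈ Icc T (2 * T), ‖S0 F y t‖ ^ 2 ≤ Real.log T ^ 2 * eta y ^ 2 + (2 * C1 * C3 + C1 ^ 2) * Real.log T := by
    intro t ht
    have k := h1 T d F hG y hy t ht
    have k2 : ‖S0 F y t‖ ≤ Real.log T * |eta y| + C1 := by
      have := norm_le_norm_add_norm_sub' (S0 F y t) ((Real.log T * eta y : ℝ) : ℂ)
      rw [Complex.norm_real, Real.norm_eq_abs, abs_mul, abs_of_nonneg (by linarith : 0 ≤ Real.log T)] at this
      linarith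
    have k3 := (h3 y).1
    have k4 := abs_nonneg (eta y)
    calc ‖S0 F y t‖ ^ 2 ≤ (Real.log T * |eta y| + C1) ^ 2 := by gcongr
      _ = Real.log T ^ 2 * eta y ^ 2 + 2 * C1 * |eta y| * Real.log T + C1 ^ 2 := by rw [← sq_abs (eta y)]; ring
      _ ≤ _ := by
        have a1 : 2 * C1 * |eta y| * Real.log T ≤ 2 * C1 * C3 * Real.log T := by gcongr
        have a2 : C1 ^ 2 ≤ C1 ^ 2 * Real.log T := le_mul_of_one_le_right (by positivity) (by linarith)
        linarith
  have := intervalIntegral.integral_mono_on hT (S0_ii F y _ _) (intervalIntegrable_const) this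
  rw [intervalIntegral.integral_const, smul_eq_mul] at this
  refine this.trans_eq (by ring)

lemma up_large : ∃ C, 0 < C ∧ ∀ e, 0 < e → ∀ T d F, Good T d F → ∀ y ∈ Icc (2 : ℝ) (Real.log T), ∀ N : ℕ, Real.exp (y + 1) ≤ N →
    ∫ t in T..(2 * T), ‖S0 F y t‖ ^ 2 ≤ (1 + e) * (T + 4 * N * (1 + Real.log N)) * ∑ n ∈ Finset.range N, an y n ^ 2 + (1 + 1 / e) * C * T := by
  obtain ⟨C1, hC1, h1⟩ := Sy_S0
  obtain ⟨C2, hC2, h2⟩ := Sy_large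
  refine ⟨(C1 + C2) ^ 2, by positivity, fun e he T d F hG y hy N hN => ?_⟩
  obtain ⟨g1, g2⟩ := hG.two
  have hT : T ≤ 2 * T := by linarith
  have hT0 : 0 < T := by linarith
  have hy0 : 0 ≤ y := by linarith [hy.1]
  have hpt : ∀ t ∈ Icc T (2 * T), ‖S0 F y t‖ ^ 2 ≤ (1 + e) * ‖∑ n ∈ Finset.range N, (an y n : ℂ) * ee (t * Real.log n)‖ ^ 2 + (1 + 1 / e) * (C1 + C2) ^ 2 := by
    intro t ht
    have k1 := h1 T d F g1 hG.2.1 hG.2.2.1 hG.2.2.2.1 hG.2.2.2.2.1 hG.2.2.2.2.2 y ⟨hy0, hy.2⟩ t ht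
    have k2 := h2 y hy.1 t (g1.trans ht.1) N hN
    have k3 : C2 * Real.exp (1 / 2 * y) / t ≤ C2 := by
      rw [div_le_iff₀ (by linarith [ht.1])]
      refine mul_le_mul_of_nonneg_left ?_ hC2.le
      calc Real.exp (1 / 2 * y) ≤ Real.exp (Real.log T) := Real.exp_le_exp.mpr (by linarith [hy.2])
        _ = T := Real.exp_log hT0
        _ ≤ t := ht.1
    set D := ∑ n ∈ Finset.range N, (an y n : ℂ) * ee (t * Real.log n)
    have k4 : ‖S0 F y t‖ ≤ ‖D‖ + (C1 + C2) := by
      have e1 : S0 F y t = -(Sy y t - S0 F y t) + (Sy y t + D) + (-D) := by ring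
      rw [e1]
      refine (norm_add₃_le).trans ?_
      rw [norm_neg, norm_neg]; linarith
    have k5 : ‖S0 F y t‖ ^ 2 ≤ (‖D‖ + (C1 + C2)) ^ 2 := by gcongr
    refine k5.trans ?_
    have k6 : 0 ≤ (e * ‖D‖ - (C1 + C2)) ^ 2 / e := by positivity
    have k7 : (e * ‖D‖ - (C1 + C2)) ^ 2 / e = e * ‖D‖ ^ 2 - 2 * ‖D‖ * (C1 + C2) + 1 / e * (C1 + C2) ^ 2 := by field_simp; ring
    nlinarith
  have hDc : Continuous fun t : ℝ => ∑ n ∈ Finset.range N, (an y n : ℂ) * ee (t * Real.log n) := by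
    have := ee_cont; fun_prop
  have := intervalIntegral.integral_mono_on hT (S0_ii F y _ _) ((by fun_prop : Continuous _).intervalIntegrable _ _) hpt
  refine this.trans ?_
  rw [intervalIntegral.integral_add ((by fun_prop : Continuous _).intervalIntegrable _ _) intervalIntegrable_const,
    intervalIntegral.integral_const_mul, intervalIntegral.integral_const, smul_eq_mul]
  have hmv := mean_value (an y) (by simp [an]) (N := N) hT0.le
  have := mul_le_mul_of_nonneg_left hmv (by positivity : 0 ≤ 1 + e)
  refine (add_le_add_left this _).trans_eq (by ring)

lemma eta_half : ∫ y in (0)..2, eta y ^ 2 ≤ E2 / 2 := by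
  have hec := eta_cont
  have e2i : Integrable (fun u => eta u ^ 2) := by
    refine Continuous.integrable_of_hasCompactSupport (by fun_prop) ?_
    simp only [pow_two]
    exact eta_csupp.mul_right (f' := eta)
  have h1 : E2 = 2 * ∫ y in Ioi (0 : ℝ), eta y ^ 2 := by
    rw [← integral_comp_abs (f := fun y => eta y ^ 2), E2]
    refine integral_congr_ae (Eventually.of_forall fun y => ?_)
    simp only
    rcases abs_choice y with h | h <;> rw [h]
    rw [eta_even]
  rw [intervalIntegral.integral_of_le (by norm_num)]
  have : ∫ y in Ioc (0 : ℝ) 2, eta y ^ 2 ≤ ∫ y in Ioi (0 : ℝ), eta y ^ 2 :=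
    setIntegral_mono_set e2i.integrableOn (Eventually.of_forall fun _ => sq_nonneg _) (Eventually.of_forall Ioc_subset_Ioi_self)
  linarith

lemma exists_N {e L : ℝ} (he : 0 < e) (he1 : e ≤ 1 / 2) (hL3 : 3 ≤ L) (hL : 16 * Real.exp 2 / e ^ 3 ≤ L) :
    ∃ N : ℕ, Real.exp ((1 - e) * L + 1) ≤ N ∧ 4 * N * (1 + Real.log N) ≤ e * Real.exp L := by
  refine ⟨⌈Real.exp ((1 - e) * L + 1)⌉₊, Nat.le_ceil _, ?_⟩
  set N := ⌈Real.exp ((1 - e) * L + 1)⌉₊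
  have hpos : 0 ≤ (1 - e) * L := mul_nonneg (by linarith) (by linarith)
  have h1 : (N : ℝ) ≤ Real.exp ((1 - e) * L + 2) := by
    have a := (Nat.ceil_lt_add_one (Real.exp_pos ((1 - e) * L + 1)).le).le
    have b : Real.exp ((1 - e) * L + 2) = Real.exp ((1 - e) * L + 1) * Real.exp 1 := by rw [← Real.exp_add]; ring_nf
    have c : 1 ≤ Real.exp ((1 - e) * L + 1) := Real.one_le_exp (by linarith)
    have d := Real.add_one_le_exp 1
    rw [b]
    calc (N : ℝ) ≤ _ := a
      _ ≤ Real.exp ((1 - e) * L + 1) * 2 := by linarith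
      _ ≤ _ := by gcongr; linarith
  have hN0 : (0 : ℝ) < N := (Real.exp_pos _).trans_le (Nat.le_ceil _)
  have h2 : Real.log N ≤ (1 - e) * L + 2 := (Real.log_le_iff_le_exp hN0).mpr h1
  have h3 : 1 + Real.log N ≤ 2 * L := by nlinarith
  have hlog : 0 ≤ Real.log N := Real.log_natCast_nonneg N
  have hq := Real.quadratic_le_exp_of_nonneg (x := e * L) (by positivity)
  have h4 : (e * L) ^ 2 / 2 ≤ Real.exp (e * L) := by nlinarith [mul_pos he (by linarith : 0 < L)]
  have h5 : Real.exp L = Real.exp ((1 - e) * L) * Real.exp (e * L) := by rw [← Real.exp_add]; ring_nf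
  have h6 : Real.exp ((1 - e) * L + 2) = Real.exp ((1 - e) * L) * Real.exp 2 := Real.exp_add _ _
  rw [div_le_iff₀ (by positivity)] at hL
  have h7 : 4 * Real.exp 2 * (2 * L) ≤ e * ((e * L) ^ 2 / 2) := by nlinarith
  calc 4 * N * (1 + Real.log N) ≤ 4 * Real.exp ((1 - e) * L + 2) * (2 * L) := by gcongr
    _ = Real.exp ((1 - e) * L) * (4 * Real.exp 2 * (2 * L)) := by rw [h6]; ring
    _ ≤ Real.exp ((1 - e) * L) * (e * Real.exp (e * L)) := mul_le_mul_of_nonneg_left (h7.trans (mul_le_mul_of_nonneg_left h4 he.le)) (Real.exp_pos _).le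
    _ = _ := by rw [h5]; ring

lemma upper {e : ℝ} (he : 0 < e) (he1 : e ≤ 1 / 2) : ∃ T0, ∀ T ≥ T0, ∀ d F, Good T d F →
    ∫ y in (0)..((1 - e) * Real.log T), gg e (y / ((1 - e) * Real.log T)) * ∫ t in T..(2 * T), ‖S0 F y t‖ ^ 2 ≤
      T * Real.log T ^ 2 * E2 * ((1 + e) / 2 + (1 + e) ^ 2 * (1 / 6 + e / 12) + e) := by
  obtain ⟨C1, hC1, h1⟩ := up_small
  obtain ⟨C2, hC2, h2⟩ := up_large
  obtain ⟨C3, hC3, h3⟩ := prime_sum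
  have hE := E2_pos
  set K := (1 + e) * (2 * C1) + (1 + e) ^ 2 * E2 * C3 + (1 + 1 / e) * C2 * (1 + e) with hK
  have hK0 : 0 < K := by positivity
  refine ⟨Real.exp (max 4 (max (16 * Real.exp 2 / e ^ 3) (K / (e * E2)))), fun T hT d F hG => ?_⟩
  obtain ⟨g1, g2⟩ := hG.two
  have hT0 : 0 < T := by linarith
  have hlog := (Real.le_log_iff_exp_le hT0).mpr hT
  obtain ⟨hL4, hL'⟩ := max_le_iff.mp hlog
  obtain ⟨hL5, hL6⟩ := max_le_iff.mp hL'
  set L := Real.log T with hLd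
  have hexpL : Real.exp L = T := Real.exp_log hT0
  set Y := (1 - e) * L with hYd
  have hY2 : 2 ≤ Y := by nlinarith
  have hYL : Y ≤ L := by nlinarith
  have hY0 : 0 < Y := by linarith
  obtain ⟨N, hN1, hN2⟩ := exists_N he he1 (by linarith) hL5
  rw [hexpL] at hN2
  have hgc := gg_cont e
  have hsc := S0_icont F T (2 * T)
  have hec := eta_cont
  have hlc : ∀ n : ℕ, Continuous fun y => an y n := fun n => by unfold an; fun_prop
  have hii : ∀ a b, IntervalIntegrable (fun y => gg e (y / Y) * ∫ t in T..(2 * T), ‖S0 F y t‖ ^ 2) volume a b :=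
    fun a b => (by fun_prop : Continuous _).intervalIntegrable _ _
  rw [← intervalIntegral.integral_add_adjacent_intervals (hii 0 2) (hii 2 Y)]
  have hg1 : ∀ y, 0 ≤ y → y ≤ Y → gg e (y / Y) ≤ 1 + e := by
    intro y hy hy'
    have := gg_anti he.le ((div_le_one hY0).mpr hy') (div_nonneg hy hY0.le)
    refine this.trans_eq (by simp [gg])
  have A1 : ∫ y in (0)..2, gg e (y / Y) * ∫ t in T..(2 * T), ‖S0 F y t‖ ^ 2 ≤ (1 + e) * T * (L ^ 2 * (E2 / 2) + C1 * L * 2) := by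
    have : ∀ y ∈ Icc (0 : ℝ) 2, gg e (y / Y) * ∫ t in T..(2 * T), ‖S0 F y t‖ ^ 2 ≤ (1 + e) * T * (L ^ 2 * eta y ^ 2 + C1 * L) := by
      intro y hy
      have a := h1 T d F hG y hy
      calc _ ≤ (1 + e) * (T * (L ^ 2 * eta y ^ 2 + C1 * L)) :=
            mul_le_mul (hg1 y hy.1 (hy.2.trans hY2)) a (intervalIntegral.integral_nonneg (by linarith) fun _ _ => sq_nonneg _) (by positivity)
        _ = _ := by ring
    refine (intervalIntegral.integral_mono_on (by norm_num) (hii 0 2) ((by fun_prop : Continuous _).intervalIntegrable _ _) this).trans ?_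
    rw [intervalIntegral.integral_const_mul, intervalIntegral.integral_add ((by fun_prop : Continuous _).intervalIntegrable _ _) intervalIntegrable_const,
      intervalIntegral.integral_const_mul, intervalIntegral.integral_const, smul_eq_mul]
    have := eta_half
    refine mul_le_mul_of_nonneg_left ?_ (by positivity)
    have := mul_le_mul_of_nonneg_left this (sq_nonneg L)
    linarith
  have A2 : ∫ y in (2)..Y, gg e (y / Y) * ∫ t in T..(2 * T), ‖S0 F y t‖ ^ 2 ≤
      (1 + e) * ((1 + e) * T) * (E2 * (Y ^ 2 * (1 / 6 + e / 12) + C3 * Y)) + (1 + e) * ((1 + 1 / e) * C2 * T) * Y := by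
    have : ∀ y ∈ Icc (2 : ℝ) Y, gg e (y / Y) * ∫ t in T..(2 * T), ‖S0 F y t‖ ^ 2 ≤
        (1 + e) * ((1 + e) * T) * (gg e (y / Y) * ∑ n ∈ Finset.range N, an y n ^ 2) + (1 + e) * ((1 + 1 / e) * C2 * T) := by
      intro y hy
      have a := h2 e he T d F hG y ⟨hy.1, hy.2.trans hYL⟩ N (le_trans (Real.exp_le_exp.mpr (by linarith [hy.2])) hN1)
      have hgn := gg_nonneg he.le ((div_le_one hY0).mpr hy.2)
      have hgl := hg1 y (by linarith [hy.1]) hy.2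
      have hs : 0 ≤ ∑ n ∈ Finset.range N, an y n ^ 2 := Finset.sum_nonneg fun _ _ => sq_nonneg _
      have b : (1 + e) * (T + 4 * N * (1 + Real.log N)) * ∑ n ∈ Finset.range N, an y n ^ 2 ≤ (1 + e) * ((1 + e) * T) * ∑ n ∈ Finset.range N, an y n ^ 2 := by
        gcongr; linarith
      have c : gg e (y / Y) * ((1 + 1 / e) * C2 * T) ≤ (1 + e) * ((1 + 1 / e) * C2 * T) := mul_le_mul_of_nonneg_right hgl (by positivity)
      calc _ ≤ gg e (y / Y) * ((1 + e) * ((1 + e) * T) * ∑ n ∈ Finset.range N, an y n ^ 2 + (1 + 1 / e) * C2 * T) :=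
            mul_le_mul_of_nonneg_left (a.trans (by linarith)) hgn
        _ ≤ _ := by linarith
    refine (intervalIntegral.integral_mono_on hY2 (hii 2 Y) ((by fun_prop : Continuous _).intervalIntegrable _ _) this).trans ?_
    rw [intervalIntegral.integral_add ((by fun_prop : Continuous _).intervalIntegrable _ _) intervalIntegrable_const,
      intervalIntegral.integral_const_mul, intervalIntegral.integral_const, smul_eq_mul]
    have q := h3 e ⟨he.le, by linarith⟩ Y hY2 N
    have q' := mul_le_mul_of_nonneg_left q (by positivity : 0 ≤ (1 + e) * ((1 + e) * T))
    have : (Y - 2) * ((1 + e) * ((1 + 1 / e) * C2 * T)) ≤ (1 + e) * ((1 + 1 / e) * C2 * T) * Y := by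
      rw [mul_comm]; exact mul_le_mul_of_nonneg_left (by linarith) (by positivity)
    linarith
  have hKL : K ≤ e * E2 * L := by
    have := (div_le_iff₀ (by positivity)).mp hL6; linarith
  have hY2L : Y ^ 2 ≤ L ^ 2 := by gcongr
  have hL0 : 0 < L := by linarith
  calc _ ≤ _ := add_le_add A1 A2
    _ ≤ (1 + e) * T * (L ^ 2 * (E2 / 2) + C1 * L * 2) + ((1 + e) * ((1 + e) * T) * (E2 * (L ^ 2 * (1 / 6 + e / 12) + C3 * L)) + (1 + e) * ((1 + 1 / e) * C2 * T) * L) := by gcongr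
    _ = T * L ^ 2 * E2 * ((1 + e) / 2 + (1 + e) ^ 2 * (1 / 6 + e / 12)) + T * L * K := by rw [hK]; ring
    _ ≤ T * L ^ 2 * E2 * ((1 + e) / 2 + (1 + e) ^ 2 * (1 / 6 + e / 12)) + T * L * (e * E2 * L) := by gcongr
    _ = _ := by ring

lemma mu_one_le (ρ : NZ) : 1 ≤ mu ρ := by
  have h := mu_pos ρ
  unfold mu at *
  exact_mod_cast h

open Classical in
lemma pairs_lower (G : Finset NZ) (hG : ∀ ρ ∈ G, symE ρ ∈ G) :
    2 * ∑ ρ ∈ G, mu ρ - ∑ ρ ∈ G with ρ.1.re = 1 / 2, mu ρ ≤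
      ∑ ρ ∈ G, ∑ ρ' ∈ G, (if ρ.1.im = ρ'.1.im then mu ρ * mu ρ' else 0) := by
  rw [Finset.mul_sum, Finset.sum_filter, ← Finset.sum_sub_distrib]
  refine Finset.sum_le_sum fun ρ hρ => ?_
  have hnn : ∀ ρ' ∈ G, 0 ≤ (if ρ.1.im = ρ'.1.im then mu ρ * mu ρ' else 0) := by
    intro ρ' _
    split_ifs
    · exact mul_nonneg (mu_pos _).le (mu_pos _).le
    · exact le_rfl
  have h1 := mu_one_le ρ
  by_cases h : ρ.1.re = 1 / 2
  · have := Finset.single_le_sum hnn hρ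
    rw [if_pos rfl] at this
    rw [if_pos h]
    nlinarith
  · have hne : ρ ≠ symE ρ := by
      intro h'
      have := symE_re ρ
      rw [← h'] at this
      exact h (by linarith)
    have hsub : ({ρ, symE ρ} : Finset NZ) ⊆ G := by
      intro x hx
      simp only [Finset.mem_insert, Finset.mem_singleton] at hx
      rcases hx with rfl | rfl
      · exact hρ
      · exact hG _ hρ
    have := Finset.sum_le_sum_of_subset_of_nonneg hsub (fun i hi _ => hnn i hi)
    rw [Finset.sum_pair hne, if_pos rfl, if_pos (symE_im ρ).symm, symE_mu] at this
    rw [if_neg h]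
    nlinarith

lemma phi_sq_int : Integrable fun x => phi x ^ 2 := by
  by_contra h
  have h1 := phi_sq_integral
  rw [integral_undef h] at h1
  have := E2_pos
  have := Real.pi_pos
  have : 0 < 2 * Real.pi * E2 := by positivity
  linarith

lemma phi_sq_trunc {e : ℝ} (he : 0 < e) : ∃ A0, ∀ A ≥ A0, ∀ T γ, T + A ≤ γ → γ ≤ 2 * T - A →
    (1 - e) * (2 * Real.pi * E2) ≤ ∫ t in T..(2 * T), phi (t - γ) ^ 2 := by
  have h := intervalIntegral_tendsto_integral phi_sq_int tendsto_neg_atTop_atBot tendsto_id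
  rw [phi_sq_integral] at h
  have hp : 0 < 2 * Real.pi * E2 := by have := E2_pos; positivity
  obtain ⟨A0, hA0⟩ := eventually_atTop.mp (h.eventually (lt_mem_nhds (by nlinarith : (1 - e) * (2 * Real.pi * E2) < 2 * Real.pi * E2)))
  refine ⟨max A0 0, fun A hA T γ h1 h2 => ?_⟩
  have h3 := hA0 A ((le_max_left _ _).trans hA)
  have h4 : 0 ≤ A := (le_max_right _ _).trans hA
  simp only [id] at h3
  refine h3.le.trans ?_
  rw [intervalIntegral.integral_comp_sub_right (fun x => phi x ^ 2)]
  refine intervalIntegral.integral_mono_interval (by linarith) (by linarith) (by linarith)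
    (Eventually.of_forall fun x => sq_nonneg _) ((phi_cont.pow 2).intervalIntegrable _ _)

lemma edge_sum {A t : ℝ} (hA : 2 ≤ A) (G : Finset NZ) (hG : ∀ ρ ∈ G, |t - ρ.1.im| ≤ A) :
    ∑ ρ ∈ G, mu ρ ≤ 16 * A * Real.log (A + |t|) := by
  obtain ⟨hs, hb⟩ := zero_sum (K := A) (t := t) hA
  have hA0 : 0 < A := by linarith
  have h1 : ∑ ρ ∈ G, mu ρ / (2 * A ^ 2) ≤ 8 * Real.log (A + |t|) / A := by
    refine le_trans (Finset.sum_le_sum fun ρ hρ => ?_)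
      ((hs.sum_le_tsum G fun ρ _ => div_nonneg (mu_pos ρ).le (by positivity)).trans hb)
    have := sq_le_sq.mpr ((hG ρ hρ).trans (le_abs_self A))
    exact div_le_div_of_nonneg_left (mu_pos ρ).le (by positivity) (by linarith)
  rw [← Finset.sum_div, div_le_iff₀ (by positivity)] at h1
  refine h1.trans_eq ?_
  field_simp
  ring

lemma far_sum : ∃ C, 0 < C ∧ ∀ A ≥ 2, ∀ t, ∀ G : Finset NZ, (∀ ρ ∈ G, A ≤ |t - ρ.1.im|) →
    ∑ ρ ∈ G, mu ρ * phi (t - ρ.1.im) ≤ C * Real.log (A + |t|) / A := by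
  obtain ⟨C, hC, h⟩ := phi_bound
  refine ⟨16 * C, by positivity, fun A hA t G hG => ?_⟩
  obtain ⟨hs, hb⟩ := zero_sum (K := A) (t := t) hA
  have hA0 : 0 < A := by linarith
  have h1 : ∑ ρ ∈ G, mu ρ * phi (t - ρ.1.im) ≤ 2 * C * ∑ ρ ∈ G, mu ρ / (A ^ 2 + (t - ρ.1.im) ^ 2) := by
    rw [Finset.mul_sum]
    refine Finset.sum_le_sum fun ρ hρ => ?_
    have h2 := hG ρ hρ
    have h3 : A ^ 2 ≤ (t - ρ.1.im) ^ 2 := sq_le_sq.mpr (by rwa [abs_of_pos hA0])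
    have h4 : phi (t - ρ.1.im) ≤ 2 * C / (A ^ 2 + (t - ρ.1.im) ^ 2) := by
      refine (h _).trans ?_
      rw [div_le_div_iff₀ (by positivity) (by positivity)]
      nlinarith
    calc _ ≤ mu ρ * (2 * C / (A ^ 2 + (t - ρ.1.im) ^ 2)) := mul_le_mul_of_nonneg_left h4 (mu_pos ρ).le
      _ = _ := by ring
  have h2 := (hs.sum_le_tsum G fun ρ _ => div_nonneg (mu_pos ρ).le (by positivity)).trans hb
  calc _ ≤ 2 * C * (8 * Real.log (A + |t|) / A) := h1.trans (mul_le_mul_of_nonneg_left h2 (by positivity))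
    _ = _ := by ring

lemma S0_zero (F : Finset NZ) (t : ℝ) : S0 F 0 t = ((∑ ρ ∈ F, mu ρ * phi (t - ρ.1.im) : ℝ) : ℂ) := by
  unfold S0
  simp [ee_zero]

open Classical in
lemma N_lower {e : ℝ} (he : 0 < e) (he1 : e ≤ 1 / 2) : ∃ T0, ∀ T ≥ T0, ∀ d F, Good T d F →
    (1 - e) * (T * Real.log T) ≤ 2 * Real.pi * ∑ ρ ∈ F with T < ρ.1.im ∧ ρ.1.im ≤ 2 * T, mu ρ := by
  obtain ⟨C, hC, h1⟩ := S0_near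
  obtain ⟨C1, hC1, h2⟩ := far_sum
  have h0 := eta_zero_pos
  set A := max 2 (8 * C1 / (e * eta 0)) with hA
  have hA2 : 2 ≤ A := le_max_left _ _
  have hA0 : 0 < A := by linarith
  have hAC : 8 * C1 / A ≤ e * eta 0 := by
    have : 8 * C1 / (e * eta 0) ≤ A := le_max_right _ _
    rw [div_le_iff₀ (by positivity)] at this ⊢
    linarith
  refine ⟨max (max 3 (4 * A / e)) (Real.exp (4 * C / (e * eta 0))), fun T hT d F hG => ?_⟩
  have hT3 : 3 ≤ T := (le_max_left _ _).trans ((le_max_left _ _).trans hT)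
  have hTA : 4 * A / e ≤ T := (le_max_right _ _).trans ((le_max_left _ _).trans hT)
  have hTC : Real.exp (4 * C / (e * eta 0)) ≤ T := (le_max_right _ _).trans hT
  rw [div_le_iff₀ he] at hTA
  rw [← Real.le_log_iff_exp_le (by linarith), div_le_iff₀ (by positivity)] at hTC
  obtain ⟨g1, g2⟩ := hG.two
  set L := Real.log T with hL
  set G := F.filter (fun ρ : NZ => T < ρ.1.im ∧ ρ.1.im ≤ 2 * T) with hGd
  have hAT : A ≤ T := by nlinarith
  have low : ∀ t ∈ Icc (T + A) (2 * T - A), (1 - e / 2) * eta 0 * L ≤ ∑ ρ ∈ G, mu ρ * phi (t - ρ.1.im) := by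
    intro t ht
    have k1 := h1 T d F hG 0 ⟨le_rfl, by norm_num⟩ t ⟨by linarith [ht.1], by linarith [ht.2]⟩
    rw [S0_zero, ← Complex.ofReal_sub, Complex.norm_real, Real.norm_eq_abs] at k1
    have k2 := (abs_le.mp k1).1
    have k3 := Finset.sum_filter_add_sum_filter_not F (fun ρ : NZ => T < ρ.1.im ∧ ρ.1.im ≤ 2 * T) (fun ρ => mu ρ * phi (t - ρ.1.im))
    have k4 := h2 A hA2 t (F.filter (fun ρ : NZ => ¬ (T < ρ.1.im ∧ ρ.1.im ≤ 2 * T))) (by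
      intro ρ hρ
      have := (Finset.mem_filter.mp hρ).2
      by_cases hc : T < ρ.1.im
      · have h5 : 2 * T < ρ.1.im := by by_contra h6; exact this ⟨hc, not_lt.mp h6⟩
        exact le_abs.mpr (Or.inr (by linarith [ht.2]))
      · exact le_abs.mpr (Or.inl (by linarith [ht.1, not_lt.mp hc])))
    have k5 : Real.log (A + |t|) ≤ 2 * L := by
      have : 2 * L = Real.log (T ^ 2) := by rw [Real.log_pow, ← hL]; norm_num
      rw [this, abs_of_pos (by linarith [ht.1])]
      exact Real.log_le_log (by linarith [ht.1]) (by nlinarith [ht.2])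
    have k6 : C1 * Real.log (A + |t|) / A ≤ e * eta 0 / 4 * L := by
      calc _ ≤ C1 * (2 * L) / A := by gcongr
        _ = 8 * C1 / A * (L / 4) := by ring
        _ ≤ e * eta 0 * (L / 4) := by gcongr
        _ = _ := by ring
    change _ + _ = _ at k3
    linarith
  have hint : ∀ ρ : NZ, IntervalIntegrable (fun t => mu ρ * phi (t - ρ.1.im)) volume (T + A) (2 * T - A) := fun ρ =>
    Continuous.intervalIntegrable (by have := phi_cont; fun_prop) _ _
  have i1 : ∫ t in (T + A)..(2 * T - A), ((1 - e / 2) * eta 0 * L) ≤ ∫ t in (T + A)..(2 * T - A), ∑ ρ ∈ G, mu ρ * phi (t - ρ.1.im) := by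
    refine intervalIntegral.integral_mono_on (by nlinarith) (by simp) ?_ low
    exact Continuous.intervalIntegrable (by have := phi_cont; fun_prop) _ _
  rw [intervalIntegral.integral_const, intervalIntegral.integral_finsetSum (fun ρ _ => hint ρ), smul_eq_mul] at i1
  have i2 : ∀ ρ : NZ, ∫ t in (T + A)..(2 * T - A), mu ρ * phi (t - ρ.1.im) ≤ mu ρ * (2 * Real.pi * eta 0) := by
    intro ρ
    rw [intervalIntegral.integral_const_mul, intervalIntegral.integral_comp_sub_right, ← phi_integral,
      intervalIntegral.integral_of_le (by nlinarith)]
    exact mul_le_mul_of_nonneg_left (setIntegral_le_integral phi_int (Eventually.of_forall phi_nonneg)) (mu_pos ρ).le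
  have i3 := i1.trans (Finset.sum_le_sum fun ρ _ => i2 ρ)
  rw [← Finset.sum_mul] at i3
  have i4 : (1 - e / 2) * T ≤ 2 * T - A - (T + A) := by linarith
  have i5 : (1 - e / 2) * T * ((1 - e / 2) * eta 0 * L) ≤ (2 * T - A - (T + A)) * ((1 - e / 2) * eta 0 * L) :=
    mul_le_mul_of_nonneg_right i4 (mul_nonneg (mul_nonneg (by linarith) h0.le) (by linarith))
  have i6 : (1 - e) * (T * L) ≤ (1 - e / 2) ^ 2 * (T * L) := mul_le_mul_of_nonneg_right (by nlinarith) (by nlinarith)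
  refine le_of_mul_le_mul_right ?_ h0
  calc _ ≤ (1 - e / 2) ^ 2 * (T * L) * eta 0 := by gcongr
    _ = (1 - e / 2) * T * ((1 - e / 2) * eta 0 * L) := by ring
    _ ≤ _ := i5.trans i3
    _ = _ := by ring

noncomputable def Kc (e : ℝ) : ℝ := (1 + e) / 2 + (1 + e) ^ 2 * (1 / 6 + e / 12) + e
noncomputable def Rc (e : ℝ) : ℝ := Kc e / ((1 - e) ^ 3 * (1 / 2 + e / 3))

open Classical in
lemma pairs_upper {e : ℝ} (he : 0 < e) (he1 : e ≤ 1 / 2) : ∃ A0, ∀ A ≥ A0, ∃ T0, ∀ T ≥ T0, ∀ d F, Good T d F →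
    24 * (d * ((1 - e) * Real.log T)) ^ 2 ≤ e → ∀ G ⊆ F, (∀ ρ ∈ G, T + A ≤ ρ.1.im ∧ ρ.1.im ≤ 2 * T - A) →
    (1 - e) ^ 2 * (1 / 2 + e / 3) * (2 * Real.pi) *
      ∑ ρ ∈ G, ∑ ρ' ∈ G, (if ρ.1.im = ρ'.1.im then mu ρ * mu ρ' else 0) ≤ T * Real.log T * Kc e := by
  obtain ⟨A0, hA0⟩ := phi_sq_trunc he
  obtain ⟨T0, hT0⟩ := upper he he1
  refine ⟨A0, fun A hA => ⟨T0, fun T hT d F hG hd G hGF hGA => ?_⟩⟩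
  obtain ⟨g1, g2⟩ := hG.two
  have hE := E2_pos
  have hY : 0 < (1 - e) * Real.log T := mul_pos (by linarith) (by linarith)
  have h1 := (pos_lower he (by linarith) hY (by linarith) F hG.2.2.1 hd).trans (hT0 T hT d F hG)
  have hI : ∀ ρ : NZ, 0 ≤ ∫ t in T..(2 * T), phi (t - ρ.1.im) ^ 2 := fun ρ =>
    intervalIntegral.integral_nonneg (by linarith) fun t _ => sq_nonneg _
  have hnn : ∀ ρ ρ' : NZ, 0 ≤ (if ρ.1.im = ρ'.1.im then mu ρ * mu ρ' * ∫ t in T..(2 * T), phi (t - ρ.1.im) ^ 2 else 0) := by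
    intro ρ ρ'
    split_ifs
    · exact mul_nonneg (mul_nonneg (mu_pos _).le (mu_pos _).le) (hI ρ)
    · exact le_rfl
  have h2 : (1 - e) * (2 * Real.pi * E2) * ∑ ρ ∈ G, ∑ ρ' ∈ G, (if ρ.1.im = ρ'.1.im then mu ρ * mu ρ' else 0) ≤
      ∑ ρ ∈ F, ∑ ρ' ∈ F, (if ρ.1.im = ρ'.1.im then mu ρ * mu ρ' * ∫ t in T..(2 * T), phi (t - ρ.1.im) ^ 2 else 0) := by
    refine le_trans ?_ (Finset.sum_le_sum_of_subset_of_nonneg hGF fun ρ _ _ => Finset.sum_nonneg fun ρ' _ => hnn ρ ρ')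
    rw [Finset.mul_sum]
    refine Finset.sum_le_sum fun ρ hρ => ?_
    refine le_trans ?_ (Finset.sum_le_sum_of_subset_of_nonneg hGF fun ρ' _ _ => hnn ρ ρ')
    rw [Finset.mul_sum]
    refine Finset.sum_le_sum fun ρ' _ => ?_
    split_ifs
    · rw [mul_comm]
      exact mul_le_mul_of_nonneg_left (hA0 A hA T ρ.1.im (hGA ρ hρ).1 (hGA ρ hρ).2) (mul_nonneg (mu_pos _).le (mu_pos _).le)
    · simp
  have h3 := (mul_le_mul_of_nonneg_left h2 (by positivity : 0 ≤ (1 - e) * Real.log T * (1 / 2 + e / 3))).trans h1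
  have hp : 0 < Real.log T * E2 := mul_pos (by linarith) hE
  refine le_of_mul_le_mul_right ?_ hp
  unfold Kc
  refine le_trans (le_of_eq ?_) (h3.trans (le_of_eq ?_)) <;> ring

open Classical in
lemma main_count {e : ℝ} (he : 0 < e) (he1 : e ≤ 1 / 2) : ∃ T0, ∀ T ≥ T0, ∀ d F, Good T d F →
    24 * (d * ((1 - e) * Real.log T)) ^ 2 ≤ e →
    0 < ∑ ρ ∈ F with T < ρ.1.im ∧ ρ.1.im ≤ 2 * T, mu ρ ∧
    (2 - e - Rc e) * ∑ ρ ∈ F with T < ρ.1.im ∧ ρ.1.im ≤ 2 * T, mu ρ ≤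
      ∑ ρ ∈ F with (T < ρ.1.im ∧ ρ.1.im ≤ 2 * T) ∧ ρ.1.re = 1 / 2, mu ρ := by
  obtain ⟨A0, hA0⟩ := pairs_upper he he1
  set A := max 2 A0 with hAd
  have hA2 : 2 ≤ A := le_max_left _ _
  obtain ⟨T1, hT1⟩ := hA0 A (le_max_right _ _)
  obtain ⟨T2, hT2⟩ := N_lower he he1
  have hpi := Real.pi_pos
  refine ⟨max (max T1 T2) (max (max 3 (2 * A)) (2 * Real.pi * (2 * (64 * A)) / (e * (1 - e)))), fun T hT d F hG hd => ?_⟩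
  have a1 : T1 ≤ T := (le_max_left _ _).trans ((le_max_left _ _).trans hT)
  have a2 : T2 ≤ T := (le_max_right _ _).trans ((le_max_left _ _).trans hT)
  have a3 : 3 ≤ T := (le_max_left _ _).trans ((le_max_left _ _).trans ((le_max_right _ _).trans hT))
  have a4 : 2 * A ≤ T := (le_max_right _ _).trans ((le_max_left _ _).trans ((le_max_right _ _).trans hT))
  have a5 : 2 * Real.pi * (2 * (64 * A)) / (e * (1 - e)) ≤ T := (le_max_right _ _).trans ((le_max_right _ _).trans hT)
  have he' : 0 < 1 - e := by linarith
  rw [div_le_iff₀ (by positivity)] at a5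
  obtain ⟨g1, g2⟩ := hG.two
  have hN := hT2 T a2 d F hG
  set L := Real.log T with hL
  set G := F.filter (fun ρ : NZ => T < ρ.1.im ∧ ρ.1.im ≤ 2 * T) with hGd
  set N := ∑ ρ ∈ G, mu ρ with hNd
  set G' := G.filter (fun ρ : NZ => T + A ≤ ρ.1.im ∧ ρ.1.im ≤ 2 * T - A) with hG'd
  set N' := ∑ ρ ∈ G', mu ρ with hN'd
  have hN0 : 0 < N := by
    have : 0 < (1 - e) * (T * L) := mul_pos he' (by nlinarith)
    by_contra h
    have := mul_nonneg (by positivity : 0 ≤ 2 * Real.pi) (neg_nonneg.mpr (not_lt.mp h))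
    linarith
  refine ⟨hN0, ?_⟩
  have hsymG : ∀ ρ ∈ G', symE ρ ∈ G' := by
    intro ρ hρ
    simp only [hG'd, hGd, Finset.mem_filter, symE_im, hG.2.1] at hρ ⊢
    exact hρ
  have p1 := pairs_lower G' hsymG
  have p2 := hT1 T a1 d F hG hd G' ((Finset.filter_subset _ _).trans (Finset.filter_subset _ _))
    (fun ρ hρ => (Finset.mem_filter.mp hρ).2)
  set P := ∑ ρ ∈ G', ∑ ρ' ∈ G', (if ρ.1.im = ρ'.1.im then mu ρ * mu ρ' else 0) with hP
  have hKc : 0 ≤ Kc e := by unfold Kc; positivity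
  have p3 : P ≤ Rc e * N := by
    have q1 : (1 - e) * ((1 - e) ^ 2 * (1 / 2 + e / 3) * (2 * Real.pi) * P) ≤ 2 * Real.pi * N * Kc e :=
      calc _ ≤ (1 - e) * (T * L * Kc e) := mul_le_mul_of_nonneg_left p2 he'.le
        _ = (1 - e) * (T * L) * Kc e := by ring
        _ ≤ _ := mul_le_mul_of_nonneg_right hN hKc
    unfold Rc
    rw [div_mul_eq_mul_div, le_div_iff₀ (by positivity)]
    refine le_of_mul_le_mul_right ?_ (by positivity : 0 < 2 * Real.pi)
    refine le_trans (le_of_eq ?_) (q1.trans (le_of_eq ?_)) <;> ring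
  have p4 : ∑ ρ ∈ G' with ρ.1.re = 1 / 2, mu ρ ≤ ∑ ρ ∈ F with (T < ρ.1.im ∧ ρ.1.im ≤ 2 * T) ∧ ρ.1.re = 1 / 2, mu ρ := by
    refine Finset.sum_le_sum_of_subset_of_nonneg ?_ (fun ρ _ _ => (mu_pos ρ).le)
    intro ρ hρ
    simp only [hG'd, hGd, Finset.mem_filter] at hρ ⊢
    exact ⟨hρ.1.1.1, hρ.1.1.2, hρ.2⟩
  have hlog : ∀ t, 0 < t → t ≤ 2 * T → Real.log (A + |t|) ≤ 2 * L := by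
    intro t h0 h1
    have : 2 * L = Real.log (T ^ 2) := by rw [Real.log_pow, ← hL]; norm_num
    rw [this, abs_of_pos h0]
    exact Real.log_le_log (by linarith) (by nlinarith)
  have p5 : N ≤ N' + 64 * A * L := by
    have e1 := edge_sum (t := T) hA2 (G.filter fun ρ : NZ => |T - ρ.1.im| ≤ A) (fun ρ hρ => (Finset.mem_filter.mp hρ).2)
    have e2 := edge_sum (t := 2 * T) hA2 (G.filter fun ρ : NZ => |2 * T - ρ.1.im| ≤ A) (fun ρ hρ => (Finset.mem_filter.mp hρ).2)
    have l1 := mul_le_mul_of_nonneg_left (hlog T (by linarith) (by linarith)) (by linarith : 0 ≤ 16 * A)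
    have l2 := mul_le_mul_of_nonneg_left (hlog (2 * T) (by linarith) le_rfl) (by linarith : 0 ≤ 16 * A)
    have e3 : N ≤ N' + ∑ ρ ∈ G.filter (fun ρ : NZ => |T - ρ.1.im| ≤ A), mu ρ + ∑ ρ ∈ G.filter (fun ρ : NZ => |2 * T - ρ.1.im| ≤ A), mu ρ := by
      rw [hNd, hN'd, hG'd, Finset.sum_filter (s := G), Finset.sum_filter (s := G), Finset.sum_filter (s := G), ← Finset.sum_add_distrib, ← Finset.sum_add_distrib]
      refine Finset.sum_le_sum fun ρ hρ => ?_
      have hm := mu_pos ρ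
      have hρ2 := (Finset.mem_filter.mp hρ).2
      by_cases c1 : T + A ≤ ρ.1.im
      · by_cases c2 : ρ.1.im ≤ 2 * T - A
        · rw [if_pos ⟨c1, c2⟩]
          split_ifs <;> linarith
        · rw [if_pos (abs_le.mpr ⟨by linarith, by linarith [not_le.mp c2]⟩ : |2 * T - ρ.1.im| ≤ A)]
          split_ifs <;> linarith
      · rw [if_pos (abs_le.mpr ⟨by linarith [not_le.mp c1], by linarith⟩ : |T - ρ.1.im| ≤ A)]
        split_ifs <;> linarith
    linarith
  have p6 : 2 * (64 * A * L) ≤ e * N := by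
    have q1 : 2 * Real.pi * (2 * (64 * A)) * L ≤ T * (e * (1 - e)) * L := mul_le_mul_of_nonneg_right a5 (by linarith)
    have q2 := mul_le_mul_of_nonneg_left hN he.le
    refine le_of_mul_le_mul_left ?_ (by positivity : 0 < 2 * Real.pi)
    linarith
  linarith

lemma Rc_lim {ε : ℝ} (hε : 0 < ε) : ∃ e, 0 < e ∧ e ≤ 1 / 2 ∧ 2 / 3 - ε ≤ 2 - e - Rc e := by
  have hc : ContinuousAt (fun e => 2 - e - Rc e) 0 := by
    unfold Rc Kc
    refine ContinuousAt.sub (by fun_prop) (ContinuousAt.div (by fun_prop) (by fun_prop) (by norm_num))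
  have h0 : (2 : ℝ) - 0 - Rc 0 = 2 / 3 := by unfold Rc Kc; norm_num
  have h1 := hc.eventually (lt_mem_nhds (by rw [h0]; linarith : 2 / 3 - ε < 2 - 0 - Rc 0))
  have h2 : ∀ᶠ e in 𝓝[>] (0 : ℝ), 2 / 3 - ε < 2 - e - Rc e := h1.filter_mono nhdsWithin_le_nhds
  have h3 : ∀ᶠ e in 𝓝[>] (0 : ℝ), e < 1 / 2 := (gt_mem_nhds (by norm_num)).filter_mono nhdsWithin_le_nhds
  obtain ⟨e, he, he2, he3⟩ := (h2.and (h3.and self_mem_nhdsWithin)).exists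
  exact ⟨e, he3, he2.le, he.le⟩

lemma get_good {b : ℝ → ℝ} (hblim : Tendsto b atTop (nhds 0))
    (hbox : ∀ᶠ T in atTop, ∀ ρ ∈ zeroBand T, |ρ.re - 1/2| < b T / (2 * Real.log T)) {c : ℝ} (hc : 0 < c) (hc1 : c ≤ 1) :
    ∀ᶠ T in atTop, ∃ F : Finset NZ, Good T (c / Real.log T) F := by
  have h1 : ∀ᶠ T in atTop, b T < c ∧ ∀ ρ ∈ zeroBand T, |ρ.re - 1/2| < b T / (2 * Real.log T) :=
    (hblim.eventually (gt_mem_nhds hc)).and hbox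
  have h2 := (tendsto_id.atTop_div_const (by norm_num : (0 : ℝ) < 2)).eventually h1
  have h3 := (tendsto_id.const_mul_atTop (by norm_num : (0 : ℝ) < 2)).eventually h1
  filter_upwards [h1, h2, h3, eventually_ge_atTop (Real.exp 2), eventually_ge_atTop 4] with T k1 k2 k3 hT hT4
  simp only [id] at k2 k3
  have hfin : {ρ : NZ | ρ.1 ∈ Icc (0 : ℝ) 1 ×ℂ Ioc (T / 2) (4 * T)}.Finite :=
    nz_finite' _ ((Metric.isBounded_Icc _ _).reProdIm (Metric.isBounded_Ioc _ _))
  have hmem : ∀ ρ : NZ, ρ ∈ hfin.toFinset ↔ T / 2 < ρ.1.im ∧ ρ.1.im ≤ 4 * T := by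
    intro ρ
    simp only [Finite.mem_toFinset, mem_ofPred_eq, Complex.mem_reProdIm, mem_Icc, mem_Ioc]
    exact ⟨fun h => h.2, fun h => ⟨⟨ρ.2.2.1.le, ρ.2.2.2.le⟩, h⟩⟩
  have hL : 2 ≤ Real.log T := (Real.le_log_iff_exp_le (by linarith)).mpr hT
  have key : ∀ T' : ℝ, T / 2 ≤ T' → b T' < c → b T' / (2 * Real.log T') ≤ c / Real.log T := by
    intro T' h h'
    have q : Real.log T ≤ 2 * Real.log T' := by
      have : 2 * Real.log T' = Real.log (T' ^ 2) := by rw [Real.log_pow]; norm_num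
      rw [this]
      exact Real.log_le_log (by linarith) (by nlinarith)
    calc _ ≤ c / (2 * Real.log T') := div_le_div_of_nonneg_right h'.le (by linarith)
      _ ≤ _ := div_le_div_of_nonneg_left hc.le (by linarith) q
  refine ⟨hfin.toFinset, hT, hmem, fun ρ hρ => ?_, by positivity, ?_, ?_⟩
  · have hr := (hmem ρ).mp hρ
    by_cases c1 : ρ.1.im ≤ T
    · exact (k2.2 ρ.1 ⟨ρ.2, hr.1, by linarith⟩).le.trans (key _ le_rfl k2.1)
    · by_cases c2 : ρ.1.im ≤ 2 * T
      · exact (k1.2 ρ.1 ⟨ρ.2, not_le.mp c1, c2⟩).le.trans (key _ (by linarith) k1.1)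
      · exact (k3.2 ρ.1 ⟨ρ.2, not_le.mp c2, by linarith⟩).le.trans (key _ (by linarith) k3.1)
  · rw [div_le_one (by linarith)]; linarith
  · rw [div_mul_cancel₀ _ (by linarith)]; exact hc1

lemma fs_eq (S : Set ℂ) (G : Finset NZ) (hS : ∀ ρ ∈ S, IsNontrivialZero ρ) (h : ∀ ρ : NZ, ρ ∈ G ↔ ρ.1 ∈ S) :
    ∑ᶠ ρ ∈ S, (zetaMult ρ : ℝ) = ∑ ρ ∈ G, mu ρ := by
  have : S = ((G.map ⟨Subtype.val, Subtype.val_injective⟩ : Finset ℂ) : Set ℂ) := by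
    ext ρ
    simp only [Finset.coe_map, Function.Embedding.coeFn_mk, Set.mem_image, Finset.mem_coe]
    constructor
    · exact fun hρ => ⟨⟨ρ, hS ρ hρ⟩, (h _).mpr hρ, rfl⟩
    · rintro ⟨x, hx, rfl⟩
      exact (h x).mp hx
  rw [this, finsum_mem_coe_finset, Finset.sum_map]
  rfl

open Classical in
lemma final_eps {b : ℝ → ℝ} (hblim : Tendsto b atTop (nhds 0))
    (hbox : ∀ᶠ T in atTop, ∀ ρ ∈ zeroBand T, |ρ.re - 1/2| < b T / (2 * Real.log T)) {ε : ℝ} (hε : 0 < ε) :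
    ∀ᶠ T in atTop, 0 < Ntot T ∧ (2 / 3 - ε) * Ntot T ≤ Nline T := by
  obtain ⟨e, he, he1, hR⟩ := Rc_lim hε
  obtain ⟨T0, hT0⟩ := main_count he he1
  filter_upwards [get_good hblim hbox (c := e / 5) (by positivity) (by linarith), eventually_ge_atTop T0] with T ⟨F, hF⟩ hT
  obtain ⟨g1, g2⟩ := hF.two
  have hd : 24 * (e / 5 / Real.log T * ((1 - e) * Real.log T)) ^ 2 ≤ e := by
    have : e / 5 / Real.log T * ((1 - e) * Real.log T) = e / 5 * (1 - e) := by
      field_simp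
    rw [this]
    have h1 : (1 - e) ^ 2 ≤ 1 := by nlinarith
    have h2 : (e / 5 * (1 - e)) ^ 2 ≤ (e / 5) ^ 2 := by rw [mul_pow]; nlinarith [sq_nonneg (e / 5)]
    nlinarith
  obtain ⟨m1, m2⟩ := hT0 T hT _ F hF hd
  have e1 : Ntot T = ∑ ρ ∈ F with T < ρ.1.im ∧ ρ.1.im ≤ 2 * T, mu ρ := by
    refine fs_eq _ _ (fun ρ hρ => hρ.1) fun ρ => ?_
    rw [Finset.mem_filter, hF.2.1]
    exact ⟨fun h => ⟨ρ.2, h.2⟩, fun h => ⟨⟨by linarith [h.2.1], by linarith [h.2.2]⟩, h.2⟩⟩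
  have e2 : Nline T = ∑ ρ ∈ F with (T < ρ.1.im ∧ ρ.1.im ≤ 2 * T) ∧ ρ.1.re = 1 / 2, mu ρ := by
    refine fs_eq _ _ (fun ρ hρ => hρ.1.1) fun ρ => ?_
    rw [Finset.mem_filter, hF.2.1]
    exact ⟨fun h => ⟨⟨ρ.2, h.2.1⟩, h.2.2⟩, fun h => ⟨⟨by linarith [h.1.2.1], by linarith [h.1.2.2]⟩, h.1.2, h.2⟩⟩
  rw [e1, e2]
  exact ⟨m1, (mul_le_mul_of_nonneg_right hR m1.le).trans m2⟩

theorem two_thirds_critical (b : ℝ → ℝ) (hbpos : ∀ T, 0 < b T)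
    (hblim : Tendsto b atTop (nhds 0))
    (hbox : ∀ᶠ T in atTop, ∀ ρ ∈ zeroBand T, |ρ.re - 1/2| < b T / (2 * Real.log T)) :
    ∃ ε : ℝ → ℝ, Tendsto ε atTop (nhds 0) ∧
      ∀ᶠ T in atTop, (2/3 + ε T) * Ntot T ≤ Nline T := by
  refine ⟨fun T => min 0 (Nline T / Ntot T - 2 / 3), ?_, ?_⟩
  · rw [Metric.tendsto_nhds]
    intro η hη
    filter_upwards [final_eps hblim hbox (half_pos hη)] with T ⟨h1, h2⟩
    rw [← le_div_iff₀ h1] at h2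
    rw [Real.dist_eq, sub_zero, abs_of_nonpos (min_le_left _ _)]
    have : -(η / 2) ≤ min 0 (Nline T / Ntot T - 2 / 3) := le_min (by linarith) (by linarith)
    linarith
  · filter_upwards [final_eps hblim hbox one_pos] with T ⟨h1, h2⟩
    have h3 := min_le_right 0 (Nline T / Ntot T - 2 / 3)
    calc _ ≤ (Nline T / Ntot T) * Ntot T := mul_le_mul_of_nonneg_right (by linarith) h1.le
      _ = _ := div_mul_cancel₀ _ h1.ne'
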